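/- arXiv:2506.23264 — 2 statements merged into one kernel-verified Lean document; each statement's English description precedes it below -/
import Mathlib

section
/- For any integer k ≥ 3, there exist a constant γ ∈ (0, 1/2) and an integer n₀ such that for all n ≥ n₀, there exist k-uniform hypergraphs G and H on n vertices whose densities e(G)/C(n,k) and e(H)/C(n,k) both lie in the open interval (γ, 1−γ), and which satisfy disc(G,H) = 0. -/
open Finset

/-- Image of the edge set of a hypergraph under a vertex permutation. -/
def permEdges {n : ℕ} (σ : Equiv.Perm (Fin n)) (G : Finset (Finset (Fin n))) :
    Finset (Finset (Fin n)) := G.image (fun e => e.image σ)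

/-- Relative discrepancy of two k-uniform hypergraphs on n vertices:
the maximum over all relabelings G' ≅ G, H' ≅ H on the same vertex set of
| |E(G') ∩ E(H')| - p q C(n,k) |, where p q C(n,k) = e(G) e(H) / C(n,k). -/
noncomputable def disc (n k : ℕ) (G H : Finset (Finset (Fin n))) : ℝ :=
  ⨆ p : Equiv.Perm (Fin n) × Equiv.Perm (Fin n),
    |((permEdges p.1 G ∩ permEdges p.2 H).card : ℝ) -
      ((G.card : ℝ) * H.card) / (n.choose k)|


/-- Degree of a `(k-1)`-set `T` in the integer weighting `F`. -/
def dg {n : ℕ} (F : Finset (Fin n) → ℤ) (T : Finset (Fin n)) : ℤ :=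
  ∑ x ∈ Tᶜ, F (insert x T)

/-- The edges of an octahedron. -/
def oct {n k : ℕ} (x y : Fin k → Fin n) (I : Finset (Fin k)) : Finset (Fin n) :=
  univ.image (fun i => if i ∈ I then y i else x i)

lemma oct_map_inj {n k : ℕ} {x y : Fin k → Fin n} (h : Function.Injective (Sum.elim x y))
    (I : Finset (Fin k)) : Function.Injective (fun i => if i ∈ I then y i else x i) := by
  intro i j hij
  by_cases hi : i ∈ I <;> by_cases hj : j ∈ I <;> simp only [hi, hj, if_true, if_false] at hij
  · exact Sum.inr.inj (h (a₁ := Sum.inr i) (a₂ := Sum.inr j) hij)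
  · exact absurd (h (a₁ := Sum.inr i) (a₂ := Sum.inl j) hij) (by simp)
  · exact absurd (h (a₁ := Sum.inl i) (a₂ := Sum.inr j) hij) (by simp)
  · exact Sum.inl.inj (h (a₁ := Sum.inl i) (a₂ := Sum.inl j) hij)

lemma oct_card {n k : ℕ} {x y : Fin k → Fin n} (h : Function.Injective (Sum.elim x y))
    (I : Finset (Fin k)) : (oct x y I).card = k := by
  rw [oct, card_image_of_injective _ (oct_map_inj h I)]; simp

lemma oct_free {n k : ℕ} {x y : Fin k → Fin n} (h : Function.Injective (Sum.elim x y))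
    (T : Finset (Fin n)) (hT : T.card < k) : ∃ i, x i ∉ T ∧ y i ∉ T := by
  by_contra hc
  push Not at hc
  let I : Finset (Fin k) := univ.filter (fun i => x i ∉ T)
  have : oct x y I ⊆ T := by
    intro v hv
    simp only [oct, mem_image, mem_univ, true_and] at hv
    obtain ⟨i, rfl⟩ := hv
    by_cases hi : x i ∈ T
    · simp [I, hi]
    · simp [I, hi, hc i hi]
  have := card_le_card this
  rw [oct_card h] at this
  omega

lemma oct_sum {n k : ℕ} {x y : Fin k → Fin n} (h : Function.Injective (Sum.elim x y))
    (T : Finset (Fin n)) (hT : T.card < k) :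
    ∑ I : Finset (Fin k), (-1 : ℤ) ^ I.card * (if T ⊆ oct x y I then 1 else 0) = 0 := by
  obtain ⟨i, hx, hy⟩ := oct_free h T hT
  have key : ∀ I : Finset (Fin k), i ∉ I → (T ⊆ oct x y I ↔ T ⊆ oct x y (insert i I)) := by
    intro I hi
    constructor
    · intro hs v hv
      have := hs hv
      simp only [oct, mem_image, mem_univ, true_and] at this ⊢
      obtain ⟨j, hj⟩ := this
      have hji : j ≠ i := by
        rintro rfl
        simp [hi] at hj
        exact hx (hj ▸ hv)
      exact ⟨j, by simpa [hji] using hj⟩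
    · intro hs v hv
      have := hs hv
      simp only [oct, mem_image, mem_univ, true_and] at this ⊢
      obtain ⟨j, hj⟩ := this
      have hji : j ≠ i := by
        rintro rfl
        simp at hj
        exact hy (hj ▸ hv)
      exact ⟨j, by simpa [hji] using hj⟩
  have hu : (univ : Finset (Finset (Fin k))) = (insert i (univ.erase i)).powerset := by
    simp
  rw [hu, Finset.sum_powerset_insert (by simp)]
  rw [← sum_add_distrib]
  apply sum_eq_zero
  intro I hI
  have hi : i ∉ I := fun hh => by
    have := mem_powerset.1 hI hh
    simp at this
  rw [card_insert_of_notMem hi]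
  simp only [key I hi, pow_succ]
  ring

lemma dg_single {n : ℕ} (f T : Finset (Fin n)) (c : ℤ) (h : f.card = T.card + 1) :
    dg (fun g => if g = f then c else 0) T = if T ⊆ f then c else 0 := by
  unfold dg
  split_ifs with hs
  · have : (f \ T).card = 1 := by rw [card_sdiff_of_subset hs]; omega
    obtain ⟨v, hv⟩ := card_eq_one.1 this
    have hvf : v ∈ f \ T := by rw [hv]; simp
    have hvf' := mem_sdiff.1 hvf
    have hins : insert v T = f := by
      apply eq_of_subset_of_card_le
      · exact insert_subset hvf'.1 hs
      · rw [card_insert_of_notMem hvf'.2]; omega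
    rw [sum_eq_single v]
    · simp [hins]
    · intro b hb hbv
      refine if_neg ?_
      intro hh
      have : b ∈ f \ T := by
        rw [mem_sdiff]
        exact ⟨hh ▸ mem_insert_self _ _, by simpa using hb⟩
      rw [hv] at this
      exact hbv (by simpa using this)
    · intro hb
      simp at hb
      exact absurd hb hvf'.2
  · apply sum_eq_zero
    intro b _
    refine if_neg ?_
    rintro rfl
    exact hs (subset_insert _ _)

lemma dg_add {n : ℕ} (F G : Finset (Fin n) → ℤ) (T : Finset (Fin n)) :
    dg (fun f => F f + G f) T = dg F T + dg G T := by
  simp [dg, sum_add_distrib]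

lemma dg_sum {n : ℕ} {ι : Type*} (s : Finset ι) (F : ι → Finset (Fin n) → ℤ)
    (T : Finset (Fin n)) :
    dg (fun f => ∑ j ∈ s, F j f) T = ∑ j ∈ s, dg (F j) T := by
  simp only [dg]
  exact sum_comm

lemma dg_mul {n : ℕ} (c : ℤ) (F : Finset (Fin n) → ℤ) (T : Finset (Fin n)) :
    dg (fun f => c * F f) T = c * dg F T := by
  simp [dg, mul_sum]

/-- The octahedron minus its base edge, as a weighting equivalent to the base edge. -/
def octW {n k : ℕ} (x y : Fin k → Fin n) (f : Finset (Fin n)) : ℤ :=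
  ∑ I ∈ univ.erase (∅ : Finset (Fin k)), (if f = oct x y I then -(-1 : ℤ) ^ I.card else 0)

lemma oct_empty {n k : ℕ} (x y : Fin k → Fin n) : oct x y ∅ = univ.image x := by
  simp [oct]

lemma dg_octW {n k : ℕ} {x y : Fin k → Fin n} (h : Function.Injective (Sum.elim x y))
    (T : Finset (Fin n)) (hT : T.card + 1 = k) :
    dg (octW x y) T = if T ⊆ univ.image x then 1 else 0 := by
  have h0 := oct_sum h T (by omega)
  rw [← Finset.add_sum_erase _ _ (mem_univ ∅), oct_empty] at h0
  have : dg (octW x y) T = ∑ I ∈ univ.erase (∅ : Finset (Fin k)),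
      (if T ⊆ oct x y I then -(-1 : ℤ) ^ I.card else 0) := by
    unfold octW
    rw [dg_sum]
    apply sum_congr rfl
    intro I _
    rw [dg_single _ _ _ (by rw [oct_card h, hT])]
  rw [this]
  have h2 : ∑ I ∈ univ.erase (∅ : Finset (Fin k)),
      (if T ⊆ oct x y I then -(-1 : ℤ) ^ I.card else 0) =
      - ∑ I ∈ univ.erase (∅ : Finset (Fin k)),
        (-1 : ℤ) ^ I.card * (if T ⊆ oct x y I then 1 else 0) := by
    rw [← sum_neg_distrib]
    apply sum_congr rfl
    intro I _
    split_ifs <;> ring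
  rw [h2]
  simp at h0 ⊢
  linarith

lemma oct_mem_y {n k : ℕ} {x y : Fin k → Fin n} (h : Function.Injective (Sum.elim x y))
    (I : Finset (Fin k)) (i : Fin k) : y i ∈ oct x y I ↔ i ∈ I := by
  simp only [oct, mem_image, mem_univ, true_and]
  constructor
  · rintro ⟨j, hj⟩
    by_cases hjI : j ∈ I
    · simp only [hjI, if_true] at hj
      have := Sum.inr.inj (h (a₁ := Sum.inr j) (a₂ := Sum.inr i) hj)
      exact this ▸ hjI
    · simp only [hjI, if_false] at hj
      exact absurd (h (a₁ := Sum.inl j) (a₂ := Sum.inr i) hj) (by simp)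
  · intro hi
    exact ⟨i, by simp [hi]⟩

lemma oct_inj {n k : ℕ} {x y : Fin k → Fin n} (h : Function.Injective (Sum.elim x y)) :
    Function.Injective (oct x y) := by
  intro I J hIJ
  ext i
  rw [← oct_mem_y h, ← oct_mem_y h, hIJ]

lemma oct_subset {n k : ℕ} (x y : Fin k → Fin n) (I : Finset (Fin k)) :
    oct x y I ⊆ univ.image x ∪ univ.image y := by
  intro v hv
  simp only [oct, mem_image, mem_univ, true_and, mem_union] at hv ⊢
  obtain ⟨i, rfl⟩ := hv
  by_cases hi : i ∈ I
  · right; exact ⟨i, by simp [hi]⟩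
  · left; exact ⟨i, by simp [hi]⟩

lemma oct_color {n k : ℕ} {x y : Fin k → Fin n} (h : Function.Injective (Sum.elim x y))
    {G : Type*} [AddCommGroup G] (c : Fin n → G) (I : Finset (Fin k)) :
    ∑ v ∈ oct x y I, c v = ∑ v ∈ univ.image x, c v + ∑ i ∈ I, (c (y i) - c (x i)) := by
  rw [← oct_empty x y, oct, oct, sum_image (fun a _ b _ hab => oct_map_inj h I hab),
    sum_image (fun a _ b _ hab => oct_map_inj h ∅ hab)]
  have : ∑ i ∈ I, (c (y i) - c (x i)) = ∑ i, (if i ∈ I then c (y i) - c (x i) else 0) := by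
    simp
  rw [this, ← sum_add_distrib]
  apply sum_congr rfl
  intro i _
  by_cases hi : i ∈ I <;> simp [hi]


/-- Maps whose coordinates in `I` land in `U`. -/
def boxF {n k : ℕ} (I : Finset (Fin k)) (U : Finset (Fin n)) : Finset (Fin k → Fin n) :=
  Fintype.piFinset (fun i => if i ∈ I then U else univ)

lemma mem_boxF {n k : ℕ} (I : Finset (Fin k)) (U : Finset (Fin n)) (y : Fin k → Fin n) :
    y ∈ boxF I U ↔ ∀ i ∈ I, y i ∈ U := by
  simp only [boxF, Fintype.mem_piFinset]
  apply forall_congr'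
  intro i
  by_cases hi : i ∈ I <;> simp [hi]

lemma card_boxF {n k : ℕ} (I : Finset (Fin k)) (U : Finset (Fin n)) :
    (boxF I U).card = U.card ^ I.card * n ^ (k - I.card) := by
  simp only [boxF, Fintype.card_piFinset]
  have : ∀ i : Fin k, (if i ∈ I then U else univ).card = if i ∈ I then U.card else n := by
    intro i; by_cases hi : i ∈ I <;> simp [hi]
  simp only [this]
  rw [prod_ite]
  simp only [prod_const]
  congr 2
  · congr 1; ext; simp
  · have := card_compl I
    rw [Fintype.card_fin] at this
    rw [← this]
    congr 1; ext; simp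

lemma greedy_step {n k : ℕ} (δ B : ℝ) (hB : 0 ≤ B) (hδ : 0 < δ)
    (Sat : Finset (Finset (Fin n)))
    (hSat : ∀ A : Finset (Fin n), ∀ u : ℕ, A.card < u → u ≤ k →
      ((Sat.filter (fun U => A ⊆ U ∧ U.card = u)).card : ℝ) ≤ B * (n : ℝ) ^ (u - A.card))
    (a : Finset (Fin n)) (ha : a.card ≤ k) (C : Fin k → Finset (Fin n))
    (hC : ∀ i, δ * n ≤ (C i).card)
    (hnum : 2 * (k : ℝ) ^ 2 * (n : ℝ) ^ (k - 1) + (4 : ℝ) ^ k * ((k : ℝ) ^ k * B * (n : ℝ) ^ k)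
      < (δ * n) ^ k) :
    ∃ y : Fin k → Fin n, (∀ i, y i ∈ C i) ∧ Function.Injective y ∧ (∀ i, y i ∉ a) ∧
      ∀ U, U ⊆ a ∪ univ.image y → ¬ U ⊆ a → U.card ≤ k → U ∉ Sat := by
  classical
  let Bad1 : Finset (Fin k → Fin n) :=
    ((univ : Finset (Fin k × Fin k)).filter (fun p => p.1 ≠ p.2)).biUnion
      (fun p => (univ : Finset (Fin n)).biUnion (fun v => boxF {p.1, p.2} {v}))
  let Bad2 : Finset (Fin k → Fin n) :=
    (univ : Finset (Fin k)).biUnion (fun i => a.biUnion (fun v => boxF {i} {v}))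
  let Bad3 : Finset (Fin k → Fin n) :=
    (a.powerset ×ˢ (univ : Finset (Finset (Fin k)))).biUnion (fun p =>
      if p.2.Nonempty ∧ p.1.card + p.2.card ≤ k then
        (Sat.filter (fun U => p.1 ⊆ U ∧ U.card = p.1.card + p.2.card)).biUnion
          (fun U => boxF p.2 U)
      else ∅)
  have hb1 : (Bad1.card : ℝ) ≤ (k : ℝ) ^ 2 * (n : ℝ) ^ (k - 1) := by
    have : Bad1.card ≤ k ^ 2 * n ^ (k - 1) := by
      refine (card_biUnion_le_card_mul _ _ (n ^ (k - 1)) ?_).trans ?_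
      · intro p hp
        have hp' : p.1 ≠ p.2 := by simpa using hp
        refine (card_biUnion_le_card_mul _ _ (n ^ (k - 2)) ?_).trans ?_
        · intro v _
          rw [card_boxF, card_pair hp']
          simp
        · have hk2 : 2 ≤ k := by
            have := card_le_univ ({p.1, p.2} : Finset (Fin k))
            rw [card_pair hp'] at this
            simpa using this
          simp only [card_univ, Fintype.card_fin]
          rw [← pow_succ']
          apply le_of_eq
          congr 1
          omega
      · apply Nat.mul_le_mul_right
        refine (card_le_univ _).trans ?_
        simp [sq]
    exact_mod_cast this
  have hb2 : (Bad2.card : ℝ) ≤ (k : ℝ) ^ 2 * (n : ℝ) ^ (k - 1) := by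
    have : Bad2.card ≤ k * (k * n ^ (k - 1)) := by
      refine (card_biUnion_le_card_mul _ _ (k * n ^ (k - 1)) ?_).trans ?_
      · intro i _
        refine (card_biUnion_le_card_mul _ _ (n ^ (k - 1)) ?_).trans ?_
        · intro v _
          rw [card_boxF]
          simp
        · exact Nat.mul_le_mul_right _ ha
      · simp
    calc (Bad2.card : ℝ) ≤ ((k * (k * n ^ (k - 1)) : ℕ) : ℝ) := by exact_mod_cast this
      _ = _ := by push_cast; ring
  have hb3 : (Bad3.card : ℝ) ≤ (4 : ℝ) ^ k * ((k : ℝ) ^ k * B * (n : ℝ) ^ k) := by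
    have h1 : (Bad3.card : ℝ) ≤ ∑ p ∈ a.powerset ×ˢ (univ : Finset (Finset (Fin k))),
        ((k : ℝ) ^ k * B * (n : ℝ) ^ k) := by
      refine (Nat.cast_le.2 card_biUnion_le).trans ?_
      push_cast
      apply sum_le_sum
      intro p hp
      split_ifs with hc
      · obtain ⟨hne, hle⟩ := hc
        have hpos : 0 < p.2.card := hne.card_pos
        have h2 := hSat p.1 (p.1.card + p.2.card) (by omega) hle
        have hkk : p.2.card ≤ k := by omega
        have h3 : ((Sat.filter (fun U => p.1 ⊆ U ∧ U.card = p.1.card + p.2.card)).biUnion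
          (fun U => boxF p.2 U)).card ≤
            (Sat.filter (fun U => p.1 ⊆ U ∧ U.card = p.1.card + p.2.card)).card *
              (k ^ k * n ^ (k - p.2.card)) := by
          apply card_biUnion_le_card_mul
          intro U hU
          rw [card_boxF]
          apply Nat.mul_le_mul_right
          have : U.card ≤ k := by
            have := (mem_filter.1 hU).2.2
            omega
          calc U.card ^ p.2.card ≤ k ^ p.2.card := Nat.pow_le_pow_left this _
            _ ≤ k ^ k := Nat.pow_le_pow_right (by omega) hkk
        refine (Nat.cast_le.2 h3).trans ?_
        push_cast
        rw [show p.1.card + p.2.card - p.1.card = p.2.card by omega] at h2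
        calc _ ≤ (B * (n : ℝ) ^ p.2.card) * ((k : ℝ) ^ k * (n : ℝ) ^ (k - p.2.card)) := by
              gcongr
          _ = (k : ℝ) ^ k * B * ((n : ℝ) ^ p.2.card * (n : ℝ) ^ (k - p.2.card)) := by ring
          _ = _ := by rw [← pow_add, Nat.add_sub_cancel' hkk]
      · simp only [card_empty, Nat.cast_zero]
        positivity
    refine h1.trans ?_
    rw [sum_const, nsmul_eq_mul]
    gcongr
    rw [card_product, card_powerset, card_univ, Fintype.card_finset, Fintype.card_fin]
    push_cast
    calc (2 : ℝ) ^ a.card * 2 ^ k ≤ 2 ^ k * 2 ^ k := by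
          gcongr
          norm_num
      _ = 4 ^ k := by rw [← mul_pow]; norm_num
  have hcard : (δ * n) ^ k ≤ ((Fintype.piFinset C).card : ℝ) := by
    rw [Fintype.card_piFinset]
    push_cast
    calc (δ * n) ^ k = ∏ _i : Fin k, (δ * n) := by simp
      _ ≤ _ := prod_le_prod (fun _ _ => by positivity) (fun i _ => hC i)
  have hlt : (Bad1 ∪ Bad2 ∪ Bad3).card < (Fintype.piFinset C).card := by
    have h1 : (Bad1 ∪ Bad2 ∪ Bad3).card ≤ Bad1.card + Bad2.card + Bad3.card :=
      (card_union_le _ _).trans (Nat.add_le_add_right (card_union_le _ _) _)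
    have h2 : (((Bad1 ∪ Bad2 ∪ Bad3).card : ℕ) : ℝ) ≤ Bad1.card + Bad2.card + Bad3.card := by
      exact_mod_cast h1
    have : (((Bad1 ∪ Bad2 ∪ Bad3).card : ℕ) : ℝ) < ((Fintype.piFinset C).card : ℝ) := by
      linarith
    exact_mod_cast this
  obtain ⟨y, hyC, hyB⟩ := exists_mem_notMem_of_card_lt_card hlt
  simp only [mem_union, not_or] at hyB
  obtain ⟨⟨hy1, hy2⟩, hy3⟩ := hyB
  have hinj : Function.Injective y := by
    intro i j hij
    by_contra hne
    apply hy1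
    simp only [Bad1, mem_biUnion, mem_filter, mem_univ, true_and]
    exact ⟨(i, j), hne, y i, by rw [mem_boxF]; simp [hij]⟩
  have hna : ∀ i, y i ∉ a := by
    intro i hi
    apply hy2
    simp only [Bad2, mem_biUnion, mem_univ, true_and]
    exact ⟨i, y i, hi, by rw [mem_boxF]; simp⟩
  refine ⟨y, fun i => Fintype.mem_piFinset.1 hyC i, hinj, hna, ?_⟩
  intro U hU hUa hUk hUS
  apply hy3
  simp only [Bad3, mem_biUnion]
  let I : Finset (Fin k) := univ.filter (fun i => y i ∈ U)
  have hUeq : U \ a = I.image y := by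
    ext v
    simp only [mem_sdiff, mem_image, I, mem_filter, mem_univ, true_and]
    constructor
    · rintro ⟨h1, h2⟩
      have := hU h1
      simp only [mem_union, mem_image, mem_univ, true_and] at this
      rcases this with h | ⟨i, rfl⟩
      · exact absurd h h2
      · exact ⟨i, h1, rfl⟩
    · rintro ⟨i, h1, rfl⟩
      exact ⟨h1, hna i⟩
  have hIc : (U \ a).card = I.card := by rw [hUeq, card_image_of_injective _ hinj]
  have hsum : U.card = (U ∩ a).card + I.card := by
    rw [← hIc]; exact (card_inter_add_card_sdiff U a).symm
  have hne : I.Nonempty := by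
    rw [← card_pos, ← hIc, card_pos]
    exact sdiff_nonempty.2 hUa
  refine ⟨(U ∩ a, I), by simp, ?_⟩
  rw [if_pos ⟨hne, by simp only; omega⟩]
  simp only [mem_biUnion, mem_filter]
  exact ⟨U, ⟨hUS, inter_subset_left, hsum⟩, by rw [mem_boxF]; intro i hi; simpa [I] using hi⟩


lemma greedy_num (k : ℕ) (hk : 1 ≤ k) (δ ε' : ℝ) (hδ : 0 < δ) (hε' : 0 < ε') :
    ∃ ρ : ℝ, 0 < ρ ∧ ρ ≤ 1 ∧ 2 * ρ ≤ ε' ∧ ∃ n₀ : ℕ, ∀ n : ℕ, n₀ ≤ n → 2 ≤ ρ * n ∧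
      2 * (k : ℝ) ^ 2 * (n : ℝ) ^ (k - 1) +
        (4 : ℝ) ^ k * ((k : ℝ) ^ k * (4 ^ (k + 1) * ρ) * (n : ℝ) ^ k) < (δ * n) ^ k := by
  set K : ℝ := (4 : ℝ) ^ k * ((k : ℝ) ^ k * 4 ^ (k + 1)) with hK
  have hkpos : (0 : ℝ) < k := by exact_mod_cast hk
  have hKpos : 0 < K := by positivity
  have hdk : 0 < δ ^ k := by positivity
  obtain ⟨ρ, hρ0, hρ⟩ : ∃ ρ : ℝ, 0 < ρ ∧ ρ ≤ 1 ∧ 2 * ρ ≤ ε' ∧ K * ρ ≤ δ ^ k / 2 := by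
    refine ⟨min 1 (min (ε' / 2) (δ ^ k / 2 / K)), by positivity, min_le_left _ _, ?_, ?_⟩
    · have : min 1 (min (ε' / 2) (δ ^ k / 2 / K)) ≤ ε' / 2 :=
        (min_le_right _ _).trans (min_le_left _ _)
      linarith
    · have : min 1 (min (ε' / 2) (δ ^ k / 2 / K)) ≤ δ ^ k / 2 / K :=
        (min_le_right _ _).trans (min_le_right _ _)
      calc K * _ ≤ K * (δ ^ k / 2 / K) := by gcongr
        _ = _ := by field_simp
  refine ⟨ρ, hρ0, hρ.1, hρ.2.1, ?_⟩
  obtain ⟨n1, hn1⟩ := exists_nat_gt (2 / ρ)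
  obtain ⟨n2, hn2⟩ := exists_nat_gt (2 * (k : ℝ) ^ 2 / (δ ^ k / 2))
  refine ⟨max n1 n2 + 1, fun n hn => ?_⟩
  have h1 : (n1 : ℝ) ≤ n := by exact_mod_cast (by omega)
  have h2 : (n2 : ℝ) ≤ n := by exact_mod_cast (by omega)
  have hn0 : (0 : ℝ) < n := by exact_mod_cast (by omega)
  constructor
  · have : 2 / ρ < n := hn1.trans_le h1
    rw [div_lt_iff₀ hρ0] at this
    linarith
  · have h3 : 2 * (k : ℝ) ^ 2 / (δ ^ k / 2) < n := hn2.trans_le h2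
    rw [div_lt_iff₀ (by positivity)] at h3
    have hnk : (n : ℝ) ^ k = n * (n : ℝ) ^ (k - 1) := by
      rw [← pow_succ']; congr 1; omega
    have h4 : 2 * (k : ℝ) ^ 2 * (n : ℝ) ^ (k - 1) < δ ^ k / 2 * (n : ℝ) ^ k := by
      rw [hnk]
      have : (0 : ℝ) < (n : ℝ) ^ (k - 1) := by positivity
      nlinarith
    have h5 : (4 : ℝ) ^ k * ((k : ℝ) ^ k * (4 ^ (k + 1) * ρ) * (n : ℝ) ^ k) =
        (K * ρ) * (n : ℝ) ^ k := by rw [hK]; ring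
    rw [h5, mul_pow]
    have : (K * ρ) * (n : ℝ) ^ k ≤ δ ^ k / 2 * (n : ℝ) ^ k := by
      gcongr
      exact hρ.2.2
    linarith

lemma greedy_sat {n k : ℕ} (hk : 1 ≤ k) {ι : Type} [DecidableEq ι] (S : Finset ι)
    (a X : ι → Finset (Fin n)) (hX : ∀ j, (X j).card ≤ 2 * k) (ρ : ℝ) (hρ : 0 < ρ) (hρ1 : ρ ≤ 1)
    (hρn : 2 ≤ ρ * n)
    (hD : ∀ U : Finset (Fin n), U.card < k →
      ((S.filter (fun j => U ⊆ a j)).card : ℝ) ≤ ρ ^ k * (n : ℝ) ^ (k - U.card))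
    (hN : ∀ U : Finset (Fin n), U.card ≤ k →
      ((S.filter (fun j => U ⊆ X j ∧ ¬ U ⊆ a j)).card : ℝ) ≤ (ρ * n) ^ (k - U.card))
    (A : Finset (Fin n)) (u : ℕ) (hAu : A.card < u) (huk : u ≤ k) :
    (((univ.filter (fun U : Finset (Fin n) =>
      (ρ * n) ^ (k - U.card) < ((S.filter (fun j => U ⊆ X j ∧ ¬ U ⊆ a j)).card : ℝ) + 1)).filter
        (fun U => A ⊆ U ∧ U.card = u)).card : ℝ) ≤ (4 ^ (k + 1) * ρ) * (n : ℝ) ^ (u - A.card) := by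
  classical
  set Q := (univ.filter (fun U : Finset (Fin n) =>
      (ρ * n) ^ (k - U.card) < ((S.filter (fun j => U ⊆ X j ∧ ¬ U ⊆ a j)).card : ℝ) + 1)).filter
        (fun U => A ⊆ U ∧ U.card = u) with hQ
  have hn0 : (0 : ℝ) < n := by
    by_contra h
    nlinarith
  have hlow : ∀ U ∈ Q, (ρ * n) ^ (k - u) / 2 ≤
      ((S.filter (fun j => U ⊆ X j ∧ ¬ U ⊆ a j)).card : ℝ) := by
    intro U hU
    simp only [hQ, mem_filter, mem_univ, true_and] at hU
    obtain ⟨h1, h2, h3⟩ := hU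
    rw [h3] at h1
    rcases Nat.eq_or_lt_of_le huk with h | h
    · subst h
      simp only [Nat.sub_self, pow_zero] at h1 ⊢
      have : 0 < (S.filter (fun j => U ⊆ X j ∧ ¬ U ⊆ a j)).card := by
        have : (0 : ℝ) < ((S.filter (fun j => U ⊆ X j ∧ ¬ U ⊆ a j)).card : ℝ) := by linarith
        exact_mod_cast this
      have : (1 : ℝ) ≤ ((S.filter (fun j => U ⊆ X j ∧ ¬ U ⊆ a j)).card : ℝ) := by
        exact_mod_cast this
      linarith
    · have : 2 ≤ (ρ * n) ^ (k - u) :=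
        hρn.trans (le_self_pow₀ (by linarith) (by omega))
      linarith
  have hcount : ∑ U ∈ Q, (S.filter (fun j => U ⊆ X j ∧ ¬ U ⊆ a j)).card ≤
      (S.filter (fun j => A ⊆ X j)).card * 4 ^ k := by
    calc ∑ U ∈ Q, (S.filter (fun j => U ⊆ X j ∧ ¬ U ⊆ a j)).card
        = ∑ j ∈ S, (Q.filter (fun U => U ⊆ X j ∧ ¬ U ⊆ a j)).card :=
          Finset.sum_card_bipartiteAbove_eq_sum_card_bipartiteBelow _
      _ ≤ ∑ j ∈ S, (if A ⊆ X j then 4 ^ k else 0) := by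
          apply sum_le_sum
          intro j _
          split_ifs with hA
          · calc _ ≤ (X j).powerset.card := by
                  apply card_le_card
                  intro U hU
                  rw [mem_powerset]
                  exact (mem_filter.1 hU).2.1
              _ = 2 ^ (X j).card := card_powerset _
              _ ≤ 2 ^ (2 * k) := Nat.pow_le_pow_right (by norm_num) (hX j)
              _ = 4 ^ k := by rw [pow_mul]; norm_num
          · rw [Nat.le_zero, card_eq_zero, filter_eq_empty_iff]
            intro U hU hU2
            simp only [hQ, mem_filter, mem_univ, true_and] at hU
            exact hA (hU.2.1.trans hU2.1)
      _ = _ := by rw [← sum_filter, sum_const, smul_eq_mul]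
  have hAX : ((S.filter (fun j => A ⊆ X j)).card : ℝ) ≤ 2 * (ρ * n) ^ (k - A.card) := by
    have h1 : (S.filter (fun j => A ⊆ X j)).card ≤ (S.filter (fun j => A ⊆ a j)).card +
        (S.filter (fun j => A ⊆ X j ∧ ¬ A ⊆ a j)).card := by
      refine (card_le_card ?_).trans (card_union_le _ _)
      intro j hj
      simp only [mem_filter, mem_union] at hj ⊢
      tauto
    have h2 := hD A (by omega)
    have h3 := hN A (by omega)
    have h4 : ρ ^ k * (n : ℝ) ^ (k - A.card) ≤ (ρ * n) ^ (k - A.card) := by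
      rw [mul_pow]
      gcongr ?_ * _
      exact pow_le_pow_of_le_one hρ.le hρ1 (by omega)
    have h5 : ((S.filter (fun j => A ⊆ X j)).card : ℝ) ≤ (S.filter (fun j => A ⊆ a j)).card +
        (S.filter (fun j => A ⊆ X j ∧ ¬ A ⊆ a j)).card := by exact_mod_cast h1
    linarith
  have hfin : (Q.card : ℝ) * ((ρ * n) ^ (k - u) / 2) ≤ 2 * (ρ * n) ^ (k - A.card) * 4 ^ k := by
    calc (Q.card : ℝ) * ((ρ * n) ^ (k - u) / 2) = ∑ U ∈ Q, ((ρ * n) ^ (k - u) / 2) := by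
          rw [sum_const, nsmul_eq_mul]
      _ ≤ ∑ U ∈ Q, ((S.filter (fun j => U ⊆ X j ∧ ¬ U ⊆ a j)).card : ℝ) := sum_le_sum hlow
      _ ≤ (S.filter (fun j => A ⊆ X j)).card * 4 ^ k := by exact_mod_cast hcount
      _ ≤ _ := by gcongr
  have hsplit : (ρ * n : ℝ) ^ (k - A.card) = (ρ * n) ^ (k - u) * (ρ * n) ^ (u - A.card) := by
    rw [← pow_add]; congr 1; omega
  rw [hsplit] at hfin
  have hpos : (0 : ℝ) < (ρ * n) ^ (k - u) := by positivity
  have h6 : (Q.card : ℝ) ≤ 4 ^ (k + 1) * (ρ * n) ^ (u - A.card) := by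
    have : (ρ * n) ^ (k - u) * (Q.card : ℝ) ≤
        (ρ * n) ^ (k - u) * (4 ^ (k + 1) * (ρ * n) ^ (u - A.card)) := by
      rw [pow_succ]; linarith
    exact le_of_mul_le_mul_left this hpos
  refine h6.trans ?_
  rw [mul_pow, mul_assoc]
  gcongr
  exact pow_le_of_le_one hρ.le hρ1 (by omega)

lemma greedy (k : ℕ) (hk : 1 ≤ k) (δ ε' : ℝ) (hδ : 0 < δ) (hε' : 0 < ε') :
    ∃ ε : ℝ, 0 < ε ∧ ∃ n₀ : ℕ, ∀ n : ℕ, n₀ ≤ n → ∀ (ι : Type) [Fintype ι] [DecidableEq ι]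
      (a : ι → Finset (Fin n)) (C : ι → Fin k → Finset (Fin n)),
      (∀ j, (a j).card ≤ k) → (∀ j i, δ * n ≤ (C j i).card) →
      (∀ U : Finset (Fin n), U.card < k →
        ((univ.filter (fun j => U ⊆ a j)).card : ℝ) ≤ ε * (n : ℝ) ^ (k - U.card)) →
      ∃ y : ι → Fin k → Fin n, (∀ j i, y j i ∈ C j i) ∧ (∀ j, Function.Injective (y j)) ∧
        (∀ j i, y j i ∉ a j) ∧
        (∀ U : Finset (Fin n), U.card < k →
          ((univ.filter (fun j => U ⊆ a j ∪ univ.image (y j))).card : ℝ) ≤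
            ε' * (n : ℝ) ^ (k - U.card)) ∧
        (∀ j j' : ι, ∀ f : Finset (Fin n), f.card = k → f ⊆ a j ∪ univ.image (y j) →
          f ⊆ a j' ∪ univ.image (y j') → ¬ f ⊆ a j → ¬ f ⊆ a j' → j = j') := by
  obtain ⟨ρ, hρ, hρ1, hρε, n₀, hn₀⟩ := greedy_num k hk δ ε' hδ hε'
  refine ⟨ρ ^ k, by positivity, n₀, ?_⟩
  intro n hn ι _ _ a C ha hC hD
  obtain ⟨hρn, hnum⟩ := hn₀ n hn
  have main : ∀ S : Finset ι, ∃ y : ι → Fin k → Fin n, (∀ j ∈ S, (∀ i, y j i ∈ C j i) ∧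
      Function.Injective (y j) ∧ (∀ i, y j i ∉ a j)) ∧
      (∀ U : Finset (Fin n), U.card ≤ k →
        ((S.filter (fun j => U ⊆ a j ∪ univ.image (y j) ∧ ¬ U ⊆ a j)).card : ℝ) ≤
          (ρ * n) ^ (k - U.card)) := by
    intro S
    induction S using Finset.induction_on with
    | empty =>
      have hn1 : 0 < n := by
        rcases Nat.eq_zero_or_pos n with h | h
        · subst h; simp at hρn; linarith
        · exact h
      exact ⟨fun _ _ => ⟨0, hn1⟩, by simp, fun U _ => by simp; positivity⟩
    | insert j S hj ih =>
      obtain ⟨y, hy1, hy2⟩ := ih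
      have hX : ∀ j, (a j ∪ univ.image (y j)).card ≤ 2 * k := by
        intro j
        have h1 := card_union_le (a j) (univ.image (y j))
        have h2 : (univ.image (y j)).card ≤ k := card_image_le.trans (by simp)
        have := ha j
        omega
      have hsat := greedy_sat hk S a (fun j => a j ∪ univ.image (y j)) hX ρ hρ hρ1 hρn
        (fun U hU => le_trans (by exact_mod_cast card_le_card (filter_subset_filter _ (subset_univ S)))
          (hD U hU)) hy2
      obtain ⟨z, hz1, hz2, hz3, hz4⟩ := greedy_step δ (4 ^ (k + 1) * ρ) (by positivity) hδ _ hsat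
        (a j) (ha j) (C j) (hC j) hnum
      have hne : ∀ j' ∈ S, j' ≠ j := fun j' hj' h => hj (h ▸ hj')
      refine ⟨Function.update y j z, ?_, ?_⟩
      · intro j' hj'
        rcases mem_insert.1 hj' with rfl | h
        · simp only [Function.update_self]
          exact ⟨hz1, hz2, hz3⟩
        · rw [Function.update_of_ne (hne j' h)]
          exact hy1 j' h
      · intro U hU
        have hfil : S.filter (fun j' => U ⊆ a j' ∪ univ.image (Function.update y j z j') ∧
            ¬ U ⊆ a j') = S.filter (fun j' => U ⊆ a j' ∪ univ.image (y j') ∧ ¬ U ⊆ a j') := by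
          apply filter_congr
          intro j' hj'
          rw [Function.update_of_ne (hne j' hj')]
        rw [filter_insert]
        split_ifs with hc
        · rw [card_insert_of_notMem (by simp [hj]), hfil]
          simp only [Function.update_self] at hc
          have := hz4 U hc.1 hc.2 hU
          simp only [mem_filter, mem_univ, true_and, not_lt] at this
          push_cast
          exact this
        · rw [hfil]
          exact hy2 U hU
  obtain ⟨y, hy1, hy2⟩ := main univ
  refine ⟨y, fun j => (hy1 j (mem_univ _)).1, fun j => (hy1 j (mem_univ _)).2.1,
    fun j => (hy1 j (mem_univ _)).2.2, ?_, ?_⟩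
  · intro U hU
    have h1 : (univ.filter (fun j => U ⊆ a j ∪ univ.image (y j))).card ≤
        (univ.filter (fun j => U ⊆ a j)).card +
        (univ.filter (fun j => U ⊆ a j ∪ univ.image (y j) ∧ ¬ U ⊆ a j)).card := by
      refine (card_le_card ?_).trans (card_union_le _ _)
      intro j hj
      simp only [mem_filter, mem_union] at hj ⊢
      tauto
    have h2 := hD U hU
    have h3 := hy2 U hU.le
    have hkU : k - U.card ≠ 0 := by omega
    have h4 : ρ ^ k ≤ ρ := pow_le_of_le_one hρ.le hρ1 (by omega)
    have h5 : ρ ^ (k - U.card) ≤ ρ := pow_le_of_le_one hρ.le hρ1 hkU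
    have h6 : ((univ.filter (fun j => U ⊆ a j ∪ univ.image (y j))).card : ℝ) ≤
        (univ.filter (fun j => U ⊆ a j)).card +
        (univ.filter (fun j => U ⊆ a j ∪ univ.image (y j) ∧ ¬ U ⊆ a j)).card := by
      exact_mod_cast h1
    rw [mul_pow] at h3
    have hp : (0 : ℝ) ≤ (n : ℝ) ^ (k - U.card) := by positivity
    nlinarith [mul_le_mul_of_nonneg_right h4 hp, mul_le_mul_of_nonneg_right h5 hp,
      mul_le_mul_of_nonneg_right hρε hp]
  · intro j j' f hf h1 h2 h3 h4
    have := hy2 f hf.le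
    rw [hf, Nat.sub_self, pow_zero] at this
    have h5 : (univ.filter (fun j => f ⊆ a j ∪ univ.image (y j) ∧ ¬ f ⊆ a j)).card ≤ 1 := by
      exact_mod_cast this
    exact card_le_one.1 h5 j (by simp [h1, h3]) j' (by simp [h2, h4])


lemma exists_coloring (G : Type) [Fintype G] [DecidableEq G] [Nonempty G] (n : ℕ) :
    ∃ c : Fin n → G, ∀ g, n / Fintype.card G ≤ (univ.filter (fun v => c v = g)).card ∧
      (univ.filter (fun v => c v = g)).card ≤ n / Fintype.card G + 1 := by
  set q := Fintype.card G with hq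
  have hq0 : 0 < q := Fintype.card_pos
  refine ⟨fun v => (Fintype.equivFin G).symm ⟨v.val % q, Nat.mod_lt _ hq0⟩, fun g => ?_⟩
  set r := Fintype.equivFin G g with hr
  have h1 : (univ.filter (fun v : Fin n =>
      (Fintype.equivFin G).symm ⟨v.val % q, Nat.mod_lt _ hq0⟩ = g)).card =
      n.count (· ≡ r.val [MOD q]) := by
    rw [Nat.count_eq_card_filter_range, ← Nat.Iio_eq_range, ← Fin.map_valEmbedding_univ, filter_map, card_map]
    congr 1
    apply filter_congr
    intro v _
    rw [Equiv.symm_apply_eq, Fin.ext_iff]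
    simp only [Function.comp, Fin.valEmbedding_apply, Nat.ModEq]
    rw [Nat.mod_eq_of_lt (a := r.val) r.isLt]
  rw [h1, Nat.count_modEq_card _ hq0]
  split_ifs <;> omega

/-- State function on colours. -/
def gval (k : ℕ) (p : ZMod 2 × (Fin k → ZMod (k + 1))) : ZMod 2 :=
  p.1 + if ∃ i, p.2 i = 0 then 1 else 0

lemma gval_pattern (k : ℕ) (s : ZMod 2 × (Fin k → ZMod (k + 1))) (b : ZMod 2) :
    ∃ δ : Fin k → ZMod 2 × (Fin k → ZMod (k + 1)), ∀ I : Finset (Fin k), I ≠ ∅ →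
      gval k (s + ∑ i ∈ I, δ i) = b + (I.card : ZMod 2) := by
  have key : ∃ d : Fin k → (Fin k → ZMod (k + 1)), ∀ I : Finset (Fin k), I ≠ ∅ →
      (if ∃ c, (s.2 + ∑ i ∈ I, d i) c = 0 then (1 : ZMod 2) else 0) = b - s.1 := by
    have hb : b - s.1 = 1 ∨ b - s.1 = 0 := by
      generalize b - s.1 = t
      revert t; decide
    rcases hb with hb | hb
    · refine ⟨fun i => Pi.single i (- s.2 i), fun I hI => ?_⟩
      rw [hb, if_pos]
      obtain ⟨i, hi⟩ := nonempty_iff_ne_empty.2 hI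
      refine ⟨i, ?_⟩
      rw [Pi.add_apply, Finset.sum_apply, sum_eq_single i]
      · simp
      · intro j _ hj
        simp [hj.symm]
      · intro h; exact absurd hi h
    · refine ⟨fun _ c => if s.2 c = 0 then 1 else 0, fun I hI => ?_⟩
      rw [hb, if_neg]
      rintro ⟨c, hc⟩
      rw [Pi.add_apply, Finset.sum_apply] at hc
      by_cases h : s.2 c = 0
      · simp only [h, if_true, sum_const, nsmul_eq_mul, mul_one, zero_add] at hc
        rw [ZMod.natCast_eq_zero_iff] at hc
        have h1 : 0 < I.card := card_pos.2 (nonempty_iff_ne_empty.2 hI)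
        have h2 : I.card ≤ k := (card_le_univ I).trans (by simp)
        have := Nat.le_of_dvd h1 hc
        omega
      · simp only [h, if_false, sum_const_zero, add_zero] at hc
  obtain ⟨d, hd⟩ := key
  refine ⟨fun i => (1, d i), fun I hI => ?_⟩
  have h1 := hd I hI
  unfold gval
  have e1 : (s + ∑ i ∈ I, ((1 : ZMod 2), d i)).1 = s.1 + (I.card : ZMod 2) := by
    simp [Prod.fst_sum]
  have e2 : (s + ∑ i ∈ I, ((1 : ZMod 2), d i)).2 = s.2 + ∑ i ∈ I, d i := by
    simp [Prod.snd_sum]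
  rw [e1, e2, h1]
  ring

lemma gval_half (k : ℕ) (s : ZMod 2 × (Fin k → ZMod (k + 1))) :
    2 * (univ.filter (fun u => gval k (s + u) = 1)).card =
      Fintype.card (ZMod 2 × (Fin k → ZMod (k + 1))) := by
  have hne : ∀ t : ZMod 2, (¬ t = 1) ↔ t + 1 = 1 := by decide
  have h1 : (univ.filter (fun u => gval k (s + u) = 1)).card =
      (univ.filter (fun u => ¬ gval k (s + u) = 1)).card := by
    refine card_bij' (fun u _ => u + (1, 0)) (fun u _ => u + (1, 0)) ?_ ?_ ?_ ?_
    · intro u hu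
      simp only [mem_filter, mem_univ, true_and] at hu ⊢
      rw [hne]
      simp only [gval, Prod.fst_add, Prod.snd_add, add_zero] at hu ⊢
      have : (1 : ZMod 2) + 1 = 0 := by decide
      linear_combination hu + this
    · intro u hu
      simp only [mem_filter, mem_univ, true_and] at hu ⊢
      rw [hne] at hu
      simp only [gval, Prod.fst_add, Prod.snd_add, add_zero] at hu ⊢
      linear_combination hu
    · intro u _
      ext <;> simp
      have : (1 : ZMod 2) + 1 = 0 := by decide
      linear_combination this
    · intro u _
      ext <;> simp
      have : (1 : ZMod 2) + 1 = 0 := by decide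
      linear_combination this
  have h2 := card_filter_add_card_filter_not (s := (univ : Finset (ZMod 2 × (Fin k → ZMod (k + 1)))))
    (fun u => gval k (s + u) = 1)
  rw [card_univ] at h2
  omega

/-- Counting vertices via their colours. -/
lemma count_color {G : Type} [Fintype G] [DecidableEq G] {n : ℕ} (c : Fin n → G)
    (p : G → Prop) [DecidablePred p] :
    (univ.filter (fun v => p (c v))).card =
      ∑ g ∈ univ.filter p, (univ.filter (fun v => c v = g)).card := by
  rw [card_eq_sum_card_fiberwise (f := c) (t := univ.filter p)]
  · apply sum_congr rfl
    intro g hg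
    congr 1
    ext v
    simp only [mem_filter, mem_univ, true_and] at hg ⊢
    constructor
    · exact fun h => h.2
    · intro h; exact ⟨h ▸ hg, h⟩
  · intro v hv
    simpa using hv

lemma exists_push {n k m : ℕ} [NeZero m] (hm : 2 * k ≤ n / m ^ k)
    (c : Fin n → (Fin k → ZMod m))
    (hc : ∀ g, n / m ^ k ≤ (univ.filter (fun v => c v = g)).card)
    (e : Finset (Fin n)) (he : e.card = k) :
    ∃ P : Finset (Fin n) → ℤ, (∀ f, P f ≠ 0 → ∃ i, (∑ v ∈ f, c v) i = 0) ∧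
      ∀ T : Finset (Fin n), T.card + 1 = k → dg P T = if T ⊆ e then 1 else 0 := by
  classical
  set x : Fin k → Fin n := fun i => e.orderEmbOfFin he i with hx
  have hxe : univ.image x = e := by
    apply coe_injective
    rw [coe_image, coe_univ, Set.image_univ]
    exact range_orderEmbOfFin e he
  have hxinj : Function.Injective x := (e.orderEmbOfFin he).injective
  set s := ∑ v ∈ e, c v with hs
  set t : Fin k → Finset (Fin n) := fun i =>
    (univ.filter (fun v => c v = c (x i) + Pi.single i (- s i))) \ e with ht
  have htc : ∀ i, k ≤ (t i).card := by
    intro i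
    have h1 := le_card_sdiff e (univ.filter (fun v => c v = c (x i) + Pi.single i (- s i)))
    have h2 := hc (c (x i) + Pi.single i (- s i))
    simp only [ht]
    omega
  obtain ⟨y, hyinj, hyt⟩ := (Finset.all_card_le_biUnion_card_iff_exists_injective t).1 (by
    intro S
    rcases S.eq_empty_or_nonempty with rfl | ⟨i, hi⟩
    · simp
    · calc S.card ≤ k := (card_le_univ S).trans (by simp)
        _ ≤ (t i).card := htc i
        _ ≤ _ := card_le_card (subset_biUnion_of_mem t hi))
  have hyc : ∀ i, c (y i) = c (x i) + Pi.single i (- s i) := by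
    intro i
    have := hyt i
    simp only [ht, mem_sdiff, mem_filter, mem_univ, true_and] at this
    exact this.1
  have hye : ∀ i, y i ∉ e := fun i => (mem_sdiff.1 (hyt i)).2
  have hinj : Function.Injective (Sum.elim x y) := by
    apply Function.Injective.sumElim hxinj hyinj
    intro i j h
    apply hye j
    rw [← h, ← hxe]
    exact mem_image_of_mem _ (mem_univ _)
  refine ⟨octW x y, ?_, ?_⟩
  · intro f hf
    obtain ⟨I, hI, hfI⟩ := exists_ne_zero_of_sum_ne_zero hf
    have hfI' : f = oct x y I := by
      by_contra h
      simp [h] at hfI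
    have hIne : I ≠ ∅ := (mem_erase.1 hI).1
    obtain ⟨i, hi⟩ := nonempty_iff_ne_empty.2 hIne
    refine ⟨i, ?_⟩
    rw [hfI', oct_color hinj, hxe, ← hs, Pi.add_apply, Finset.sum_apply, sum_eq_single i]
    · rw [hyc]; simp
    · intro j _ hj
      rw [hyc]; simp [hj.symm]
    · intro h; exact absurd hi h
  · intro T hT
    rw [dg_octW hinj T hT, hxe]

/-- Weights of the gadget which realises `k!` times a single `(k-1)`-set. -/
def gw (k i : ℕ) : ℤ :=
  if i = 0 then 0 else (-1) ^ (i - 1) * ((i - 1).factorial : ℤ) * ((k - i).factorial : ℤ)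

lemma gw_rec (k i : ℕ) (hi : i < k) :
    ((k - i : ℕ) : ℤ) * gw k (i + 1) + (i : ℤ) * gw k i =
      if i = 0 then (k.factorial : ℤ) else 0 := by
  rcases Nat.eq_zero_or_pos i with rfl | h
  · obtain ⟨k, rfl⟩ : ∃ k', k = k' + 1 := ⟨k - 1, by omega⟩
    simp [gw, Nat.factorial_succ]
  · obtain ⟨j, rfl⟩ : ∃ j, i = j + 1 := ⟨i - 1, by omega⟩
    obtain ⟨d, rfl⟩ : ∃ d, k = j + 1 + (d + 1) := ⟨k - (j + 1) - 1, by omega⟩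
    simp only [gw, Nat.add_sub_cancel, Nat.add_sub_cancel_left]
    rw [show j + 1 + (d + 1) - (j + 1 + 1) = d by omega]
    simp only [Nat.factorial_succ, if_neg (Nat.succ_ne_zero _)]
    push_cast
    ring

lemma gw_abs (k i : ℕ) (hi : i ≤ k) : |gw k i| ≤ (k.factorial : ℤ) := by
  unfold gw
  split_ifs with h
  · simp
  · rw [mul_assoc, abs_mul, abs_pow, abs_neg, abs_one, one_pow, one_mul, ← Nat.cast_mul,
      Nat.abs_cast]
    have h1 := Nat.factorial_mul_factorial_dvd_factorial_add (i - 1) (k - i)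
    have h2 := Nat.le_of_dvd (Nat.factorial_pos _) h1
    have h3 : (i - 1 + (k - i)).factorial ≤ k.factorial := Nat.factorial_le (by omega)
    exact_mod_cast h2.trans h3

/-- The gadget. -/
def gad {n : ℕ} (k : ℕ) (a Z : Finset (Fin n)) (f : Finset (Fin n)) : ℤ :=
  if f ⊆ a ∪ Z then gw k (f ∩ Z).card else 0

lemma dg_gad {n k : ℕ} (a Z : Finset (Fin n)) (hZ : Z.card = k) (ha : a.card + 1 = k)
    (hd : Disjoint a Z) (T : Finset (Fin n)) (hT : T.card + 1 = k) :
    dg (gad k a Z) T = if T = a then (k.factorial : ℤ) else 0 := by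
  classical
  by_cases hs : T ⊆ a ∪ Z
  · set i := (T ∩ Z).card with hi
    have hTa : (T ∩ a).card + i = T.card := by
      rw [hi, ← card_union_of_disjoint (hd.mono inter_subset_right inter_subset_right),
        ← inter_union_distrib_left, inter_eq_left.2 hs]
    have hZT : (Z \ T).card = k - i := by
      rw [card_sdiff, hZ, hi]
    have haT : (a \ T).card = i := by
      rw [card_sdiff]; omega
    have h1 : dg (gad k a Z) T = ∑ x ∈ (Z \ T) ∪ (a \ T), gad k a Z (insert x T) := by
      unfold dg
      symm
      apply sum_subset
      · intro x hx
        simp only [mem_union, mem_sdiff, mem_compl] at hx ⊢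
        tauto
      · intro x hx hx'
        unfold gad
        rw [if_neg]
        intro h
        have := h (mem_insert_self x T)
        simp only [mem_union, mem_sdiff, mem_compl] at hx hx' this
        tauto
    rw [h1, sum_union (by
      apply Disjoint.mono sdiff_subset sdiff_subset hd.symm)]
    have h2 : ∀ x ∈ Z \ T, gad k a Z (insert x T) = gw k (i + 1) := by
      intro x hx
      rw [mem_sdiff] at hx
      unfold gad
      rw [if_pos (insert_subset (mem_union_right _ hx.1) hs), insert_inter_of_mem hx.1,
        card_insert_of_notMem (by simp [hx.2])]
    have h3 : ∀ x ∈ a \ T, gad k a Z (insert x T) = gw k i := by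
      intro x hx
      rw [mem_sdiff] at hx
      unfold gad
      rw [if_pos (insert_subset (mem_union_left _ hx.1) hs),
        insert_inter_of_notMem (fun h => disjoint_left.1 hd hx.1 h)]
    rw [sum_congr rfl h2, sum_congr rfl h3, sum_const, sum_const, hZT, haT, nsmul_eq_mul,
      nsmul_eq_mul, gw_rec k i (by omega)]
    have : i = 0 ↔ T = a := by
      constructor
      · intro h0
        rw [h0] at haT
        have : a ⊆ T := sdiff_eq_empty_iff_subset.1 (card_eq_zero.1 haT)
        exact (eq_of_subset_of_card_le this (by omega)).symm
      · rintro rfl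
        rw [hi, disjoint_iff_inter_eq_empty.1 hd]; rfl
    simp only [this]
  · rw [if_neg (by rintro rfl; exact hs subset_union_left)]
    unfold dg
    apply sum_eq_zero
    intro x _
    unfold gad
    rw [if_neg]
    exact fun h => hs ((subset_insert _ _).trans h)


lemma dg_eq_sum {n k : ℕ} (F : Finset (Fin n) → ℤ) (hF : ∀ f, f.card ≠ k → F f = 0)
    (T : Finset (Fin n)) (hT : T.card + 1 = k) :
    dg F T = ∑ f, if T ⊆ f then F f else 0 := by
  have h1 : dg F T = dg (fun g => ∑ f, if g = f then F f else 0) T := by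
    unfold dg
    apply sum_congr rfl
    intro x _
    simp
  rw [h1, dg_sum]
  apply sum_congr rfl
  intro f _
  by_cases hf : f.card = k
  · exact dg_single f T (F f) (by omega)
  · rw [hF f hf]
    simp [dg]

lemma tasks_sum {α : Type} [Fintype α] (W : α → ℕ) (g : α → ℤ) :
    ∑ j : (Σ a, Fin (W a)), g j.1 = ∑ a, (W a : ℤ) * g a := by
  rw [Fintype.sum_sigma]
  simp

lemma tasks_count {α : Type} [Fintype α] (W : α → ℕ) (p : α → Prop) [DecidablePred p] :
    (univ.filter (fun j : (Σ a, Fin (W a)) => p j.1)).card = ∑ a ∈ univ.filter p, W a := by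
  rw [card_filter, Fintype.sum_sigma, sum_filter]
  apply sum_congr rfl
  intro a _
  by_cases h : p a <;> simp [h]

lemma count_supersets {n d : ℕ} (U : Finset (Fin n)) (hU : U.card ≤ d) :
    (univ.filter (fun T : Finset (Fin n) => U ⊆ T ∧ T.card = d)).card ≤ n ^ (d - U.card) := by
  calc (univ.filter (fun T : Finset (Fin n) => U ⊆ T ∧ T.card = d)).card
      ≤ (powersetCard (d - U.card) (univ : Finset (Fin n))).card := by
        apply card_le_card_of_injOn (fun T => T \ U)
        · intro T hT
          simp only [coe_filter, mem_univ, true_and, Set.mem_ofPred_eq] at hT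
          rw [mem_coe]
          simp [mem_powersetCard, card_sdiff_of_subset hT.1, hT.2]
        · intro T hT T' hT' h
          simp only [coe_filter, mem_univ, true_and, Set.mem_ofPred_eq] at hT hT'
          simp only at h
          rw [← sdiff_union_of_subset hT.1, h, sdiff_union_of_subset hT'.1]
    _ ≤ _ := by
        rw [card_powersetCard, card_univ, Fintype.card_fin]
        exact Nat.choose_le_pow _ _

lemma spread_low {n k : ℕ} (E : Finset (Fin n) → ℤ) (hE : ∀ T, T.card + 1 ≠ k → E T = 0)
    (ε : ℝ) (hε : 0 ≤ ε) (hb : ∀ T, T.card + 1 = k → (|E T| : ℝ) ≤ ε * n)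
    (U : Finset (Fin n)) (hU : U.card < k) :
    ((∑ T ∈ univ.filter (fun T => U ⊆ T), |E T| : ℤ) : ℝ) ≤ ε * (n : ℝ) ^ (k - U.card) := by
  have h1 : ∑ T ∈ univ.filter (fun T => U ⊆ T), |E T| =
      ∑ T ∈ univ.filter (fun T : Finset (Fin n) => U ⊆ T ∧ T.card = k - 1), |E T| := by
    symm
    apply sum_subset
    · intro T hT
      simp only [mem_filter, mem_univ, true_and] at hT ⊢
      exact hT.1
    · intro T hT hT'
      simp only [mem_filter, mem_univ, true_and] at hT hT'
      rw [hE T (by intro h; apply hT'; exact ⟨hT, by omega⟩)]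
      simp
  rw [h1]
  push_cast
  calc ∑ T ∈ univ.filter (fun T : Finset (Fin n) => U ⊆ T ∧ T.card = k - 1), |(E T : ℝ)|
      ≤ ∑ T ∈ univ.filter (fun T : Finset (Fin n) => U ⊆ T ∧ T.card = k - 1), ε * n := by
        apply sum_le_sum
        intro T hT
        simp only [mem_filter, mem_univ, true_and] at hT
        exact hb T (by omega)
    _ = (univ.filter (fun T : Finset (Fin n) => U ⊆ T ∧ T.card = k - 1)).card * (ε * n) := by
        rw [sum_const, nsmul_eq_mul]
    _ ≤ ((n ^ (k - 1 - U.card) : ℕ) : ℝ) * (ε * n) := by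
        apply mul_le_mul_of_nonneg_right _ (by positivity)
        exact_mod_cast count_supersets U (by omega)
    _ = ε * (n : ℝ) ^ (k - U.card) := by
        rw [show k - U.card = k - 1 - U.card + 1 by omega, pow_succ]
        push_cast; ring

lemma spread_high {n k : ℕ} (F : Finset (Fin n) → ℤ) (hF : ∀ f, f.card ≠ k → F f = 0)
    (ε : ℝ) (hε : 0 ≤ ε)
    (hb : ∀ T : Finset (Fin n), T.card + 1 = k → ((dg (fun f => |F f|) T : ℤ) : ℝ) ≤ ε * n)
    (U : Finset (Fin n)) (hU : U.card < k) :
    ((∑ f ∈ univ.filter (fun f => U ⊆ f), |F f| : ℤ) : ℝ) ≤ ε * (n : ℝ) ^ (k - U.card) := by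
  set E : Finset (Fin n) → ℤ := fun T => if T.card + 1 = k then dg (fun f => |F f|) T else 0
    with hE
  have hE0 : ∀ T, 0 ≤ E T := by
    intro T
    simp only [hE]
    split_ifs
    · exact sum_nonneg (fun _ _ => abs_nonneg _)
    · exact le_rfl
  have h1 := spread_low (k := k) E (by intro T hT; simp [hE, hT]) ε hε (by
    intro T hT
    have := hE0 T
    rw [abs_of_nonneg (by exact_mod_cast this)]
    simp only [hE, hT, if_true]
    exact hb T hT) U hU
  refine le_trans ?_ h1
  norm_cast
  have h2 : ∑ T ∈ univ.filter (fun T => U ⊆ T), |E T| =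
      ∑ f, ∑ T ∈ univ.filter (fun T : Finset (Fin n) => U ⊆ T ∧ T.card + 1 = k),
        if T ⊆ f then |F f| else 0 := by
    rw [sum_comm]
    rw [filter_and, filter_inter, univ_inter, sum_filter, sum_filter]
    rw [sum_filter]
    apply sum_congr rfl
    intro T _
    rw [abs_of_nonneg (hE0 T)]
    by_cases hT : T.card + 1 = k
    · simp only [hE, hT, if_true]
      rw [dg_eq_sum (fun f => |F f|) (by intro f hf; simp [hF f hf]) T hT]
    · simp [hE, hT]
  rw [h2, sum_filter]
  apply sum_le_sum
  intro f _
  by_cases hUf : U ⊆ f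
  · rw [if_pos hUf]
    by_cases hf : f.card = k
    · obtain ⟨T, hUT, hTf, hTc⟩ := exists_subsuperset_card_eq hUf (show U.card ≤ k - 1 by omega)
        (show k - 1 ≤ f.card by omega)
      calc |F f| = if T ⊆ f then |F f| else 0 := by simp [hTf]
        _ ≤ _ := by
          apply single_le_sum (f := fun T => if T ⊆ f then |F f| else 0)
          · intro T _
            split_ifs
            · exact abs_nonneg _
            · exact le_rfl
          · simp only [mem_filter, mem_univ, true_and]
            exact ⟨hUT, by omega⟩
    · rw [hF f hf]; simp
  · rw [if_neg hUf]
    apply sum_nonneg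
    intro T _
    split_ifs
    · exact abs_nonneg _
    · exact le_rfl


lemma octW_oct {n k : ℕ} {x y : Fin k → Fin n} (h : Function.Injective (Sum.elim x y))
    (I : Finset (Fin k)) (hI : I ≠ ∅) : octW x y (oct x y I) = -(-1 : ℤ) ^ I.card := by
  unfold octW
  rw [sum_eq_single I]
  · simp
  · intro J _ hJ
    rw [if_neg]
    intro h'
    exact hJ (oct_inj h h').symm
  · intro h'
    exact absurd (mem_erase.2 ⟨hI, mem_univ _⟩) h'

lemma octW_supp {n k : ℕ} {x y : Fin k → Fin n} {f : Finset (Fin n)} (hf : octW x y f ≠ 0) :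
    ∃ I : Finset (Fin k), I ≠ ∅ ∧ f = oct x y I := by
  obtain ⟨I, hI, hfI⟩ := exists_ne_zero_of_sum_ne_zero hf
  refine ⟨I, (mem_erase.1 hI).1, ?_⟩
  by_contra h
  simp [h] at hfI

/-- The initial hypergraph as an integer weighting. -/
def hz {n : ℕ} (k : ℕ) (c : Fin n → ZMod 2 × (Fin k → ZMod (k + 1))) (f : Finset (Fin n)) : ℤ :=
  if gval k (∑ v ∈ f, c v) = 1 then 1 else 0

/-- Indicator. -/
def ind {n : ℕ} (H : Finset (Finset (Fin n))) (f : Finset (Fin n)) : ℤ := if f ∈ H then 1 else 0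

lemma stage3 (k : ℕ) (hk : 1 ≤ k) : ∃ ε : ℝ, 0 < ε ∧ ∃ n₀ : ℕ, ∀ n : ℕ, n₀ ≤ n →
    ∀ c : Fin n → ZMod 2 × (Fin k → ZMod (k + 1)),
    (∀ g, n / Fintype.card (ZMod 2 × (Fin k → ZMod (k + 1))) ≤
      (univ.filter (fun v => c v = g)).card) →
    ∀ Φ : Finset (Fin n) → ℤ, (∀ f, f.card ≠ k → Φ f = 0) →
    (∀ U : Finset (Fin n), U.card < k →
      ((∑ f ∈ univ.filter (fun f => U ⊆ f), |Φ f| : ℤ) : ℝ) ≤ ε * (n : ℝ) ^ (k - U.card)) →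
    ∃ H : Finset (Finset (Fin n)), (∀ e ∈ H, e.card = k) ∧
      ∀ T : Finset (Fin n), T.card + 1 = k → dg (ind H) T = dg (hz k c) T + dg Φ T := by
  classical
  set q := Fintype.card (ZMod 2 × (Fin k → ZMod (k + 1))) with hq
  have hq0 : 0 < q := Fintype.card_pos
  have hq0' : (0 : ℝ) < q := by exact_mod_cast hq0
  obtain ⟨ε, hε, n₀, hn₀⟩ := greedy k hk (1 / (2 * q)) 1 (by positivity) one_pos
  refine ⟨ε, hε, max n₀ (2 * q), ?_⟩
  intro n hn c hc Φ hΦ hsp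
  have hn1 := (le_max_left _ _).trans hn
  have hn2 := (le_max_right _ _).trans hn
  set ι := Σ f : Finset (Fin n), Fin (Φ f).natAbs with hι
  have he : ∀ j : ι, j.1.card = k := by
    intro j
    by_contra h
    have h1 := hΦ j.1 h
    have h2 := Fin.pos j.2
    rw [h1] at h2
    simp at h2
  set x : ι → Fin k → Fin n := fun j i => j.1.orderEmbOfFin (he j) i with hx
  have hxe : ∀ j, univ.image (x j) = j.1 := by
    intro j
    apply coe_injective
    rw [coe_image, coe_univ, Set.image_univ]
    exact range_orderEmbOfFin j.1 (he j)
  have hxinj : ∀ j, Function.Injective (x j) := fun j => (j.1.orderEmbOfFin (he j)).injective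
  have hpat := fun j : ι => gval_pattern k (∑ v ∈ j.1, c v)
    (if (Φ j.1).sign = 1 then 1 else 0)
  choose d hd using hpat
  obtain ⟨y, hyC, hyinj, hya, -, hdis⟩ := hn₀ n hn1 ι (fun j => j.1)
    (fun j i => univ.filter (fun v => c v = c (x j i) + d j i)) (fun j => (he j).le) (by
      intro j i
      have h1 := hc (c (x j i) + d j i)
      have h2 : (n : ℝ) < q * (n / q : ℕ) + q := by
        have := Nat.lt_mul_div_succ n hq0
        have h3 : n < q * (n / q) + q := by
          rw [Nat.mul_add] at this; omega
        exact_mod_cast h3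
      have h3 : (2 * q : ℝ) ≤ n := by exact_mod_cast hn2
      have h4 : ((n / q : ℕ) : ℝ) ≤ ((univ.filter (fun v => c v = c (x j i) + d j i)).card : ℝ) := by
        exact_mod_cast h1
      refine le_trans ?_ h4
      rw [div_mul_eq_mul_div, one_mul, div_le_iff₀ (by positivity)]
      nlinarith) (by
      intro U hU
      refine le_trans (le_of_eq ?_) (hsp U hU)
      rw [tasks_count (fun f => (Φ f).natAbs) (fun f => U ⊆ f)]
      push_cast
      apply sum_congr rfl
      intro f _
      rw [Nat.cast_natAbs, Int.cast_abs])
  have hinj : ∀ j, Function.Injective (Sum.elim (x j) (y j)) := by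
    intro j
    apply Function.Injective.sumElim (hxinj j) (hyinj j)
    intro i i' h
    apply hya j i'
    rw [← h]
    show x j i ∈ j.1
    rw [← hxe j]
    exact mem_image_of_mem _ (mem_univ _)
  have hsgn : ∀ j : ι, (Φ j.1).sign = 1 ∨ (Φ j.1).sign = -1 := by
    intro j
    have h2 := Fin.pos j.2
    rcases lt_trichotomy (Φ j.1) 0 with h | h | h
    · right; exact Int.sign_eq_neg_one_of_neg h
    · rw [h] at h2; simp at h2
    · left; exact Int.sign_eq_one_of_pos h
  set V : Finset (Fin n) → ℤ := fun f => hz k c f + ∑ j : ι, (Φ j.1).sign * octW (x j) (y j) f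
    with hV
  have hval : ∀ f, f.card = k → V f = 0 ∨ V f = 1 := by
    intro f hf
    by_cases hex : ∃ j : ι, octW (x j) (y j) f ≠ 0
    · obtain ⟨j, hj⟩ := hex
      obtain ⟨I, hI, rfl⟩ := octW_supp hj
      have hnsub : ∀ (j : ι) (I : Finset (Fin k)), I ≠ ∅ → ¬ oct (x j) (y j) I ⊆ j.1 := by
        intro j I hI hs
        obtain ⟨i, hi⟩ := nonempty_iff_ne_empty.2 hI
        exact hya j i (hs ((oct_mem_y (hinj j) I i).2 hi))
      have hsubX : ∀ (j : ι) (I : Finset (Fin k)), oct (x j) (y j) I ⊆ j.1 ∪ univ.image (y j) := by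
        intro j I
        have := oct_subset (x j) (y j) I
        rwa [hxe j] at this
      have hV1 : V (oct (x j) (y j) I) = hz k c (oct (x j) (y j) I) +
          (Φ j.1).sign * (-(-1 : ℤ) ^ I.card) := by
        simp only [hV]
        congr 1
        rw [sum_eq_single j]
        · rw [octW_oct (hinj j) I hI]
        · intro j' _ hj'
          by_contra h
          obtain ⟨I', hI', hfI'⟩ := octW_supp (right_ne_zero_of_mul h)
          apply hj'
          apply hdis j' j (oct (x j) (y j) I) hf
          · rw [hfI']; exact hsubX j' I'
          · exact hsubX j I
          · rw [hfI']; exact hnsub j' I' hI'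
          · exact hnsub j I hI
        · intro h; exact absurd (mem_univ _) h
      have hcol : ∑ v ∈ oct (x j) (y j) I, c v = ∑ v ∈ j.1, c v + ∑ i ∈ I, d j i := by
        rw [oct_color (hinj j), hxe]
        congr 1
        apply sum_congr rfl
        intro i _
        have := hyC j i
        simp only [mem_filter, mem_univ, true_and] at this
        rw [this]; abel
      rw [hV1, hz, hcol, hd j I hI]
      rcases Nat.even_or_odd I.card with h | h
      · have h0 : (I.card : ZMod 2) = 0 := (ZMod.natCast_eq_zero_iff_even).2 h
        rw [h0, h.neg_one_pow]
        rcases hsgn j with hs | hs <;> rw [hs] <;> simp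
      · have h0 : (I.card : ZMod 2) = 1 := (ZMod.natCast_eq_one_iff_odd).2 h
        rw [h0, h.neg_one_pow]
        have h11 : ¬ ((1 : ZMod 2) + 1 = 1) := by decide
        rcases hsgn j with hs | hs <;> rw [hs] <;> simp
    · push Not at hex
      have : V f = hz k c f := by
        simp only [hV]
        rw [sum_eq_zero, add_zero]
        intro j _
        rw [hex j, mul_zero]
      rw [this, hz]
      split_ifs
      · right; rfl
      · left; rfl
  refine ⟨univ.filter (fun f => f.card = k ∧ V f = 1), ?_, ?_⟩
  · intro e he'
    simp only [mem_filter, mem_univ, true_and] at he'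
    exact he'.1
  · intro T hT
    have h1 : dg (ind (univ.filter (fun f => f.card = k ∧ V f = 1))) T = dg V T := by
      unfold dg
      apply sum_congr rfl
      intro v hv
      have hc' : (insert v T).card = k := by
        rw [card_insert_of_notMem (by simpa using hv)]; exact hT
      rcases hval _ hc' with h | h
      · simp [ind, h]
      · simp [ind, h, hc']
    rw [h1, hV, dg_add, dg_sum, dg_eq_sum Φ hΦ T hT]
    congr 1
    have h2 : ∀ j : ι, dg (fun f => (Φ j.1).sign * octW (x j) (y j) f) T =
        (Φ j.1).sign * if T ⊆ j.1 then 1 else 0 := by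
      intro j
      rw [dg_mul, dg_octW (hinj j) T hT, hxe]
    rw [sum_congr rfl (fun j _ => h2 j),
      tasks_sum (fun f => (Φ f).natAbs) (fun f => (Φ f).sign * if T ⊆ f then 1 else 0)]
    apply sum_congr rfl
    intro f _
    rw [← mul_assoc, Int.natCast_natAbs, mul_comm |Φ f|, Int.sign_mul_abs]
    simp

lemma stage1 (k : ℕ) (hk : 1 ≤ k) (ε' : ℝ) (hε' : 0 < ε') :
    ∃ ε : ℝ, 0 < ε ∧ ∃ n₀ : ℕ, ∀ n : ℕ, n₀ ≤ n →
    ∀ E : Finset (Fin n) → ℤ, (∀ T, T.card + 1 ≠ k → E T = 0) →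
    (∀ T, (k.factorial : ℤ) ∣ E T) →
    (∀ U : Finset (Fin n), U.card < k →
      ((∑ f ∈ univ.filter (fun f => U ⊆ f), |E f| : ℤ) : ℝ) ≤ ε * (n : ℝ) ^ (k - U.card)) →
    ∃ Φ : Finset (Fin n) → ℤ, (∀ f, f.card ≠ k → Φ f = 0) ∧
      (∀ T : Finset (Fin n), T.card + 1 = k → dg Φ T = E T) ∧
      (∀ U : Finset (Fin n), U.card < k →
      ((∑ f ∈ univ.filter (fun f => U ⊆ f), |Φ f| : ℤ) : ℝ) ≤ ε' * (n : ℝ) ^ (k - U.card)) := by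
  classical
  have hL : (0 : ℤ) < k.factorial := by exact_mod_cast k.factorial_pos
  have hLr : (0 : ℝ) < k.factorial := by exact_mod_cast k.factorial_pos
  obtain ⟨ε, hε, n₀, hn₀⟩ := greedy k hk 1 (ε' / (k.factorial * 4 ^ k)) one_pos (by positivity)
  refine ⟨ε, hε, n₀, ?_⟩
  intro n hn E hE hdvd hsp
  choose D hD using hdvd
  set ι := Σ f : Finset (Fin n), Fin (D f).natAbs with hι
  have hD0 : ∀ T, T.card + 1 ≠ k → D T = 0 := by
    intro T hT
    have h1 := hE T hT
    rw [hD T] at h1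
    rcases mul_eq_zero.1 h1 with h | h
    · omega
    · exact h
  have he : ∀ j : ι, j.1.card + 1 = k := by
    intro j
    by_contra h
    have h1 := hD0 j.1 h
    have h2 := Fin.pos j.2
    rw [h1] at h2
    simp at h2
  obtain ⟨y, hyC, hyinj, hya, hspr, -⟩ := hn₀ n hn ι (fun j => j.1)
    (fun j i => univ) (fun j => by have := he j; omega) (by
      intro j i
      simp) (by
      intro U hU
      refine le_trans ?_ (hsp U hU)
      rw [tasks_count (fun f => (D f).natAbs) (fun f => U ⊆ f)]
      push_cast
      apply sum_le_sum
      intro f _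
      rw [Nat.cast_natAbs, Int.cast_abs, hD f]
      push_cast
      rw [abs_mul, abs_of_pos hLr]
      have := abs_nonneg (D f : ℝ)
      have h1 : (1 : ℝ) ≤ k.factorial := by exact_mod_cast k.factorial_pos
      nlinarith)
  set Z : ι → Finset (Fin n) := fun j => univ.image (y j) with hZ
  have hZc : ∀ j, (Z j).card = k := by
    intro j
    rw [hZ, card_image_of_injective _ (hyinj j)]; simp
  have hZd : ∀ j, Disjoint j.1 (Z j) := by
    intro j
    rw [disjoint_right]
    intro v hv
    simp only [hZ, mem_image, mem_univ, true_and] at hv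
    obtain ⟨i, rfl⟩ := hv
    exact hya j i
  set Φ : Finset (Fin n) → ℤ := fun f =>
    if f.card = k then ∑ j : ι, (D j.1).sign * gad k j.1 (Z j) f else 0 with hΦ
  refine ⟨Φ, ?_, ?_, ?_⟩
  · intro f hf
    simp [hΦ, hf]
  · intro T hT
    have h1 : dg Φ T = dg (fun f => ∑ j : ι, (D j.1).sign * gad k j.1 (Z j) f) T := by
      unfold dg
      apply sum_congr rfl
      intro v hv
      have hc' : (insert v T).card = k := by
        rw [card_insert_of_notMem (by simpa using hv)]; exact hT
      simp [hΦ, hc']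
    rw [h1, dg_sum]
    have h2 : ∀ j : ι, dg (fun f => (D j.1).sign * gad k j.1 (Z j) f) T =
        (D j.1).sign * if T = j.1 then (k.factorial : ℤ) else 0 := by
      intro j
      rw [dg_mul, dg_gad j.1 (Z j) (hZc j) (he j) (hZd j) T hT]
    rw [sum_congr rfl (fun j _ => h2 j),
      tasks_sum (fun f => (D f).natAbs) (fun f => (D f).sign * if T = f then (k.factorial : ℤ) else 0)]
    rw [sum_eq_single T]
    · rw [← mul_assoc, Int.natCast_natAbs, mul_comm |D T|, Int.sign_mul_abs, hD T]
      simp [mul_comm]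
    · intro f _ hf
      simp [hf.symm]
    · intro h; exact absurd (mem_univ _) h
  · intro U hU
    have hΦb : ∀ f, |Φ f| ≤ ∑ j : ι, if f ⊆ j.1 ∪ Z j then (k.factorial : ℤ) else 0 := by
      intro f
      simp only [hΦ]
      split_ifs
      · refine (abs_sum_le_sum_abs _ _).trans (sum_le_sum ?_)
        intro j _
        rw [abs_mul]
        unfold gad
        split_ifs
        · have h1 : |(D j.1).sign| ≤ 1 := by
            rcases Int.sign_trichotomy (D j.1) with h | h | h <;> simp [h]
          have h2 := gw_abs k (f ∩ Z j).card ((card_le_card inter_subset_right).trans (hZc j).le)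
          have h3 := abs_nonneg (gw k (f ∩ Z j).card)
          nlinarith
        · simp
      · rw [abs_zero]
        apply sum_nonneg
        intro j _
        split_ifs <;> omega
    have hsum : ∑ f ∈ univ.filter (fun f => U ⊆ f), |Φ f| ≤
        (k.factorial : ℤ) * 4 ^ k * (univ.filter (fun j : ι => U ⊆ j.1 ∪ Z j)).card := by
      calc ∑ f ∈ univ.filter (fun f => U ⊆ f), |Φ f|
          ≤ ∑ f ∈ univ.filter (fun f => U ⊆ f), ∑ j : ι,
            (if f ⊆ j.1 ∪ Z j then (k.factorial : ℤ) else 0) := sum_le_sum (fun f _ => hΦb f)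
        _ = ∑ j : ι, ∑ f ∈ univ.filter (fun f => U ⊆ f),
            (if f ⊆ j.1 ∪ Z j then (k.factorial : ℤ) else 0) := sum_comm
        _ ≤ ∑ j : ι, if U ⊆ j.1 ∪ Z j then (k.factorial : ℤ) * 4 ^ k else 0 := by
          apply sum_le_sum
          intro j _
          rw [← sum_filter, filter_filter, sum_const, nsmul_eq_mul]
          split_ifs with h
          · rw [mul_comm]
            apply mul_le_mul_of_nonneg_left _ hL.le
            have h1 : (univ.filter (fun f => U ⊆ f ∧ f ⊆ j.1 ∪ Z j)).card ≤ 4 ^ k := by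
              calc _ ≤ (j.1 ∪ Z j).powerset.card := by
                    apply card_le_card
                    intro f hf
                    simp only [mem_filter, mem_univ, true_and] at hf
                    exact mem_powerset.2 hf.2
                _ = 2 ^ (j.1 ∪ Z j).card := card_powerset _
                _ ≤ 2 ^ (2 * k) := by
                    apply Nat.pow_le_pow_right (by norm_num)
                    have h1 := card_union_le j.1 (Z j)
                    have h2 := he j
                    have h3 := hZc j
                    omega
                _ = 4 ^ k := by rw [pow_mul]; norm_num
            exact_mod_cast h1
          · rw [filter_false_of_mem]
            · simp
            · intro f _ hf
              exact h (hf.1.trans hf.2)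
        _ = _ := by
          rw [← sum_filter, sum_const, nsmul_eq_mul]; ring
    have h1 := hspr U hU
    calc ((∑ f ∈ univ.filter (fun f => U ⊆ f), |Φ f| : ℤ) : ℝ)
        ≤ (k.factorial : ℝ) * 4 ^ k * (univ.filter (fun j : ι => U ⊆ j.1 ∪ Z j)).card := by
          exact_mod_cast hsum
      _ ≤ (k.factorial : ℝ) * 4 ^ k * (ε' / (k.factorial * 4 ^ k) * (n : ℝ) ^ (k - U.card)) := by
          apply mul_le_mul_of_nonneg_left h1 (by positivity)
      _ = _ := by
          field_simp


lemma card_fix {k m : ℕ} [NeZero m] (i : Fin k) (t : ZMod m) :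
    (univ.filter (fun g : Fin k → ZMod m => g i = t)).card = m ^ (k - 1) := by
  classical
  have h : univ.filter (fun g : Fin k → ZMod m => g i = t) =
      Fintype.piFinset (fun j => if j = i then {t} else univ) := by
    ext g
    simp only [mem_filter, mem_univ, true_and, Fintype.mem_piFinset]
    constructor
    · intro h j
      by_cases hj : j = i
      · subst hj; simp [h]
      · simp [hj]
    · intro h
      simpa using h i
  rw [h, Fintype.card_piFinset, ← mul_prod_erase univ _ (mem_univ i)]
  rw [prod_congr rfl (g := fun _ => m)]
  · simp [card_erase_of_mem]
  · intro j hj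
    simp [ne_of_mem_erase hj, ZMod.card]

lemma push_exists (k : ℕ) (hk : 1 ≤ k) (ε : ℝ) (hε : 0 < ε) : ∃ n₀ : ℕ, ∀ n : ℕ, n₀ ≤ n →
    ∃ R : Finset (Finset (Fin n)),
      (∀ T : Finset (Fin n), ((Tᶜ.filter (fun v => insert v T ∈ R)).card : ℝ) ≤ ε * n) ∧
      ∀ e : Finset (Fin n), e.card = k → ∃ P : Finset (Fin n) → ℤ, (∀ f, P f ≠ 0 → f ∈ R) ∧
        ∀ T : Finset (Fin n), T.card + 1 = k → dg P T = if T ⊆ e then 1 else 0 := by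
  classical
  obtain ⟨m, hm⟩ := exists_nat_gt (max 1 (2 * k / ε))
  have hm1 : (1 : ℝ) < m := (le_max_left _ _).trans_lt hm
  have hm2 : (2 * k / ε : ℝ) < m := (le_max_right _ _).trans_lt hm
  have hm0 : 0 < m := by
    have : (0 : ℝ) < m := by linarith
    exact_mod_cast this
  have : NeZero m := ⟨hm0.ne'⟩
  obtain ⟨n₁, hn₁⟩ := exists_nat_gt (2 * (k * m ^ (k - 1)) / ε : ℝ)
  refine ⟨max n₁ (2 * k * m ^ k), ?_⟩
  intro n hn
  have h1 : n₁ ≤ n := (le_max_left _ _).trans hn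
  have h2 : 2 * k * m ^ k ≤ n := (le_max_right _ _).trans hn
  have hcard : Fintype.card (Fin k → ZMod m) = m ^ k := by
    simp [ZMod.card]
  obtain ⟨c, hc⟩ := exists_coloring (Fin k → ZMod m) n
  rw [hcard] at hc
  refine ⟨univ.filter (fun f => ∃ i, (∑ v ∈ f, c v) i = 0), ?_, ?_⟩
  · intro T
    have hb : (Tᶜ.filter (fun v => insert v T ∈
        univ.filter (fun f : Finset (Fin n) => ∃ i, (∑ v ∈ f, c v) i = 0))).card ≤
        k * (m ^ (k - 1) * (n / m ^ k + 1)) := by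
      calc _ ≤ ((univ : Finset (Fin k)).biUnion (fun i => univ.filter (fun v : Fin n =>
              c v i = - (∑ v ∈ T, c v) i))).card := by
            apply card_le_card
            intro v hv
            simp only [mem_filter, mem_compl, mem_univ, true_and, mem_biUnion] at hv ⊢
            obtain ⟨hvT, i, hi⟩ := hv
            refine ⟨i, ?_⟩
            rw [sum_insert hvT, Pi.add_apply] at hi
            exact eq_neg_of_add_eq_zero_left hi
        _ ≤ ∑ i : Fin k, (univ.filter (fun v : Fin n => c v i = - (∑ v ∈ T, c v) i)).card :=
            card_biUnion_le
        _ ≤ ∑ i : Fin k, m ^ (k - 1) * (n / m ^ k + 1) := by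
            apply sum_le_sum
            intro i _
            rw [count_color c (fun g => g i = - (∑ v ∈ T, c v) i)]
            refine (sum_le_sum (fun g _ => (hc g).2)).trans ?_
            rw [sum_const, smul_eq_mul, card_fix]
        _ = _ := by simp
    have hb' : ((Tᶜ.filter (fun v => insert v T ∈
        univ.filter (fun f : Finset (Fin n) => ∃ i, (∑ v ∈ f, c v) i = 0))).card : ℝ) ≤
        k * (m ^ (k - 1) * ((n / m ^ k : ℕ) + 1)) := by exact_mod_cast hb
    refine hb'.trans ?_
    have h3 : ((n / m ^ k : ℕ) : ℝ) ≤ n / (m : ℝ) ^ k := by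
      have := Nat.cast_div_le (m := n) (n := m ^ k) (α := ℝ)
      exact_mod_cast this
    have hmr : (0 : ℝ) < m := by linarith
    have hkr : (0 : ℝ) ≤ k := Nat.cast_nonneg k
    have hnr : (0 : ℝ) ≤ n := Nat.cast_nonneg n
    have h4 : (m : ℝ) ^ (k - 1) * (n / (m : ℝ) ^ k) = n / m := by
      obtain ⟨k', rfl⟩ : ∃ k', k = k' + 1 := ⟨k - 1, by omega⟩
      rw [Nat.add_sub_cancel, pow_succ]
      field_simp
    have h5 : (m : ℝ) ^ (k - 1) * ((n / m ^ k : ℕ) : ℝ) ≤ n / m := by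
      rw [← h4]
      exact mul_le_mul_of_nonneg_left h3 (by positivity)
    have h6 : (k : ℝ) * (n / m) ≤ ε / 2 * n := by
      rw [div_lt_iff₀ hε] at hm2
      rw [mul_div_assoc', div_le_iff₀ hmr]
      nlinarith
    have h7 : (k : ℝ) * (m : ℝ) ^ (k - 1) ≤ ε / 2 * n := by
      rw [div_lt_iff₀ hε] at hn₁
      have : (n₁ : ℝ) ≤ n := by exact_mod_cast h1
      nlinarith
    calc (k : ℝ) * (m ^ (k - 1) * ((n / m ^ k : ℕ) + 1))
        = k * ((m : ℝ) ^ (k - 1) * ((n / m ^ k : ℕ) : ℝ)) + k * (m : ℝ) ^ (k - 1) := by ring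
      _ ≤ k * (n / m) + k * (m : ℝ) ^ (k - 1) := by
          have := mul_le_mul_of_nonneg_left h5 hkr
          linarith
      _ ≤ ε * n := by linarith
  · intro e he
    obtain ⟨P, hP, hP'⟩ := exists_push (k := k) (m := m) (by
      rw [Nat.le_div_iff_mul_le (by positivity)]
      exact h2) c (fun g => (hc g).1) e he
    refine ⟨P, ?_, hP'⟩
    intro f hf
    simpa using hP f hf

lemma hz_deg {n k : ℕ} (c : Fin n → ZMod 2 × (Fin k → ZMod (k + 1)))
    (hc : ∀ g, n / Fintype.card (ZMod 2 × (Fin k → ZMod (k + 1))) ≤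
      (univ.filter (fun v => c v = g)).card ∧ (univ.filter (fun v => c v = g)).card ≤
        n / Fintype.card (ZMod 2 × (Fin k → ZMod (k + 1))) + 1)
    (T : Finset (Fin n)) (hT : T.card + 1 = k) :
    |2 * dg (hz k c) T - n| ≤ Fintype.card (ZMod 2 × (Fin k → ZMod (k + 1))) + 2 * k := by
  classical
  set q := Fintype.card (ZMod 2 × (Fin k → ZMod (k + 1))) with hq
  have hq0 : 0 < q := Fintype.card_pos
  set s := ∑ v ∈ T, c v with hs
  set N := (univ.filter (fun v => gval k (s + c v) = 1)).card with hN
  have h1 : dg (hz k c) T = ((Tᶜ.filter (fun v => gval k (s + c v) = 1)).card : ℤ) := by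
    rw [card_filter]
    push_cast
    unfold dg
    apply sum_congr rfl
    intro v hv
    unfold hz
    rw [sum_insert (by simpa using hv), add_comm]
  have h2 : (Tᶜ.filter (fun v => gval k (s + c v) = 1)).card ≤ N := by
    apply card_le_card
    exact filter_subset_filter _ (subset_univ _)
  have h3 : N ≤ (Tᶜ.filter (fun v => gval k (s + c v) = 1)).card + T.card := by
    rw [hN]
    refine le_trans (card_le_card ?_) (card_union_le _ _)
    intro v hv
    simp only [mem_filter, mem_univ, true_and, mem_union, mem_compl] at hv ⊢
    tauto
  have h4 := gval_half k s
  rw [← hq] at h4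
  have h5 : N = _ := count_color c (fun u => gval k (s + u) = 1)
  set S := univ.filter (fun u => gval k (s + u) = 1) with hS
  have h6 : S.card * (n / q) ≤ N := by
    rw [h5, ← smul_eq_mul, ← sum_const]
    exact sum_le_sum (fun g _ => (hc g).1)
  have h7 : N ≤ S.card * (n / q + 1) := by
    rw [h5, ← smul_eq_mul, ← sum_const]
    exact sum_le_sum (fun g _ => (hc g).2)
  have h8 := Nat.div_add_mod n q
  have h9 := Nat.mod_lt n hq0
  have h6' : q * (n / q) ≤ 2 * N := by
    calc q * (n / q) = (2 * S.card) * (n / q) := by rw [h4]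
      _ = 2 * (S.card * (n / q)) := by ring
      _ ≤ 2 * N := by omega
  have h7' : 2 * N ≤ q * (n / q) + q := by
    calc 2 * N ≤ 2 * (S.card * (n / q + 1)) := by omega
      _ = (2 * S.card) * (n / q) + 2 * S.card := by ring
      _ = _ := by rw [h4]
  rw [h1, abs_le]
  constructor <;> omega

lemma exists_design (k : ℕ) (hk : 1 ≤ k) : ∃ n₀ : ℕ, ∀ n : ℕ, n₀ ≤ n →
    ∃ H : Finset (Finset (Fin n)), (∀ e ∈ H, e.card = k) ∧
      ∀ T : Finset (Fin n), T.card + 1 = k →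
        dg (ind H) T = ((k.factorial * (n / (2 * k.factorial)) : ℕ) : ℤ) := by
  classical
  set L := k.factorial with hL
  have hL0 : 0 < L := k.factorial_pos
  have hLr : (0 : ℝ) < L := by exact_mod_cast hL0
  set q := Fintype.card (ZMod 2 × (Fin k → ZMod (k + 1))) with hq
  obtain ⟨ε3, hε3, n3, H3⟩ := stage3 k hk
  obtain ⟨ε1, hε1, n1, H1⟩ := stage1 k hk (ε3 / 2) (by positivity)
  set ε := min (ε3 / 2) (ε1 / 2) / L with hε
  have hε0 : 0 < ε := by positivity
  have hLε : L * ε = min (ε3 / 2) (ε1 / 2) := by rw [hε]; field_simp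
  obtain ⟨n2, H2⟩ := push_exists k hk ε hε0
  obtain ⟨n4, hn4⟩ := exists_nat_gt ((2 * L + q + 2 * k) / ε1 : ℝ)
  refine ⟨max (max n1 n2) (max n3 n4), ?_⟩
  intro n hn
  have hn1 : n1 ≤ n := by omega
  have hn2 : n2 ≤ n := by omega
  have hn3 : n3 ≤ n := by omega
  have hn4' : n4 ≤ n := by omega
  obtain ⟨c, hc⟩ := exists_coloring (ZMod 2 × (Fin k → ZMod (k + 1))) n
  rw [← hq] at hc
  obtain ⟨R, hR, hP⟩ := H2 n hn2
  choose! P hPR hPdg using hP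
  set K := univ.filter (fun e : Finset (Fin n) => e.card = k) with hK
  set Ψ : Finset (Fin n) → ℤ := fun f => ∑ e ∈ K, (- hz k c e) * P e f with hΨ
  set Φz : Finset (Fin n) → ℤ := fun f => if f.card = k then Ψ f % L else 0 with hΦz
  have hΦzc : ∀ f, f.card ≠ k → Φz f = 0 := by intro f hf; simp [hΦz, hf]
  have hΦzn : ∀ f, 0 ≤ Φz f := by
    intro f
    simp only [hΦz]
    split_ifs
    · exact Int.emod_nonneg _ (by omega)
    · exact le_rfl
  have hΦzb : ∀ f, |Φz f| ≤ if f ∈ R then (L : ℤ) else 0 := by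
    intro f
    rw [abs_of_nonneg (hΦzn f)]
    by_cases hf : f ∈ R
    · rw [if_pos hf]
      simp only [hΦz]
      split_ifs
      · exact (Int.emod_lt_of_pos _ (by omega)).le
      · omega
    · rw [if_neg hf]
      have : Ψ f = 0 := by
        apply sum_eq_zero
        intro e he
        have he' : e.card = k := by simpa [hK] using he
        by_contra h
        exact hf (hPR e he' f (right_ne_zero_of_mul h))
      simp [hΦz, this]
  have hΨdg : ∀ T : Finset (Fin n), T.card + 1 = k → dg Ψ T = - dg (hz k c) T := by
    intro T hT
    rw [hΨ, dg_sum]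
    have e1 : dg (hz k c) T = dg (fun f => if f.card = k then hz k c f else 0) T := by
      unfold dg
      apply sum_congr rfl
      intro v hv
      have hc' : (insert v T).card = k := by
        rw [card_insert_of_notMem (by simpa using hv)]; exact hT
      simp [hc']
    rw [e1, dg_eq_sum _ (by intro f hf; simp [hf]) T hT, ← sum_neg_distrib, hK, sum_filter]
    apply sum_congr rfl
    intro f _
    by_cases hf : f.card = k
    · simp only [hf, if_true]
      rw [dg_mul, hPdg f hf T hT]
      split_ifs <;> simp
    · simp [hf]
  have hΦzdg : ∀ T : Finset (Fin n), T.card + 1 = k → (L : ℤ) ∣ dg (hz k c) T + dg Φz T := by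
    intro T hT
    have : dg (hz k c) T + dg Φz T = dg Φz T - dg Ψ T := by rw [hΨdg T hT]; ring
    rw [this]
    unfold dg
    rw [← sum_sub_distrib]
    apply dvd_sum
    intro v hv
    have hc' : (insert v T).card = k := by
      rw [card_insert_of_notMem (by simpa using hv)]; exact hT
    simp only [hΦz, hc', if_true]
    have := Int.emod_add_mul_ediv (Ψ (insert v T)) L
    exact ⟨- (Ψ (insert v T) / L), by linarith⟩
  have hΦzsz : ∀ T : Finset (Fin n), ((dg (fun f => |Φz f|) T : ℤ) : ℝ) ≤ L * ε * n := by
    intro T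
    have h1 : dg (fun f => |Φz f|) T ≤ (L : ℤ) * (Tᶜ.filter (fun v => insert v T ∈ R)).card := by
      unfold dg
      refine (sum_le_sum (fun v _ => hΦzb (insert v T))).trans ?_
      rw [← sum_filter, sum_const, nsmul_eq_mul, mul_comm]
    have h2 : ((dg (fun f => |Φz f|) T : ℤ) : ℝ) ≤
        (L : ℝ) * (Tᶜ.filter (fun v => insert v T ∈ R)).card := by exact_mod_cast h1
    refine h2.trans ?_
    rw [mul_assoc]
    exact mul_le_mul_of_nonneg_left (hR T) hLr.le
  set lam : ℕ := L * (n / (2 * L)) with hlam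
  set E : Finset (Fin n) → ℤ := fun T =>
    if T.card + 1 = k then lam - (dg (hz k c) T + dg Φz T) else 0 with hE
  have hEc : ∀ T, T.card + 1 ≠ k → E T = 0 := by intro T hT; simp [hE, hT]
  have hnr : (0 : ℝ) ≤ n := Nat.cast_nonneg n
  obtain ⟨Φo, hΦoc, hΦodg, hΦosp⟩ := H1 n hn1 E hEc (by
    intro T
    simp only [hE]
    split_ifs with hT
    · apply dvd_sub
      · rw [hlam]; push_cast; exact dvd_mul_right _ _
      · exact hΦzdg T hT
    · exact dvd_zero _) (by
    apply spread_low E hEc ε1 hε1.le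
    intro T hT
    have h1 := hz_deg c hc T hT
    rw [← hq] at h1
    have h2 : |2 * (lam : ℤ) - n| ≤ 2 * L := by
      have e1 := Nat.div_add_mod n (2 * L)
      have e2 := Nat.mod_lt n (show 0 < 2 * L by omega)
      have e3 : 2 * lam = 2 * L * (n / (2 * L)) := by rw [hlam]; ring
      rw [abs_le]; constructor <;> omega
    have h3 := hΦzsz T
    have h4 : |dg Φz T| ≤ dg (fun f => |Φz f|) T := by
      unfold dg; exact abs_sum_le_sum_abs _ _
    have h5 : 2 * |E T| ≤ 2 * L + (q + 2 * k) + 2 * dg (fun f => |Φz f|) T := by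
      simp only [hE, hT, if_true]
      rw [abs_le] at h1 h2 h4
      rw [show (2 : ℤ) * |(lam : ℤ) - (dg (hz k c) T + dg Φz T)| =
        |2 * ((lam : ℤ) - (dg (hz k c) T + dg Φz T))| by rw [abs_mul]; norm_num]
      rw [abs_le]
      constructor <;> linarith [h1.1, h1.2, h2.1, h2.2, h4.1, h4.2]
    have h6 : (2 : ℝ) * |(E T : ℝ)| ≤
        2 * L + (q + 2 * k) + 2 * ((dg (fun f => |Φz f|) T : ℤ) : ℝ) := by
      exact_mod_cast h5
    rw [div_lt_iff₀ hε1] at hn4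
    have h7 : (n4 : ℝ) ≤ n := by exact_mod_cast hn4'
    have h8 : L * ε * n ≤ ε1 / 2 * n := by
      rw [hLε]; exact mul_le_mul_of_nonneg_right (min_le_right _ _) hnr
    have h9 : (n4 : ℝ) * ε1 ≤ n * ε1 := mul_le_mul_of_nonneg_right h7 hε1.le
    linarith)
  obtain ⟨H, hHk, hHdg⟩ := H3 n hn3 c (fun g => (hc g).1) (fun f => Φz f + Φo f)
    (by intro f hf; simp only [hΦzc f hf, hΦoc f hf, add_zero]) (by
    intro U hU
    have h1 := hΦosp U hU
    have h2 := spread_high Φz hΦzc (ε3 / 2) (by positivity) (by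
      intro T _
      refine (hΦzsz T).trans ?_
      rw [hLε]; exact mul_le_mul_of_nonneg_right (min_le_left _ _) hnr) U hU
    have h3 : ∑ f ∈ univ.filter (fun f => U ⊆ f), |Φz f + Φo f| ≤
        ∑ f ∈ univ.filter (fun f => U ⊆ f), |Φz f| +
        ∑ f ∈ univ.filter (fun f => U ⊆ f), |Φo f| := by
      rw [← sum_add_distrib]
      exact sum_le_sum (fun f _ => abs_add_le _ _)
    have h4 : ((∑ f ∈ univ.filter (fun f => U ⊆ f), |Φz f + Φo f| : ℤ) : ℝ) ≤
        ((∑ f ∈ univ.filter (fun f => U ⊆ f), |Φz f| : ℤ) : ℝ) +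
        ((∑ f ∈ univ.filter (fun f => U ⊆ f), |Φo f| : ℤ) : ℝ) := by
      exact_mod_cast h3
    linarith)
  refine ⟨H, hHk, ?_⟩
  intro T hT
  rw [hHdg T hT, dg_add, hΦodg T hT]
  simp only [hE, hT, if_true]
  ring


lemma sum_super {n k : ℕ} (μ : Finset (Fin n) → ℤ) (hμ : ∀ f, f.card ≠ k → μ f = 0)
    (h0 : ∀ T : Finset (Fin n), T.card + 1 = k → dg μ T = 0) :
    ∀ d : ℕ, ∀ J : Finset (Fin n), J.card + 1 + d = k → ∑ f, (if J ⊆ f then μ f else 0) = 0 := by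
  intro d
  induction d with
  | zero =>
    intro J hJ
    rw [← dg_eq_sum μ hμ J (by omega)]
    exact h0 J (by omega)
  | succ d ih =>
    intro J hJ
    have h1 : ∑ x ∈ Jᶜ, ∑ f, (if insert x J ⊆ f then μ f else 0) = 0 := by
      apply sum_eq_zero
      intro x hx
      apply ih
      rw [card_insert_of_notMem (by simpa using hx)]; omega
    rw [sum_comm] at h1
    have h2 : ∀ f, ∑ x ∈ Jᶜ, (if insert x J ⊆ f then μ f else 0) =
        ((k : ℤ) - J.card) * if J ⊆ f then μ f else 0 := by
      intro f
      by_cases hf : f.card = k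
      · by_cases hJf : J ⊆ f
        · rw [← sum_filter, sum_const, nsmul_eq_mul, if_pos hJf]
          congr 1
          have : Jᶜ.filter (fun x => insert x J ⊆ f) = f \ J := by
            ext x
            simp only [mem_filter, mem_compl, mem_sdiff, insert_subset_iff]
            tauto
          rw [this, card_sdiff_of_subset hJf, hf, Nat.cast_sub (by omega)]
        · rw [if_neg hJf, mul_zero]
          apply sum_eq_zero
          intro x _
          rw [if_neg]
          exact fun h => hJf ((subset_insert _ _).trans h)
      · rw [hμ f hf]; simp
    rw [sum_congr rfl (fun f _ => h2 f), ← mul_sum] at h1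
    rcases mul_eq_zero.1 h1 with h | h
    · omega
    · exact h

lemma orth_D {n k : ℕ} (hk : 1 ≤ k) (μ : Finset (Fin n) → ℤ) (hμ : ∀ f, f.card ≠ k → μ f = 0)
    (h0 : ∀ T : Finset (Fin n), T.card + 1 = k → dg μ T = 0) (W : Finset (Fin n)) :
    ∑ f, μ f * ((if Disjoint f W then 1 else 0) - (-1) ^ k * (if f ⊆ W then 1 else 0)) = 0 := by
  classical
  have h1 : ∑ J ∈ W.powerset.filter (fun J => J.card < k),
      (-1 : ℤ) ^ J.card * ∑ f, (if J ⊆ f then μ f else 0) = 0 := by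
    apply sum_eq_zero
    intro J hJ
    simp only [mem_filter] at hJ
    rw [sum_super μ hμ h0 (k - 1 - J.card) J (by omega), mul_zero]
  simp only [mul_sum] at h1
  rw [sum_comm] at h1
  refine Eq.trans ?_ h1
  apply sum_congr rfl
  intro f _
  by_cases hf : f.card = k
  · have e1 : ∑ J ∈ W.powerset.filter (fun J => J.card < k),
        (-1 : ℤ) ^ J.card * (if J ⊆ f then μ f else 0) =
        μ f * ∑ J ∈ (f ∩ W).powerset.filter (fun J => J.card < k), (-1 : ℤ) ^ J.card := by
      rw [mul_sum]
      have : (f ∩ W).powerset.filter (fun J => J.card < k) =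
          (W.powerset.filter (fun J => J.card < k)).filter (fun J => J ⊆ f) := by
        ext J
        simp only [mem_filter, mem_powerset, subset_inter_iff]
        tauto
      rw [this, sum_filter (fun J => J ⊆ f)]
      apply sum_congr rfl
      intro J _
      split_ifs <;> ring
    rw [e1]
    congr 1
    have e2 := sum_filter_add_sum_filter_not (f ∩ W).powerset (fun J => J.card < k)
      (fun J => (-1 : ℤ) ^ J.card)
    rw [sum_powerset_neg_one_pow_card] at e2
    have e3 : ∑ J ∈ (f ∩ W).powerset.filter (fun J => ¬ J.card < k), (-1 : ℤ) ^ J.card =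
        (-1) ^ k * (if f ⊆ W then 1 else 0) := by
      by_cases hW : f ⊆ W
      · have : (f ∩ W).powerset.filter (fun J => ¬ J.card < k) = {f} := by
          ext J
          simp only [mem_filter, mem_powerset, mem_singleton, inter_eq_left.2 hW]
          constructor
          · rintro ⟨a, b⟩
            exact eq_of_subset_of_card_le a (by omega)
          · rintro rfl
            exact ⟨Subset.refl _, by omega⟩
        rw [this, sum_singleton, hf, if_pos hW, mul_one]
      · rw [if_neg hW, mul_zero, filter_false_of_mem, sum_empty]
        intro J hJ hJk
        rw [mem_powerset] at hJ
        apply hW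
        have hJf : J = f := eq_of_subset_of_card_le (hJ.trans inter_subset_left) (by omega)
        rw [← hJf]
        exact hJ.trans inter_subset_right
    rw [e3] at e2
    have e4 : (if f ∩ W = ∅ then (1 : ℤ) else 0) = if Disjoint f W then 1 else 0 := by
      simp only [disjoint_iff_inter_eq_empty]
    rw [e4] at e2
    rw [← e2]
    ring
  · simp [hμ f hf]

lemma exists_G (k n : ℕ) (hk : 3 ≤ k) : ∃ G : Finset (Finset (Fin n)), (∀ e ∈ G, e.card = k) ∧
    (∀ f : Finset (Fin n), f.card = k → (∀ r < k, ∃ v ∈ f, v.val % k = r) → f ∈ G) ∧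
    (∀ f : Finset (Fin n), (∀ v ∈ f, v.val % k = 0) → f ∉ G) ∧
    ∀ μ : Finset (Fin n) → ℤ, (∀ f, f.card ≠ k → μ f = 0) →
      (∀ T : Finset (Fin n), T.card + 1 = k → dg μ T = 0) → ∑ f ∈ G, μ f = 0 := by
  classical
  set A := univ.filter (fun v : Fin n => v.val % k = 0) with hA
  set B := univ.filter (fun v : Fin n => v.val % k = 1) with hB
  set C := univ.filter (fun v : Fin n => v.val % k ≠ 0 ∧ v.val % k ≠ 1) with hC
  have htot : ∀ μ : Finset (Fin n) → ℤ, (∀ f, f.card ≠ k → μ f = 0) →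
      (∀ T : Finset (Fin n), T.card + 1 = k → dg μ T = 0) → ∑ f, μ f = 0 := by
    intro μ hμ h0
    have := sum_super μ hμ h0 (k - 1) ∅ (by simp; omega)
    simpa using this
  have hmem : ∀ (f X : Finset (Fin n)), ¬ Disjoint f X ↔ ∃ v ∈ f, v ∈ X := by
    intro f X
    exact not_disjoint_iff
  rcases Nat.even_or_odd k with hev | hodd
  · refine ⟨univ.filter (fun f => f.card = k ∧ ¬ Disjoint f A ∧ ¬ Disjoint f B ∧ ¬ Disjoint f C),
      ?_, ?_, ?_, ?_⟩
    · intro e he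
      simp only [mem_filter] at he
      exact he.2.1
    · intro f hf hr
      simp only [mem_filter, mem_univ, true_and, hmem]
      refine ⟨hf, ?_, ?_, ?_⟩
      · obtain ⟨v, hv, h⟩ := hr 0 (by omega)
        exact ⟨v, hv, by simp [hA, h]⟩
      · obtain ⟨v, hv, h⟩ := hr 1 (by omega)
        exact ⟨v, hv, by simp [hB, h]⟩
      · obtain ⟨v, hv, h⟩ := hr 2 (by omega)
        exact ⟨v, hv, by simp [hC, h]⟩
    · intro f hf hG
      simp only [mem_filter, mem_univ, true_and, hmem] at hG
      obtain ⟨v, hv, hvB⟩ := hG.2.2.1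
      have := hf v hv
      simp [hB, this] at hvB
    · intro μ hμ h0
      have a1 := orth_D (by omega) μ hμ h0 A
      have a2 := orth_D (by omega) μ hμ h0 B
      have a3 := orth_D (by omega) μ hμ h0 C
      have a4 := htot μ hμ h0
      rw [hev.neg_one_pow] at a1 a2 a3
      have : ∑ f ∈ univ.filter (fun f => f.card = k ∧ ¬ Disjoint f A ∧ ¬ Disjoint f B ∧
          ¬ Disjoint f C), μ f = ∑ f, μ f -
          (∑ f, μ f * ((if Disjoint f A then 1 else 0) - 1 * (if f ⊆ A then 1 else 0)) +
          ∑ f, μ f * ((if Disjoint f B then 1 else 0) - 1 * (if f ⊆ B then 1 else 0)) +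
          ∑ f, μ f * ((if Disjoint f C then 1 else 0) - 1 * (if f ⊆ C then 1 else 0))) := by
        rw [← sum_add_distrib, ← sum_add_distrib, ← sum_sub_distrib, sum_filter]
        apply sum_congr rfl
        intro f _
        by_cases hf : f.card = k
        · have hne : f.Nonempty := card_pos.1 (by omega)
          obtain ⟨w, hw⟩ := hne
          have hcov : ∀ v : Fin n, v ∈ A ∨ v ∈ B ∨ v ∈ C := by
            intro v; simp only [hA, hB, hC, mem_filter, mem_univ, true_and]; tauto
          have hAB : ∀ v : Fin n, v ∈ A → v ∉ B ∧ v ∉ C := by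
            intro v; simp only [hA, hB, hC, mem_filter, mem_univ, true_and]; omega
          have hBC : ∀ v : Fin n, v ∈ B → v ∉ A ∧ v ∉ C := by
            intro v; simp only [hA, hB, hC, mem_filter, mem_univ, true_and]; omega
          have hsA : f ⊆ A ↔ Disjoint f B ∧ Disjoint f C := by
            constructor
            · intro h
              exact ⟨disjoint_left.2 fun v hv => (hAB v (h hv)).1,
                disjoint_left.2 fun v hv => (hAB v (h hv)).2⟩
            · rintro ⟨h1, h2⟩ v hv
              have := disjoint_left.1 h1 hv
              have := disjoint_left.1 h2 hv
              have := hcov v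
              tauto
          have hsB : f ⊆ B ↔ Disjoint f A ∧ Disjoint f C := by
            constructor
            · intro h
              exact ⟨disjoint_left.2 fun v hv => (hBC v (h hv)).1,
                disjoint_left.2 fun v hv => (hBC v (h hv)).2⟩
            · rintro ⟨h1, h2⟩ v hv
              have := disjoint_left.1 h1 hv
              have := disjoint_left.1 h2 hv
              have := hcov v
              tauto
          have hsC : f ⊆ C ↔ Disjoint f A ∧ Disjoint f B := by
            constructor
            · intro h
              exact ⟨disjoint_left.2 fun v hv hA' => (hAB v hA').2 (h hv),
                disjoint_left.2 fun v hv hB' => (hBC v hB').2 (h hv)⟩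
            · rintro ⟨h1, h2⟩ v hv
              have := disjoint_left.1 h1 hv
              have := disjoint_left.1 h2 hv
              have := hcov v
              tauto
          have hno : ¬ (Disjoint f A ∧ Disjoint f B ∧ Disjoint f C) := by
            rintro ⟨h1, h2, h3⟩
            have := disjoint_left.1 h1 hw
            have := disjoint_left.1 h2 hw
            have := disjoint_left.1 h3 hw
            have := hcov w
            tauto
          simp only [hsA, hsB, hsC, hf, true_and]
          by_cases p1 : Disjoint f A <;> by_cases p2 : Disjoint f B <;>
            by_cases p3 : Disjoint f C <;> simp [p1, p2, p3] at hno ⊢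
        · simp [hμ f hf]
      rw [this, a1, a2, a3, a4]; norm_num
  · refine ⟨univ.filter (fun f => f.card = k ∧ ¬ Disjoint f A ∧ ¬ f ⊆ A), ?_, ?_, ?_, ?_⟩
    · intro e he
      simp only [mem_filter] at he
      exact he.2.1
    · intro f hf hr
      simp only [mem_filter, mem_univ, true_and, hmem]
      refine ⟨hf, ?_, ?_⟩
      · obtain ⟨v, hv, h⟩ := hr 0 (by omega)
        exact ⟨v, hv, by simp [hA, h]⟩
      · obtain ⟨v, hv, h⟩ := hr 1 (by omega)
        intro hs
        have := hs hv
        simp [hA, h] at this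
    · intro f hf hG
      simp only [mem_filter, mem_univ, true_and] at hG
      apply hG.2.2
      intro v hv
      simp [hA, hf v hv]
    · intro μ hμ h0
      have a1 := orth_D (by omega) μ hμ h0 A
      have a4 := htot μ hμ h0
      rw [hodd.neg_one_pow] at a1
      have : ∑ f ∈ univ.filter (fun f => f.card = k ∧ ¬ Disjoint f A ∧ ¬ f ⊆ A), μ f =
          ∑ f, μ f - ∑ f, μ f * ((if Disjoint f A then 1 else 0) - (-1) *
            (if f ⊆ A then 1 else 0)) := by
        rw [← sum_sub_distrib, sum_filter]
        apply sum_congr rfl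
        intro f _
        by_cases hf : f.card = k
        · have hne : f.Nonempty := card_pos.1 (by omega)
          obtain ⟨w, hw⟩ := hne
          have hno : ¬ (Disjoint f A ∧ f ⊆ A) := by
            rintro ⟨h1, h2⟩
            exact disjoint_left.1 h1 hw (h2 hw)
          by_cases p1 : Disjoint f A <;> by_cases p2 : f ⊆ A <;> simp [p1, p2, hf] at hno ⊢
        · simp [hμ f hf]
      rw [this, a1, a4]; norm_num

lemma design_card {n k : ℕ} (hk : 1 ≤ k) (H : Finset (Finset (Fin n)))
    (hH : ∀ e ∈ H, e.card = k) (lam : ℤ)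
    (hd : ∀ T : Finset (Fin n), T.card + 1 = k → dg (ind H) T = lam) :
    (H.card : ℤ) * k = lam * (n.choose (k - 1)) := by
  classical
  have h1 : ∑ T ∈ powersetCard (k - 1) (univ : Finset (Fin n)), dg (ind H) T =
      lam * (n.choose (k - 1)) := by
    rw [sum_congr rfl (g := fun _ => lam)]
    · rw [sum_const, card_powersetCard, nsmul_eq_mul, mul_comm]; simp
    · intro T hT
      rw [mem_powersetCard] at hT
      exact hd T (by omega)
  rw [← h1]
  have h2 : ∀ T ∈ powersetCard (k - 1) (univ : Finset (Fin n)), dg (ind H) T =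
      ∑ f ∈ H, if T ⊆ f then 1 else 0 := by
    intro T hT
    rw [mem_powersetCard] at hT
    rw [dg_eq_sum (k := k) (ind H) (by
      intro f hf
      unfold ind
      rw [if_neg]
      exact fun h => hf (hH f h)) T (by omega)]
    rw [← sum_subset (subset_univ H)]
    · apply sum_congr rfl
      intro f hf
      simp [ind, hf]
    · intro f _ hf
      simp [ind, hf]
  rw [sum_congr rfl h2, sum_comm, sum_congr rfl (g := fun _ => (k : ℤ))]
  · rw [sum_const, nsmul_eq_mul]
  · intro f hf
    have : (powersetCard (k - 1) (univ : Finset (Fin n))).filter (fun T => T ⊆ f) =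
        powersetCard (k - 1) f := by
      ext T
      simp only [mem_filter, mem_powersetCard, subset_univ, true_and]
      tauto
    rw [← sum_filter, this, sum_const, card_powersetCard, hH f hf, nsmul_eq_mul, mul_one,
      Nat.choose_symm_of_eq_add (show k = (k - 1) + 1 by omega), Nat.choose_one_right]

lemma choose_rec {n k : ℕ} (hk : 1 ≤ k) :
    n.choose k * k = n.choose (k - 1) * (n - (k - 1)) := by
  obtain ⟨k', rfl⟩ : ∃ k', k = k' + 1 := ⟨k - 1, by omega⟩
  rw [Nat.choose_succ_right_eq]; rfl

lemma design_card' {n k : ℕ} (hk : 1 ≤ k) (hkn : k ≤ n) (H : Finset (Finset (Fin n)))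
    (hH : ∀ e ∈ H, e.card = k) (lam : ℤ)
    (hd : ∀ T : Finset (Fin n), T.card + 1 = k → dg (ind H) T = lam) :
    (H.card : ℤ) * ((n - (k - 1) : ℕ) : ℤ) = lam * n.choose k := by
  have h1 := design_card hk H hH lam hd
  have h2 : (n.choose k : ℤ) * k = n.choose (k - 1) * ((n - (k - 1) : ℕ) : ℤ) := by
    exact_mod_cast choose_rec (n := n) hk
  have hk0 : (k : ℤ) ≠ 0 := by omega
  apply mul_right_cancel₀ hk0
  linear_combination ((n - (k - 1) : ℕ) : ℤ) * h1 - lam * h2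

lemma perm_count {n k : ℕ} (hk : 1 ≤ k) (hkn : k ≤ n) (G H : Finset (Finset (Fin n)))
    (hG : ∀ e ∈ G, e.card = k) (hH : ∀ e ∈ H, e.card = k) (lam : ℤ)
    (hd : ∀ T : Finset (Fin n), T.card + 1 = k → dg (ind H) T = lam)
    (horth : ∀ μ : Finset (Fin n) → ℤ, (∀ f, f.card ≠ k → μ f = 0) →
      (∀ T : Finset (Fin n), T.card + 1 = k → dg μ T = 0) → ∑ f ∈ G, μ f = 0)
    (ρ : Equiv.Perm (Fin n)) :
    (n.choose k : ℤ) * (G.filter (fun f => f.image ρ ∈ H)).card = G.card * H.card := by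
  classical
  set μ : Finset (Fin n) → ℤ := fun f =>
    if f.card = k then (n.choose k : ℤ) * ind H (f.image ρ) - H.card else 0 with hμ
  have h1 := horth μ (by intro f hf; simp [hμ, hf]) (by
    intro T hT
    have e1 : dg μ T = ∑ x ∈ Tᶜ, ((n.choose k : ℤ) * ind H ((insert x T).image ρ) - H.card) := by
      unfold dg
      apply sum_congr rfl
      intro v hv
      have hc' : (insert v T).card = k := by
        rw [card_insert_of_notMem (by simpa using hv)]; exact hT
      simp only [hμ, hc', if_true]
    have e2 : ∑ x ∈ Tᶜ, ind H ((insert x T).image ρ) = dg (ind H) (T.image ρ) := by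
      unfold dg
      apply sum_bij (fun x _ => ρ x)
      · intro x hx
        simpa using hx
      · intro a _ b _ h
        exact ρ.injective h
      · intro b hb
        refine ⟨ρ.symm b, ?_, by simp⟩
        simp only [mem_compl, mem_image, not_exists, not_and] at hb ⊢
        intro h
        exact hb _ h (by simp)
      · intro x _
        rw [image_insert]
    have hc : (T.image ρ).card + 1 = k := by
      rw [card_image_of_injective _ ρ.injective]; exact hT
    rw [e1, sum_sub_distrib, ← mul_sum, e2, hd _ hc, sum_const, card_compl, Fintype.card_fin,
      nsmul_eq_mul]
    have h3 := design_card' hk hkn H hH lam hd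
    rw [show n - T.card = n - (k - 1) by omega]
    linarith)
  have h2 : ∑ f ∈ G, μ f = (n.choose k : ℤ) * (G.filter (fun f => f.image ρ ∈ H)).card -
      G.card * H.card := by
    rw [card_filter]
    push_cast
    rw [mul_sum, ← nsmul_eq_mul, ← sum_const, ← sum_sub_distrib]
    apply sum_congr rfl
    intro f hf
    simp only [hμ, hG f hf, if_true, ind]
  linarith

lemma count_trans {n k M : ℕ} (φ : Fin k × Fin M → Fin n) (hφ : Function.Injective φ)
    (S : Finset (Finset (Fin n)))
    (hS : ∀ g : Fin k → Fin M, univ.image (fun r => φ (r, g r)) ∈ S) : M ^ k ≤ S.card := by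
  classical
  calc M ^ k = (univ : Finset (Fin k → Fin M)).card := by simp
    _ ≤ S.card := by
      apply card_le_card_of_injOn (fun g => univ.image (fun r => φ (r, g r)))
      · intro g _
        exact hS g
      · intro g _ g' _ h
        funext r
        have h1 : φ (r, g r) ∈ univ.image (fun r => φ (r, g' r)) := by
          simp only at h
          rw [← h]
          exact mem_image_of_mem (fun r => φ (r, g r)) (mem_univ r)
        simp only [mem_image, mem_univ, true_and] at h1
        obtain ⟨r', hr'⟩ := h1
        have h2 := hφ hr'
        rw [Prod.mk.injEq] at h2
        obtain ⟨rfl, h3⟩ := h2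
        exact h3.symm


lemma perm_inter_card {n : ℕ} (G H : Finset (Finset (Fin n))) (σ τ : Equiv.Perm (Fin n)) :
    (permEdges σ G ∩ permEdges τ H).card =
      (G.filter (fun f => f.image (σ.trans τ.symm) ∈ H)).card := by
  classical
  have hinj : Function.Injective (fun e : Finset (Fin n) => e.image σ) :=
    image_injective σ.injective
  rw [← card_image_of_injective (G.filter _) hinj]
  congr 1
  ext f
  simp only [permEdges, mem_inter, mem_image, mem_filter]
  constructor
  · rintro ⟨⟨a, ha, rfl⟩, b, hb, hab⟩
    refine ⟨a, ⟨ha, ?_⟩, rfl⟩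
    have : a.image (σ.trans τ.symm) = b := by
      rw [Equiv.coe_trans, ← image_image, ← hab, image_image]
      simp
    rw [this]; exact hb
  · rintro ⟨a, ⟨ha, hb⟩, rfl⟩
    refine ⟨⟨a, ha, rfl⟩, _, hb, ?_⟩
    rw [image_image]
    congr 1
    funext v
    simp

lemma G_dens {n k : ℕ} (hk : 3 ≤ k) (G : Finset (Finset (Fin n)))
    (hGk : ∀ e ∈ G, e.card = k)
    (h1 : ∀ f : Finset (Fin n), f.card = k → (∀ r < k, ∃ v ∈ f, v.val % k = r) → f ∈ G)
    (h2 : ∀ f : Finset (Fin n), (∀ v ∈ f, v.val % k = 0) → f ∉ G) :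
    (n / (k * k)) ^ k ≤ G.card ∧ G.card + (n / (k * k)) ^ k ≤ n.choose k := by
  classical
  set M := n / (k * k) with hM
  have hMn : k * k * M ≤ n := Nat.mul_div_le n (k * k)
  have hb : ∀ (r : Fin k) (i : Fin M), r.val + k * i.val < k * M := by
    intro r i
    have h3 := r.isLt
    have h4 : k * (i.val + 1) ≤ k * M := Nat.mul_le_mul_left k i.isLt
    rw [Nat.mul_add] at h4
    omega
  have hb1 : ∀ (r : Fin k) (i : Fin M), r.val + k * i.val < n := by
    intro r i
    have h3 := hb r i
    nlinarith
  have hb2 : ∀ (r : Fin k) (i : Fin M), k * (r.val + k * i.val) < n := by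
    intro r i
    have h3 := hb r i
    nlinarith
  have hinj0 : ∀ (r r' : Fin k) (i i' : Fin M), r.val + k * i.val = r'.val + k * i'.val →
      (r, i) = (r', i') := by
    intro r r' i i' h
    have e1 : (r.val + k * i.val) % k = r.val := by
      rw [Nat.add_mul_mod_self_left, Nat.mod_eq_of_lt r.isLt]
    have e2 : (r'.val + k * i'.val) % k = r'.val := by
      rw [Nat.add_mul_mod_self_left, Nat.mod_eq_of_lt r'.isLt]
    have e3 : r.val = r'.val := by rw [← e1, ← e2, h]
    have e4 : k * i.val = k * i'.val := by omega
    have e5 : i.val = i'.val := Nat.eq_of_mul_eq_mul_left (by omega) e4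
    rw [Prod.mk.injEq]
    exact ⟨Fin.ext e3, Fin.ext e5⟩
  set φ1 : Fin k × Fin M → Fin n := fun p => ⟨p.1.val + k * p.2.val, hb1 p.1 p.2⟩ with hφ1
  set φ2 : Fin k × Fin M → Fin n := fun p => ⟨k * (p.1.val + k * p.2.val), hb2 p.1 p.2⟩ with hφ2
  have hi1 : Function.Injective φ1 := by
    rintro ⟨r, i⟩ ⟨r', i'⟩ h
    exact hinj0 r r' i i' (congrArg Fin.val h)
  have hi2 : Function.Injective φ2 := by
    rintro ⟨r, i⟩ ⟨r', i'⟩ h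
    exact hinj0 r r' i i' (Nat.eq_of_mul_eq_mul_left (by omega) (congrArg Fin.val h))
  have hcard : ∀ φ : Fin k × Fin M → Fin n, Function.Injective φ → ∀ g : Fin k → Fin M,
      (univ.image (fun r => φ (r, g r))).card = k := by
    intro φ hφ g
    rw [card_image_of_injective]
    · simp
    · intro r r' h
      have := hφ h
      rw [Prod.mk.injEq] at this
      exact this.1
  constructor
  · apply count_trans φ1 hi1
    intro g
    apply h1 _ (hcard φ1 hi1 g)
    intro r hr
    refine ⟨φ1 (⟨r, hr⟩, g ⟨r, hr⟩), mem_image_of_mem (fun r => φ1 (r, g r)) (mem_univ _), ?_⟩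
    simp only [hφ1]
    rw [Nat.add_mul_mod_self_left, Nat.mod_eq_of_lt hr]
  · have h3 : M ^ k ≤ (powersetCard k (univ : Finset (Fin n)) \ G).card := by
      apply count_trans φ2 hi2
      intro g
      rw [mem_sdiff, mem_powersetCard]
      refine ⟨⟨subset_univ _, hcard φ2 hi2 g⟩, ?_⟩
      apply h2
      intro v hv
      simp only [mem_image, mem_univ, true_and] at hv
      obtain ⟨r, rfl⟩ := hv
      simp [hφ2]
    have hsub : G ⊆ powersetCard k (univ : Finset (Fin n)) := by
      intro e he
      rw [mem_powersetCard]
      exact ⟨subset_univ _, hGk e he⟩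
    have h4 := card_sdiff_add_card_eq_card hsub
    rw [card_powersetCard, card_univ, Fintype.card_fin] at h4
    omega

theorem stmt1 :
    ∀ k : ℕ, 3 ≤ k →
      ∃ γ : ℝ, 0 < γ ∧ γ < 1 / 2 ∧ ∃ n₀ : ℕ, ∀ n : ℕ, n₀ ≤ n →
        ∃ G H : Finset (Finset (Fin n)),
          (∀ e ∈ G, e.card = k) ∧ (∀ e ∈ H, e.card = k) ∧
          γ < (G.card : ℝ) / (n.choose k : ℝ) ∧
          (G.card : ℝ) / (n.choose k : ℝ) < 1 - γ ∧
          γ < (H.card : ℝ) / (n.choose k : ℝ) ∧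
          (H.card : ℝ) / (n.choose k : ℝ) < 1 - γ ∧
          disc n k G H = 0 := by
  intro k hk
  have hkr : (3 : ℝ) ≤ k := by exact_mod_cast hk
  obtain ⟨n₁, hn₁⟩ := exists_design k (by omega)
  set L := k.factorial with hL
  have hL0 : 0 < L := k.factorial_pos
  set β : ℝ := (1 / (2 * (k * k))) ^ k with hβ
  have hβ0 : 0 < β := by positivity
  have hβ1 : β < 1 / 4 := by
    have h1 : (1 / (2 * ((k : ℝ) * k))) ≤ 1 / 18 := by
      apply one_div_le_one_div_of_le (by norm_num)
      nlinarith
    have h2 : β ≤ 1 / (2 * ((k : ℝ) * k)) := by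
      apply pow_le_of_le_one (by positivity) (by linarith) (by omega)
    linarith
  refine ⟨β / 2, by linarith, by linarith, max n₁ (max (2 * (k * k)) (max (4 * L) (4 * k))), ?_⟩
  intro n hn
  have hn1 : n₁ ≤ n := by omega
  have hn2 : 2 * (k * k) ≤ n := by omega
  have hn3 : 4 * L ≤ n := by omega
  have hn4 : 4 * k ≤ n := by omega
  obtain ⟨G, hGk, hG1, hG2, hGo⟩ := exists_G k n hk
  obtain ⟨H, hHk, hHd⟩ := hn₁ n hn1
  obtain ⟨g1, g2⟩ := G_dens hk G hGk hG1 hG2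
  have hC0 : 0 < n.choose k := Nat.choose_pos (by omega)
  have hCr : (0 : ℝ) < n.choose k := by exact_mod_cast hC0
  have hnr : (0 : ℝ) < n := by
    have : 0 < n := by omega
    exact_mod_cast this
  have hM : β * n.choose k ≤ (((n / (k * k)) ^ k : ℕ) : ℝ) := by
    have e1 : (n.choose k : ℝ) ≤ (n : ℝ) ^ k := by exact_mod_cast Nat.choose_le_pow n k
    have e2 : (1 / (2 * (k * k)) : ℝ) * n ≤ ((n / (k * k) : ℕ) : ℝ) := by
      have f1 : n < k * k * (n / (k * k)) + k * k := by
        have := Nat.lt_mul_div_succ n (show 0 < k * k by nlinarith)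
        rw [Nat.mul_add] at this; omega
      have f2 : (n : ℝ) < k * k * ((n / (k * k) : ℕ) : ℝ) + k * k := by exact_mod_cast f1
      have f3 : (2 * (k * k) : ℝ) ≤ n := by exact_mod_cast hn2
      rw [div_mul_eq_mul_div, one_mul, div_le_iff₀ (by positivity)]
      nlinarith
    calc β * n.choose k ≤ β * (n : ℝ) ^ k := mul_le_mul_of_nonneg_left e1 hβ0.le
      _ = ((1 / (2 * (k * k)) : ℝ) * n) ^ k := by rw [hβ, mul_pow]
      _ ≤ ((n / (k * k) : ℕ) : ℝ) ^ k := pow_le_pow_left₀ (by positivity) e2 k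
      _ = _ := by push_cast; rfl
  have g1' : (((n / (k * k)) ^ k : ℕ) : ℝ) ≤ G.card := by exact_mod_cast g1
  have g2' : (G.card : ℝ) + (((n / (k * k)) ^ k : ℕ) : ℝ) ≤ n.choose k := by exact_mod_cast g2
  have hHc := design_card' (by omega) (by omega) H hHk _ hHd
  set lam := L * (n / (2 * L)) with hlam
  set N := n - (k - 1) with hN
  have hHc' : (H.card : ℝ) * N = lam * n.choose k := by exact_mod_cast hHc
  have hl1 : n ≤ 4 * lam := by
    have e1 := Nat.div_add_mod n (2 * L)
    have e2 := Nat.mod_lt n (show 0 < 2 * L by omega)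
    have e3 : 2 * lam = 2 * L * (n / (2 * L)) := by rw [hlam]; ring
    omega
  have hl2 : 2 * lam ≤ n := by
    have e1 := Nat.div_add_mod n (2 * L)
    have e3 : 2 * lam = 2 * L * (n / (2 * L)) := by rw [hlam]; ring
    omega
  have hNl : N ≤ n := by omega
  have hNu : 3 * n ≤ 4 * N := by omega
  have hl1' : (n : ℝ) ≤ 4 * lam := by exact_mod_cast hl1
  have hl2' : 2 * (lam : ℝ) ≤ n := by exact_mod_cast hl2
  have hNl' : (N : ℝ) ≤ n := by exact_mod_cast hNl
  have hNu' : 3 * (n : ℝ) ≤ 4 * N := by exact_mod_cast hNu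
  have hNpos : (0 : ℝ) < N := by linarith
  refine ⟨G, H, hGk, hHk, ?_, ?_, ?_, ?_, ?_⟩
  · rw [lt_div_iff₀ hCr]
    nlinarith [mul_pos hβ0 hCr]
  · rw [div_lt_iff₀ hCr]
    nlinarith [mul_pos hβ0 hCr]
  · have : (H.card : ℝ) / n.choose k = lam / N := by
      rw [div_eq_div_iff hCr.ne' hNpos.ne', hHc']
    rw [this, lt_div_iff₀ hNpos]
    nlinarith
  · have : (H.card : ℝ) / n.choose k = lam / N := by
      rw [div_eq_div_iff hCr.ne' hNpos.ne', hHc']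
    rw [this, div_lt_iff₀ hNpos]
    nlinarith
  · unfold disc
    have hz0 : ∀ p : Equiv.Perm (Fin n) × Equiv.Perm (Fin n),
        |((permEdges p.1 G ∩ permEdges p.2 H).card : ℝ) -
          ((G.card : ℝ) * H.card) / (n.choose k)| = 0 := by
      intro p
      have e1 := perm_count (by omega) (by omega) G H hGk hHk _ hHd hGo (p.1.trans p.2.symm)
      rw [← perm_inter_card] at e1
      have e2 : (n.choose k : ℝ) * ((permEdges p.1 G ∩ permEdges p.2 H).card : ℝ) =
          G.card * H.card := by exact_mod_cast e1
      rw [abs_eq_zero, sub_eq_zero, eq_div_iff hCr.ne', ← e2, mul_comm]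
    rw [iSup_congr hz0]
    exact ciSup_const
end

section
/- g(2) = 0; g(k) = 1 for every integer k with 3 ≤ k ≤ 13; and g(k) ≤ 3 for every integer k with 14 ≤ k ≤ 128. -/
open Finset

/-- g(k): the smallest g ≥ 0 such that for every m ∈ [2,k], the binary system
Σ_{0 ≤ i ≤ r} (-1)^i C(r,i) α_i = 0 (r = m-g, ..., m) with α ∈ {0,1}^{m+1}
has only the all-zero and all-one solutions. -/
noncomputable def gDef (k : ℕ) : ℕ :=
  sInf {g : ℕ |
    ∀ m : ℕ, 2 ≤ m → m ≤ k →
      ∀ α : ℕ → Bool,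
        (∀ r ∈ Finset.Icc (m - g) m,
          ∑ i ∈ Finset.range (r + 1),
            (-1 : ℤ) ^ i * (r.choose i) * (if α i then 1 else 0) = 0) →
        ∀ i ≤ m, α i = α 0}

/-! ### Differences -/

/-- The indicator value. -/
def bv (α : ℕ → Bool) (i : ℕ) : ℤ := if α i then 1 else 0

/-- Alternating binomial sum with shift. -/
def dsum (f : ℕ → ℤ) (r s : ℕ) : ℤ :=
  ∑ i ∈ Finset.range (r + 1), (-1 : ℤ) ^ i * (r.choose i) * f (s + i)

theorem dsum_succ (f : ℕ → ℤ) (r s : ℕ) :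
    dsum f (r + 1) s = dsum f r s - dsum f r (s + 1) := by
  unfold dsum
  rw [Finset.sum_range_succ' _ (r + 1)]
  have h1 : ∀ i ∈ Finset.range (r + 1),
      (-1 : ℤ) ^ (i + 1) * ((r + 1).choose (i + 1) : ℕ) * f (s + (i + 1)) =
      (-1 : ℤ) ^ (i + 1) * (r.choose (i + 1) : ℕ) * f (s + (i + 1)) -
      (-1 : ℤ) ^ i * (r.choose i : ℕ) * f (s + 1 + i) := by
    intro i _
    rw [Nat.choose_succ_succ]
    have : s + 1 + i = s + (i + 1) := by ring
    rw [this]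
    push_cast
    ring
  rw [Finset.sum_congr rfl h1, Finset.sum_sub_distrib]
  have h2 := Finset.sum_range_succ' (fun i => (-1 : ℤ) ^ i * (r.choose i : ℕ) * f (s + i)) (r + 1)
  rw [Finset.sum_range_succ] at h2
  simp only [Nat.choose_succ_self, Nat.cast_zero, mul_zero, zero_mul, add_zero] at h2
  simp only [Nat.choose_zero_right] at h2 ⊢
  rw [h2]
  simp only [add_zero]
  ring

/-- All relevant equations hold. -/
def Hyp (m g : ℕ) (α : ℕ → Bool) : Prop :=
  ∀ r ∈ Finset.Icc (m - g) m, ∑ i ∈ Finset.range (r + 1),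
    (-1 : ℤ) ^ i * (r.choose i) * (if α i then 1 else 0) = 0

/-- Only constant solutions. -/
def Good (m g : ℕ) : Prop := ∀ α : ℕ → Bool, Hyp m g α → ∀ i ≤ m, α i = α 0

theorem dsum_zero_of_hyp {m g : ℕ} {α : ℕ → Bool} (h : Hyp m g α) (s : ℕ) :
    ∀ r, m - g ≤ r → r + s ≤ m → dsum (bv α) r s = 0 := by
  induction s with
  | zero =>
    intro r h1 h2
    have := h r (Finset.mem_Icc.2 ⟨h1, by omega⟩)
    simpa [dsum, bv] using this
  | succ s ih =>
    intro r h1 h2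
    have e := dsum_succ (bv α) r s
    rw [ih r h1 (by omega), ih (r + 1) (by omega) (by omega)] at e
    omega

theorem hyp_xor {m g : ℕ} (hm : 0 < m - g) {α : ℕ → Bool} (h : Hyp m g α) :
    Hyp m g (fun i => xor (α i) (α 0)) := by
  cases h0 : α 0 with
  | false => simpa [h0] using h
  | true =>
    intro r hr
    have h1 := h r hr
    have hr0 : r ≠ 0 := by
      have := (Finset.mem_Icc.1 hr).1
      omega
    have h2 := Int.alternating_sum_range_choose_of_ne hr0
    have h3 : ∀ i ∈ Finset.range (r + 1),
        (-1 : ℤ) ^ i * (r.choose i) * (if xor (α i) true then 1 else 0) =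
        (-1 : ℤ) ^ i * (r.choose i) - (-1 : ℤ) ^ i * (r.choose i) * (if α i then 1 else 0) := by
      intro i _
      cases α i <;> simp
    rw [Finset.sum_congr rfl h3, Finset.sum_sub_distrib, h1, h2, sub_zero]

/-! ### The prime case -/

theorem choose_pred_mod (p : ℕ) (hp : p.Prime) (i : ℕ) (hi : i < p) :
    (((-1 : ℤ) ^ i * ((p - 1).choose i) : ℤ) : ZMod p) = 1 := by
  induction i with
  | zero => simp
  | succ i ih =>
    have ih := ih (by omega)
    have h1 : (p - 1).choose i + (p - 1).choose (i + 1) = p.choose (i + 1) := by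
      have h := Nat.choose_succ_succ (p - 1) i
      rw [Nat.succ_eq_add_one, Nat.sub_add_cancel hp.one_le] at h
      exact h.symm
    have h2 : p ∣ p.choose (i + 1) := hp.dvd_choose_self (by omega) hi
    rw [← h1] at h2
    have h3 : (((p - 1).choose i + (p - 1).choose (i + 1) : ℕ) : ZMod p) = 0 :=
      (ZMod.natCast_eq_zero_iff _ _).2 h2
    push_cast at h3 ih ⊢
    rw [pow_succ]
    linear_combination ih - (-1) ^ i * h3

theorem good_of_prime {m g : ℕ} (p : ℕ) (hp : p.Prime) (h1 : m - g ≤ p - 1) (h2 : p - 1 ≤ m) :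
    Good m g := by
  intro α h
  have hw : ∀ s, p - 1 + s ≤ m → ∀ i < p, α (s + i) = α s := by
    intro s hs i hi
    have e := dsum_zero_of_hyp h s (p - 1) h1 hs
    unfold dsum at e
    rw [Nat.sub_add_cancel hp.one_le] at e
    have e2 : ((∑ i ∈ Finset.range p, bv α (s + i) : ℤ) : ZMod p) = 0 := by
      have e3 := congrArg (fun z : ℤ => (z : ZMod p)) e
      simp only [Int.cast_sum, Int.cast_zero] at e3 ⊢
      rw [← e3]
      apply Finset.sum_congr rfl
      intro i hi
      rw [Int.cast_mul, choose_pred_mod p hp i (Finset.mem_range.1 hi), one_mul]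
    have e4 : (∑ i ∈ Finset.range p, bv α (s + i) : ℤ) =
        (((Finset.range p).filter (fun i => α (s + i) = true)).card : ℕ) := by
      simp [bv, Finset.sum_boole]
    rw [e4, Int.cast_natCast, ZMod.natCast_eq_zero_iff] at e2
    have hle : ((Finset.range p).filter (fun i => α (s + i) = true)).card ≤ p := by
      simpa using Finset.card_filter_le (Finset.range p) (fun i => α (s + i) = true)
    rcases Nat.eq_zero_or_pos ((Finset.range p).filter (fun i => α (s + i) = true)).card with h0 | h0
    · rw [Finset.card_eq_zero, Finset.filter_eq_empty_iff] at h0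
      have a := h0 (Finset.mem_range.2 hi)
      have b := h0 (Finset.mem_range.2 hp.pos)
      simp at a b
      rw [a, b]
    · have hc := le_antisymm hle (Nat.le_of_dvd h0 e2)
      have hf : (Finset.range p).filter (fun i => α (s + i) = true) = Finset.range p := by
        apply Finset.eq_of_subset_of_card_le (Finset.filter_subset _ _)
        rw [hc, Finset.card_range]
      rw [Finset.filter_eq_self] at hf
      have a := hf i (Finset.mem_range.2 hi)
      have b := hf 0 (Finset.mem_range.2 hp.pos)
      rw [a, ← b, add_zero]
  intro x
  induction x using Nat.strong_induction_on with
  | _ x ih =>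
    intro hx
    have h2' := hp.two_le
    by_cases hxp : x < p
    · simpa using hw 0 (by omega) x hxp
    · have := hw (x - (p - 1)) (by omega) (p - 1) (by omega)
      rw [Nat.sub_add_cancel (by omega)] at this
      rw [this]
      exact ih _ (by omega) (by omega)

/-! ### A verified search procedure -/

/-- Evaluate a number before passing it on. -/
def force {β : Type} (n : ℕ) (k : ℕ → β) : β := Nat.rec (k 0) (fun j _ => k (Nat.succ j)) n

theorem force_eq {β : Type} (n : ℕ) (k : ℕ → β) : force n k = k n := by
  cases n <;> rfl

/-- Run over the support of one equation mod `p`, separating known and unknown positions. -/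
def split (p r known : ℕ) : ℕ → ℕ → ℕ → ℕ → ℕ → ℕ → ℕ → List (ℕ × ℕ) → List (ℕ × ℕ) →
    (ℕ → List (ℕ × ℕ) → List (ℕ × ℕ) → Bool) → Bool
  | 0, _, _, _, _, _, kn, K, U, k => k kn K U
  | n + 1, i, b, σ, τ, pos, kn, K, U, k =>
    force (Nat.div (Nat.mul b (Nat.sub r i)) (Nat.succ i)) fun b' =>
    force (Nat.succ i) fun i' =>
    force (Nat.succ pos) fun pos' =>
    force (Nat.mod (Nat.mul b σ) p) fun c =>
    cond (Nat.beq c 0) (split p r known n i' b' τ σ pos' kn K U k)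
      (cond (Nat.beq (Nat.mod (Nat.shiftRight known pos) 2) 1)
        (split p r known n i' b' τ σ pos' kn ((pos, c) :: K) U k)
        (force (Nat.lor kn (Nat.shiftLeft 1 pos)) fun kn' =>
          split p r known n i' b' τ σ pos' kn' K ((pos, c) :: U) k))

/-- Value of the known part. -/
def evalK (v : ℕ) : List (ℕ × ℕ) → ℕ → (ℕ → Bool) → Bool
  | [], acc, k => k acc
  | x :: K, acc, k =>
    force (Nat.add acc (Nat.mul x.2 (Nat.mod (Nat.shiftRight v x.1) 2))) fun a => evalK v K a k

/-- Enumerate the unknown part. -/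
def enumU (p : ℕ) : List (ℕ × ℕ) → ℕ → ℕ → (ℕ → Bool) → Bool
  | [], acc, v, k => cond (Nat.beq (Nat.mod acc p) 0) (force v k) true
  | x :: U, acc, v, k =>
    cond (enumU p U acc v k)
      (force (Nat.add acc x.2) fun a => enumU p U a (Nat.lor v (Nat.shiftLeft 1 x.1)) k) false

/-- Search. -/
def runP : List (ℕ × List (ℕ × ℕ) × List (ℕ × ℕ)) → ℕ → Bool
  | [], v => Nat.beq v 0
  | x :: P, v => evalK v x.2.1 0 fun acc => enumU x.1 x.2.2 acc v (runP P)

/-- Prepare the search. -/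
def comp (m g : ℕ) : List (ℕ × ℕ × ℕ) → ℕ →
    (List (ℕ × List (ℕ × ℕ) × List (ℕ × ℕ)) → Bool) → Bool
  | [], known, k => cond (Nat.beq known (Nat.sub (Nat.pow 2 (Nat.succ m)) 1)) (k []) false
  | x :: cs, known, k =>
    cond (Nat.ble (Nat.sub m g) x.2.1)
      (cond (Nat.ble (Nat.add x.2.1 x.2.2) m)
        (cond (Nat.ble 1 x.1)
          (split x.1 x.2.1 known (Nat.succ x.2.1) 0 1 1 (Nat.sub x.1 1) x.2.2 known [] []
            fun kn K U => comp m g cs kn fun P => k ((x.1, K, U) :: P)) false) false) false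

/-- The whole check. -/
def check (m g : ℕ) (cs : List (ℕ × ℕ × ℕ)) : Bool := comp m g cs 1 fun P => runP P 0

/-- natural number value -/
def nv (α : ℕ → Bool) (i : ℕ) : ℕ := (α i).toNat

/-- Sum of a list of terms. -/
def lsum (α : ℕ → Bool) : List (ℕ × ℕ) → ℕ
  | [] => 0
  | x :: L => x.2 * nv α x.1 + lsum α L

theorem shift_mod_two (v x : ℕ) : Nat.mod (Nat.shiftRight v x) 2 = (v.testBit x).toNat := by
  rw [Nat.toNat_testBit]
  show (v >>> x) % 2 = _
  rw [Nat.shiftRight_eq_div_pow]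

/-- `v` stores the values of `α` on the set coded by `known`. -/
def Agrees (α : ℕ → Bool) (v known : ℕ) : Prop :=
  ∀ x, v.testBit x = (known.testBit x && α x)

theorem testBit_lor_bit (v y x : ℕ) :
    (Nat.lor v (Nat.shiftLeft 1 y)).testBit x = (v.testBit x || decide (y = x)) := by
  show (v ||| (1 <<< y)).testBit x = _
  rw [Nat.testBit_lor, Nat.one_shiftLeft, Nat.testBit_two_pow]

theorem split_spec (α : ℕ → Bool) (p r known s : ℕ) (hp : 1 ≤ p)
    (k : ℕ → List (ℕ × ℕ) → List (ℕ × ℕ) → Bool) (n : ℕ) :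
    ∀ (i b σ τ pos kn : ℕ) (K U : List (ℕ × ℕ)),
    b = r.choose i → ((σ : ℤ) : ZMod p) = (-1) ^ i → ((τ : ℤ) : ZMod p) = (-1) ^ (i + 1) →
    pos = s + i →
    (∀ x ∈ K, known.testBit x.1 = true) →
    (∀ x, kn.testBit x = (known.testBit x || decide (x ∈ U.map Prod.fst))) →
    split p r known n i b σ τ pos kn K U k = true →
    ∃ kn' K' U', k kn' K' U' = true ∧ (∀ x ∈ K', known.testBit x.1 = true) ∧
      (∀ x, kn'.testBit x = (known.testBit x || decide (x ∈ U'.map Prod.fst))) ∧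
      ((lsum α K' + lsum α U' : ℕ) : ZMod p) = ((lsum α K + lsum α U : ℕ) : ZMod p) +
        ∑ j ∈ Finset.range n, (-1 : ZMod p) ^ (i + j) * (r.choose (i + j)) * (nv α (s + (i + j)) : ℕ) := by
  induction n with
  | zero =>
    intro i b σ τ pos kn K U _ _ _ _ hK hU h
    exact ⟨kn, K, U, h, hK, hU, by simp⟩
  | succ n ih =>
    intro i b σ τ pos kn K U hb hσ hτ hpos hK hU h
    rw [split] at h
    simp only [force_eq] at h
    have hb' : Nat.div (Nat.mul b (Nat.sub r i)) (Nat.succ i) = r.choose (i + 1) := by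
      show (b * (r - i)) / (i + 1) = _
      rw [hb, ← Nat.choose_succ_right_eq]
      exact Nat.mul_div_cancel _ (Nat.succ_pos i)
    have hσ' : ((σ : ℤ) : ZMod p) = (-1) ^ (i + 1 + 1) := by
      rw [hσ, pow_succ, pow_succ]; ring
    have hc : ((Nat.mod (Nat.mul b σ) p : ℕ) : ZMod p) = (-1) ^ i * (r.choose i : ℕ) := by
      show (((b * σ) % p : ℕ) : ZMod p) = _
      rw [ZMod.natCast_mod, Nat.cast_mul, hb]
      rw [Int.cast_natCast] at hσ
      rw [hσ, mul_comm]
    have hpos' : Nat.succ pos = s + (i + 1) := by rw [hpos]; rfl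
    have hsum : ∀ z : ZMod p, z + ∑ j ∈ Finset.range (n + 1),
          (-1 : ZMod p) ^ (i + j) * (r.choose (i + j)) * (nv α (s + (i + j)) : ℕ) =
        (z + (Nat.mod (Nat.mul b σ) p : ℕ) * (nv α pos : ℕ)) + ∑ j ∈ Finset.range n,
          (-1 : ZMod p) ^ (i + 1 + j) * (r.choose (i + 1 + j)) * (nv α (s + (i + 1 + j)) : ℕ) := by
      intro z
      rw [Finset.sum_range_succ', hc, hpos]
      simp only [add_zero]
      rw [add_comm (Finset.sum _ _), ← add_assoc]
      congr 1
      apply Finset.sum_congr rfl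
      intro j _
      rw [show i + (j + 1) = i + 1 + j by ring]
    generalize hcc : Nat.mod (Nat.mul b σ) p = c at h hc hsum
    cases h0 : Nat.beq c 0 with
    | true =>
      rw [h0, cond_true] at h
      obtain ⟨kn', K', U', h1, h2, h3, h4⟩ := ih _ _ _ _ _ _ _ _ hb' hτ hσ' hpos' hK hU h
      refine ⟨kn', K', U', h1, h2, h3, ?_⟩
      rw [hsum, h4, Nat.eq_of_beq_eq_true h0]
      simp
    | false =>
      rw [h0, cond_false, shift_mod_two] at h
      cases ht : known.testBit pos with
      | true =>
        rw [ht] at h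
        change split _ _ _ _ _ _ _ _ _ _ _ _ _ = true at h
        obtain ⟨kn', K', U', h1, h2, h3, h4⟩ := ih _ _ _ _ _ _ ((pos, c) :: K) _ hb' hτ hσ' hpos'
          (by
            intro x hx
            rcases List.mem_cons.1 hx with rfl | hx
            · exact ht
            · exact hK x hx) hU h
        refine ⟨kn', K', U', h1, h2, h3, ?_⟩
        rw [hsum, h4, lsum]
        push_cast
        ring
      | false =>
        rw [ht] at h
        change split _ _ _ _ _ _ _ _ _ _ _ _ _ = true at h
        obtain ⟨kn', K', U', h1, h2, h3, h4⟩ := ih _ _ _ _ _ _ K ((pos, c) :: U) hb' hτ hσ' hpos'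
          hK (by
            intro x
            rw [testBit_lor_bit, hU, Bool.or_assoc]
            congr 1
            simp only [List.map_cons, List.mem_cons, eq_comm (a := pos)]
            by_cases h5 : x = pos <;> simp [h5]) h
        refine ⟨kn', K', U', h1, h2, h3, ?_⟩
        rw [hsum, h4, lsum]
        push_cast
        ring

theorem evalK_spec (α : ℕ → Bool) (v known : ℕ) (hv : Agrees α v known) (k : ℕ → Bool)
    (K : List (ℕ × ℕ)) : ∀ acc, (∀ x ∈ K, known.testBit x.1 = true) →
    evalK v K acc k = k (acc + lsum α K) := by
  induction K with
  | nil => intro acc _; rfl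
  | cons x K ih =>
    intro acc hK
    rw [evalK, force_eq, shift_mod_two, ih _ (fun y hy => hK y (List.mem_cons_of_mem _ hy)),
      hv x.1, hK x List.mem_cons_self, lsum, Bool.true_and]
    show k (acc + x.2 * (α x.1).toNat + lsum α K) = _
    rw [nv, add_assoc]

theorem enumU_spec (α : ℕ → Bool) (p known : ℕ) (k : ℕ → Bool) (U : List (ℕ × ℕ)) :
    ∀ (acc v kn : ℕ), Agrees α v kn → p ∣ acc + lsum α U → enumU p U acc v k = true →
    ∃ v', k v' = true ∧ ∀ x, v'.testBit x =
      ((kn.testBit x || decide (x ∈ U.map Prod.fst)) && α x) := by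
  induction U with
  | nil =>
    intro acc v kn hv hd h
    have h1 : Nat.mod acc p = 0 := Nat.mod_eq_zero_of_dvd (by simpa [lsum] using hd)
    rw [enumU, h1, force_eq] at h
    exact ⟨v, h, fun x => by simpa using hv x⟩
  | cons x U ih =>
    intro acc v kn hv hd h
    rw [enumU, force_eq] at h
    cases h1 : enumU p U acc v k with
    | false => rw [h1] at h; exact absurd h (by simp)
    | true =>
      rw [h1, cond_true] at h
      have hv' : ∀ w, (∀ y, w.testBit y = (v.testBit y || (decide (x.1 = y) && α y))) →
          Agrees α w (Nat.lor kn (Nat.shiftLeft 1 x.1)) := by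
        intro w hw y
        rw [hw, testBit_lor_bit, hv y]
        cases kn.testBit y <;> cases α y <;> simp
      have fin : ∀ y, ((Nat.lor kn (Nat.shiftLeft 1 x.1)).testBit y ||
          decide (y ∈ U.map Prod.fst)) =
          (kn.testBit y || decide (y ∈ (x :: U).map Prod.fst)) := by
        intro y
        rw [testBit_lor_bit, Bool.or_assoc]
        congr 1
        simp only [List.map_cons, List.mem_cons]
        by_cases h5 : y = x.1
        · simp [h5]
        · simp [h5, Ne.symm h5]
      cases hx : α x.1 with
      | false =>
        obtain ⟨v', a, b⟩ := ih acc v _ (hv' v (by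
          intro y
          by_cases h5 : x.1 = y
          · subst h5; simp [hx]
          · simp [h5])) (by simpa [lsum, nv, hx] using hd) h1
        exact ⟨v', a, fun y => by rw [b, fin]⟩
      | true =>
        obtain ⟨v', a, b⟩ := ih (acc + x.2) _ _ (hv' (Nat.lor v (Nat.shiftLeft 1 x.1)) (by
          intro y
          rw [testBit_lor_bit]
          by_cases h5 : x.1 = y
          · subst h5; simp [hx]
          · simp [h5])) (by simpa [lsum, nv, hx, add_assoc] using hd) h
        exact ⟨v', a, fun y => by rw [b, fin]⟩

theorem dsum_cast (α : ℕ → Bool) (p r s : ℕ) : ((dsum (bv α) r s : ℤ) : ZMod p) =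
    ∑ j ∈ Finset.range (r + 1), (-1 : ZMod p) ^ (0 + j) * (r.choose (0 + j)) *
      (nv α (s + (0 + j)) : ℕ) := by
  unfold dsum
  rw [Int.cast_sum]
  apply Finset.sum_congr rfl
  intro j _
  simp only [zero_add, bv, nv]
  cases α (s + j) <;> simp

theorem comp_spec (α : ℕ → Bool) (m g : ℕ) (h : Hyp m g α) (cs : List (ℕ × ℕ × ℕ)) :
    ∀ (known : ℕ) (k : List (ℕ × List (ℕ × ℕ) × List (ℕ × ℕ)) → Bool),
    comp m g cs known k = true →
    ∃ P, k P = true ∧ ∀ v, Agrees α v known → runP P v = true → ∀ x ≤ m, α x = false := by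
  induction cs with
  | nil =>
    intro known k hc
    rw [comp] at hc
    cases h0 : Nat.beq known (Nat.sub (Nat.pow 2 (Nat.succ m)) 1) with
    | false => rw [h0] at hc; exact absurd hc (by simp)
    | true =>
      rw [h0, cond_true] at hc
      refine ⟨[], hc, ?_⟩
      intro v hv hr x hx
      have hk : known = 2 ^ (m + 1) - 1 := Nat.eq_of_beq_eq_true h0
      have hv0 : v = 0 := Nat.eq_of_beq_eq_true hr
      have := hv x
      rw [hv0, hk, Nat.testBit_two_pow_sub_one] at this
      have hx' : x < m + 1 := by omega
      simpa [hx'] using this.symm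
  | cons c cs ih =>
    intro known k hc
    rw [comp] at hc
    cases h1 : Nat.ble (Nat.sub m g) c.2.1 with
    | false => rw [h1] at hc; exact absurd hc (by simp)
    | true =>
    cases h2 : Nat.ble (Nat.add c.2.1 c.2.2) m with
    | false => rw [h1, h2] at hc; exact absurd hc (by simp)
    | true =>
    cases h3 : Nat.ble 1 c.1 with
    | false => rw [h1, h2, h3] at hc; exact absurd hc (by simp)
    | true =>
    rw [h1, h2, h3, cond_true, cond_true, cond_true] at hc
    have h1' : m - g ≤ c.2.1 := Nat.le_of_ble_eq_true h1
    have h2' : c.2.1 + c.2.2 ≤ m := Nat.le_of_ble_eq_true h2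
    have h3' : 1 ≤ c.1 := Nat.le_of_ble_eq_true h3
    obtain ⟨kn, K, U, a1, a2, a3, a4⟩ := split_spec α c.1 c.2.1 known c.2.2 h3' _ _ _ _ _ _ _ _ [] []
      (by simp) (by simp) (by
        show (((c.1 - 1 : ℕ) : ℤ) : ZMod c.1) = _
        rw [Int.cast_natCast, Nat.cast_sub h3']
        simp) (by simp) (by simp) (by simp) hc
    obtain ⟨P, b1, b2⟩ := ih kn _ a1
    refine ⟨_, b1, ?_⟩
    intro v hv hr
    rw [runP] at hr
    simp only at hr
    rw [evalK_spec α v known hv _ K 0 a2] at hr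
    have hd : c.1 ∣ 0 + lsum α K + lsum α U := by
      rw [← ZMod.natCast_eq_zero_iff, zero_add, a4]
      have := dsum_cast α c.1 c.2.1 c.2.2
      rw [dsum_zero_of_hyp h c.2.2 c.2.1 h1' h2'] at this
      rw [Nat.succ_eq_add_one, ← this]
      simp [lsum]
    obtain ⟨v', d1, d2⟩ := enumU_spec α c.1 known _ U _ v known hv hd hr
    exact b2 v' (fun x => by rw [d2, a3]) d1

theorem good_of_check {m g : ℕ} (hm : 0 < m - g) (cs : List (ℕ × ℕ × ℕ))
    (h : check m g cs = true) : Good m g := by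
  intro α hα i hi
  obtain ⟨P, h1, h2⟩ := comp_spec _ m g (hyp_xor hm hα) cs 1 _ h
  have h3 := h2 0 (by
    intro x
    cases x with
    | zero => simp
    | succ x => simp [Nat.testBit_succ]) h1 i hi
  simpa using h3

theorem good_8 : Good 8 1 := good_of_check (by norm_num)
    [(7, 7, 0), (2, 8, 0), (7, 7, 1), (5, 7, 0), (5, 7, 1), (3, 7, 0)]
    (by decide +kernel)

theorem good_9 : Good 9 1 := good_of_check (by norm_num)
    [(3, 9, 0), (2, 8, 0), (7, 8, 0), (7, 8, 1), (5, 8, 0), (5, 8, 1)]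
    (by decide +kernel)

theorem good_26 : Good 26 3 := good_of_check (by norm_num)
    [(23, 23, 0), (5, 25, 0), (23, 23, 2), (23, 23, 1), (5, 25, 1), (23, 23, 3), (13, 26, 0),
     (11, 23, 1), (11, 23, 2), (11, 23, 0), (11, 23, 3), (19, 23, 0), (19, 23, 1), (19, 23, 2),
     (19, 23, 3), (17, 23, 1), (17, 23, 0), (17, 23, 2), (17, 23, 3), (7, 23, 0), (13, 23, 0)]
    (by decide +kernel)

theorem good_27 : Good 27 3 := good_of_check (by norm_num)
    [(5, 25, 0), (3, 27, 0), (5, 25, 2), (23, 24, 1), (23, 24, 0), (13, 26, 1), (5, 25, 1),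
     (23, 24, 2), (23, 24, 3), (13, 26, 0), (11, 24, 1), (11, 24, 2), (11, 24, 0), (2, 24, 3),
     (11, 24, 3), (2, 24, 0), (19, 24, 0), (19, 24, 1), (19, 24, 2), (17, 24, 1), (17, 24, 0),
     (17, 24, 2), (17, 24, 3)]
    (by decide +kernel)

theorem good_34 : Good 34 3 := good_of_check (by norm_num)
    [(31, 31, 0), (2, 32, 0), (31, 31, 1), (2, 32, 1), (31, 31, 2), (2, 32, 2), (31, 31, 3),
     (29, 31, 1), (29, 31, 0), (29, 31, 2), (29, 31, 3), (17, 34, 0), (3, 31, 1), (3, 31, 0),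
     (3, 31, 2), (3, 31, 3), (5, 31, 1), (5, 31, 0), (5, 31, 2), (5, 31, 3), (23, 31, 1),
     (23, 31, 0), (23, 31, 2), (23, 31, 3), (11, 33, 0), (11, 33, 1), (19, 31, 0), (19, 31, 1),
     (19, 31, 2), (19, 31, 3), (17, 31, 0), (17, 31, 2)]
    (by decide +kernel)

theorem good_35 : Good 35 3 := good_of_check (by norm_num)
    [(2, 32, 0), (31, 32, 0), (2, 32, 1), (31, 32, 1), (2, 32, 2), (31, 32, 2), (17, 34, 0),
     (2, 32, 3), (31, 32, 3), (29, 32, 1), (29, 32, 0), (29, 32, 2), (29, 32, 3), (17, 34, 1),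
     (3, 32, 1), (3, 32, 0), (3, 32, 2), (3, 32, 3), (5, 32, 1), (5, 32, 0), (5, 32, 2),
     (5, 32, 3), (23, 32, 1), (23, 32, 0), (23, 32, 2), (23, 32, 3), (11, 33, 0), (11, 33, 2),
     (7, 35, 0), (19, 32, 1), (19, 32, 0), (19, 32, 2), (19, 32, 3)]
    (by decide +kernel)

theorem good_50 : Good 50 3 := good_of_check (by norm_num)
    [(47, 47, 0), (47, 47, 1), (47, 47, 2), (7, 49, 0), (47, 47, 3), (7, 49, 1), (23, 47, 1),
     (5, 50, 0), (23, 47, 2), (23, 47, 0), (23, 47, 3), (43, 47, 0), (43, 47, 1), (43, 47, 2),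
     (43, 47, 3), (41, 47, 1), (41, 47, 0), (41, 47, 2), (41, 47, 3), (37, 47, 0), (37, 47, 1),
     (37, 47, 2), (37, 47, 3), (2, 48, 0), (2, 48, 1), (31, 47, 1), (11, 47, 2), (31, 47, 0),
     (31, 47, 2), (31, 47, 3), (29, 47, 1), (29, 47, 0), (29, 47, 2), (29, 47, 3), (13, 47, 0),
     (19, 47, 0)]
    (by decide +kernel)

theorem good_51 : Good 51 3 := good_of_check (by norm_num)
    [(47, 48, 0), (47, 48, 1), (7, 49, 0), (47, 48, 2), (7, 49, 1), (47, 48, 3), (7, 49, 2),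
     (17, 51, 0), (5, 50, 0), (23, 48, 1), (23, 48, 2), (23, 48, 0), (23, 48, 3), (43, 48, 0),
     (43, 48, 1), (43, 48, 2), (43, 48, 3), (41, 48, 1), (41, 48, 0), (41, 48, 2), (41, 48, 3),
     (2, 48, 1), (2, 48, 2), (37, 48, 0), (37, 48, 1), (37, 48, 2), (37, 48, 3), (31, 48, 1),
     (31, 48, 0), (31, 48, 2), (31, 48, 3), (29, 48, 1), (29, 48, 0), (29, 48, 2), (29, 48, 3)]
    (by decide +kernel)

theorem good_56 : Good 56 3 := good_of_check (by norm_num)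
    [(53, 53, 0), (3, 54, 0), (53, 53, 1), (3, 54, 1), (53, 53, 2), (3, 54, 2), (53, 53, 3),
     (7, 56, 0), (5, 53, 1), (7, 53, 0), (5, 53, 0), (7, 53, 1), (5, 53, 2), (7, 53, 2),
     (5, 53, 3), (47, 53, 1), (47, 53, 0), (47, 53, 2), (23, 53, 1), (47, 53, 3), (23, 53, 2),
     (2, 56, 0), (23, 53, 0), (23, 53, 3), (11, 55, 0), (43, 53, 1), (43, 53, 0), (43, 53, 2),
     (11, 55, 1), (43, 53, 3), (41, 53, 1), (13, 53, 3), (41, 53, 0), (13, 53, 2), (13, 53, 1),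
     (41, 53, 3), (13, 53, 0), (37, 53, 1), (37, 53, 0), (37, 53, 2), (2, 53, 1), (17, 53, 3),
     (2, 53, 0), (11, 53, 3), (2, 53, 2)]
    (by decide +kernel)

theorem good_57 : Good 57 3 := good_of_check (by norm_num)
    [(3, 54, 0), (53, 54, 0), (53, 54, 1), (3, 54, 1), (53, 54, 2), (3, 54, 2), (53, 54, 3),
     (3, 54, 3), (19, 57, 0), (7, 56, 0), (7, 56, 1), (5, 55, 0), (7, 54, 0), (7, 54, 1),
     (47, 54, 1), (47, 54, 0), (47, 54, 2), (47, 54, 3), (5, 54, 0), (5, 54, 2), (5, 54, 3),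
     (23, 54, 1), (23, 54, 2), (23, 54, 0), (23, 54, 3), (11, 55, 0), (43, 54, 0), (43, 54, 1),
     (43, 54, 2), (43, 54, 3), (41, 54, 1), (41, 54, 0), (41, 54, 2), (41, 54, 3), (13, 54, 1),
     (13, 54, 0), (13, 54, 2), (37, 54, 0), (37, 54, 1), (37, 54, 3), (17, 54, 3), (19, 54, 0),
     (31, 54, 0)]
    (by decide +kernel)

theorem good_64 : Good 64 3 := good_of_check (by norm_num)
    [(61, 61, 0), (61, 61, 1), (31, 62, 0), (61, 61, 2), (31, 62, 1), (61, 61, 3), (2, 64, 0),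
     (59, 61, 1), (59, 61, 0), (59, 61, 2), (59, 61, 3), (31, 62, 2), (29, 61, 1), (29, 61, 2),
     (29, 61, 0), (29, 61, 3), (7, 63, 0), (3, 61, 1), (53, 61, 0), (53, 61, 1), (53, 61, 2),
     (53, 61, 3), (3, 61, 0), (3, 61, 2), (3, 61, 3), (7, 63, 1), (7, 61, 0), (47, 61, 1),
     (47, 61, 0), (47, 61, 2), (47, 61, 3), (5, 61, 1), (5, 61, 0), (5, 61, 2), (5, 61, 3),
     (23, 61, 1), (23, 61, 2), (23, 61, 0), (23, 61, 3), (11, 61, 1), (11, 61, 2), (43, 61, 1),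
     (43, 61, 0), (43, 61, 2), (43, 61, 3), (41, 61, 0), (41, 61, 2)]
    (by decide +kernel)

theorem good_65 : Good 65 3 := good_of_check (by norm_num)
    [(31, 62, 0), (61, 62, 0), (61, 62, 1), (31, 62, 1), (61, 62, 2), (2, 64, 0), (31, 62, 2),
     (61, 62, 3), (2, 64, 1), (59, 62, 1), (59, 62, 0), (59, 62, 2), (59, 62, 3), (31, 62, 3),
     (29, 62, 1), (29, 62, 2), (29, 62, 0), (29, 62, 3), (7, 63, 0), (3, 63, 2), (53, 62, 2),
     (53, 62, 1), (53, 62, 0), (53, 62, 3), (3, 62, 1), (3, 62, 0), (3, 62, 2), (7, 63, 1),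
     (7, 63, 2), (47, 62, 1), (47, 62, 0), (47, 62, 2), (47, 62, 3), (13, 65, 0), (5, 62, 1),
     (5, 62, 0), (23, 62, 1), (23, 62, 2), (23, 62, 0), (23, 62, 3), (11, 62, 1), (43, 62, 0),
     (43, 62, 1), (43, 62, 2), (43, 62, 3)]
    (by decide +kernel)

theorem good_76 : Good 76 3 := good_of_check (by norm_num)
    [(73, 73, 2), (37, 74, 2), (73, 73, 3), (73, 73, 0), (73, 74, 0), (71, 73, 2), (71, 73, 3),
     (71, 73, 1), (71, 76, 0), (37, 74, 1), (37, 76, 0), (19, 76, 0), (67, 73, 0), (67, 74, 0),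
     (67, 74, 1), (67, 76, 0), (2, 73, 0), (2, 76, 0), (2, 73, 3), (61, 73, 0), (2, 73, 1),
     (61, 73, 1), (61, 76, 0), (59, 73, 1), (59, 73, 0), (59, 73, 3), (5, 75, 1), (5, 76, 0),
     (53, 73, 2), (53, 73, 1), (53, 73, 3), (53, 73, 0), (7, 73, 2), (7, 73, 1), (47, 73, 2),
     (7, 73, 0), (47, 73, 3), (47, 73, 1), (47, 76, 0), (23, 73, 0), (23, 75, 1), (43, 74, 1),
     (43, 74, 0), (43, 73, 3), (41, 73, 1), (41, 74, 1), (41, 75, 1), (41, 76, 0), (19, 73, 0),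
     (31, 74, 2)]
    (by decide +kernel)

theorem good_77 : Good 77 3 := good_of_check (by norm_num)
    [(73, 74, 0), (73, 74, 1), (37, 74, 0), (37, 75, 0), (73, 76, 0), (37, 75, 1), (73, 77, 0),
     (71, 74, 2), (37, 77, 0), (71, 74, 1), (71, 74, 3), (71, 76, 0), (19, 76, 0), (19, 77, 0),
     (67, 74, 2), (67, 74, 1), (67, 74, 0), (67, 74, 3), (2, 74, 0), (2, 76, 1), (2, 74, 2),
     (61, 74, 0), (61, 74, 1), (61, 75, 1), (61, 77, 0), (59, 74, 2), (59, 75, 1), (59, 76, 0),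
     (59, 77, 0), (5, 75, 1), (53, 74, 3), (53, 74, 1), (53, 74, 2), (53, 75, 0), (5, 75, 0),
     (7, 74, 1), (7, 75, 0), (7, 77, 0), (47, 74, 1), (47, 75, 1), (47, 74, 0), (23, 74, 2),
     (23, 75, 2), (23, 75, 0), (43, 74, 3), (43, 75, 2), (43, 74, 1), (43, 76, 0), (41, 74, 1),
     (41, 75, 0), (41, 76, 0), (29, 75, 2)]
    (by decide +kernel)

theorem good_86 : Good 86 3 := good_of_check (by norm_num)
    [(83, 83, 0), (83, 83, 1), (83, 83, 2), (83, 84, 2), (43, 86, 0), (41, 83, 1), (41, 84, 0),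
     (3, 83, 1), (41, 84, 1), (41, 83, 3), (79, 83, 1), (3, 83, 3), (79, 84, 0), (79, 85, 0),
     (79, 85, 1), (17, 85, 0), (17, 86, 0), (73, 83, 0), (73, 83, 1), (73, 85, 0), (73, 86, 0),
     (71, 84, 0), (71, 85, 0), (71, 84, 2), (67, 83, 1), (67, 83, 2), (67, 85, 1), (67, 86, 0),
     (37, 83, 1), (37, 84, 1), (37, 85, 0), (37, 84, 2), (2, 84, 1), (7, 84, 0), (61, 83, 2),
     (2, 83, 0), (61, 84, 2), (61, 84, 0), (59, 84, 2), (59, 83, 1), (59, 83, 0), (19, 83, 0),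
     (19, 86, 0), (11, 83, 1), (11, 84, 1), (53, 83, 2), (5, 85, 0), (53, 83, 1), (53, 83, 0),
     (53, 86, 0)]
    (by decide +kernel)

theorem good_87 : Good 87 3 := good_of_check (by norm_num)
    [(43, 86, 0), (83, 84, 3), (83, 85, 2), (83, 85, 0), (83, 84, 0), (43, 87, 0), (41, 84, 2),
     (41, 85, 1), (41, 85, 2), (41, 86, 0), (79, 84, 1), (79, 84, 2), (79, 86, 0), (79, 87, 0),
     (29, 87, 0), (17, 85, 2), (17, 85, 1), (17, 87, 0), (73, 84, 0), (73, 84, 1), (73, 84, 2),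
     (73, 86, 1), (71, 84, 1), (71, 85, 1), (71, 85, 2), (67, 85, 1), (67, 84, 1), (67, 85, 2),
     (67, 84, 0), (37, 84, 1), (37, 84, 2), (37, 85, 0), (37, 86, 1), (2, 84, 3), (7, 84, 2),
     (7, 85, 1), (2, 84, 0), (2, 84, 1), (61, 84, 2), (2, 84, 2), (61, 85, 2), (61, 85, 1),
     (61, 84, 0), (59, 84, 1), (59, 85, 0), (59, 86, 1), (31, 84, 2), (31, 85, 1), (31, 86, 1),
     (53, 84, 0)]
    (by decide +kernel)

theorem good_92 : Good 92 3 := good_of_check (by norm_num)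
    [(89, 89, 1), (89, 89, 3), (89, 90, 0), (89, 90, 1), (23, 92, 0), (43, 89, 0), (43, 89, 1),
     (43, 90, 2), (83, 89, 3), (83, 90, 2), (83, 89, 1), (83, 92, 0), (41, 89, 2), (41, 90, 1),
     (41, 91, 0), (41, 89, 3), (79, 89, 1), (3, 89, 3), (79, 89, 2), (79, 91, 0), (79, 89, 3),
     (13, 91, 0), (73, 89, 2), (73, 89, 1), (73, 91, 1), (73, 92, 0), (71, 89, 2), (71, 89, 1),
     (71, 89, 3), (71, 92, 0), (67, 89, 2), (67, 91, 1), (67, 89, 1), (67, 89, 0), (37, 89, 0),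
     (37, 89, 1), (37, 91, 0), (37, 92, 0), (13, 92, 0), (2, 89, 1), (2, 89, 2), (17, 89, 1),
     (17, 89, 2), (17, 90, 0), (17, 92, 0), (11, 90, 2), (11, 89, 0), (31, 89, 1), (2, 89, 3),
     (61, 89, 2), (61, 90, 1), (61, 89, 0), (61, 90, 2), (59, 92, 0)]
    (by decide +kernel)

theorem good_93 : Good 93 3 := good_of_check (by norm_num)
    [(89, 90, 0), (89, 90, 1), (89, 91, 1), (89, 93, 0), (31, 93, 0), (23, 92, 0), (23, 92, 1),
     (43, 90, 0), (43, 90, 2), (43, 90, 1), (43, 92, 1), (83, 90, 3), (83, 91, 2), (83, 91, 1),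
     (83, 90, 0), (41, 90, 1), (41, 90, 2), (41, 92, 0), (41, 92, 1), (79, 90, 1), (79, 91, 2),
     (79, 90, 0), (13, 91, 0), (73, 90, 0), (73, 90, 1), (73, 90, 2), (73, 92, 1), (71, 90, 0),
     (71, 92, 1), (67, 90, 3), (67, 91, 1), (67, 90, 0), (13, 91, 2), (37, 90, 2), (37, 91, 2),
     (37, 90, 1), (37, 92, 0), (13, 93, 0), (2, 90, 1), (61, 90, 1), (61, 90, 3), (61, 93, 0),
     (59, 90, 1), (59, 90, 0), (59, 90, 2), (59, 93, 0), (29, 91, 0), (19, 90, 2), (47, 90, 2)]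
    (by decide +kernel)

theorem good_94 : Good 94 3 := good_of_check (by norm_num)
    [(47, 94, 0), (31, 93, 0), (31, 93, 1), (23, 92, 1), (89, 91, 0), (89, 91, 1), (89, 91, 2),
     (89, 92, 2), (23, 93, 1), (23, 94, 0), (43, 91, 1), (43, 92, 0), (43, 92, 1), (43, 92, 2),
     (83, 91, 3), (83, 91, 2), (83, 92, 1), (41, 91, 2), (83, 91, 0), (41, 92, 1), (41, 91, 3),
     (41, 91, 0), (79, 91, 0), (79, 91, 1), (79, 91, 2), (79, 93, 1), (29, 91, 2), (29, 91, 3),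
     (29, 93, 1), (29, 91, 0), (13, 91, 3), (7, 91, 2), (7, 92, 1), (13, 91, 0), (11, 91, 2),
     (11, 92, 2), (13, 92, 0), (7, 92, 2), (13, 92, 2), (11, 92, 1), (11, 94, 0), (7, 92, 0),
     (19, 91, 1), (19, 91, 0), (73, 91, 3), (73, 92, 2), (73, 92, 0)]
    (by decide +kernel)

theorem good_95 : Good 95 3 := good_of_check (by norm_num)
    [(47, 94, 0), (47, 95, 0), (31, 93, 0), (31, 94, 0), (23, 92, 1), (31, 95, 0), (23, 93, 1),
     (23, 92, 3), (89, 93, 0), (89, 92, 0), (89, 92, 2), (89, 92, 3), (23, 93, 0), (43, 92, 3),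
     (43, 92, 2), (43, 92, 1), (43, 92, 0), (83, 92, 0), (83, 92, 1), (83, 92, 2), (83, 93, 2),
     (41, 92, 2), (41, 92, 1), (41, 92, 0), (41, 92, 3), (79, 92, 3), (3, 92, 3), (79, 92, 2),
     (79, 92, 1), (79, 92, 0), (19, 95, 0), (73, 92, 3), (73, 92, 2), (73, 93, 1), (71, 93, 2),
     (67, 92, 1), (67, 93, 0), (67, 93, 1), (2, 92, 3), (67, 92, 3), (2, 92, 0), (13, 92, 2),
     (13, 93, 2), (61, 93, 1), (61, 92, 1), (61, 94, 1), (61, 94, 0), (59, 92, 1), (59, 93, 1),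
     (59, 93, 2), (7, 92, 0), (59, 93, 0), (29, 92, 0), (29, 95, 0), (53, 92, 0), (53, 93, 2)]
    (by decide +kernel)

theorem good_116 : Good 116 3 := good_of_check (by norm_num)
    [(113, 113, 0), (113, 113, 2), (113, 114, 0), (113, 113, 3), (29, 116, 0), (109, 113, 0),
     (109, 113, 2), (109, 113, 3), (107, 113, 1), (107, 113, 0), (107, 113, 2), (107, 113, 3),
     (103, 113, 1), (103, 114, 0), (103, 115, 0), (103, 115, 1), (101, 113, 2), (101, 113, 3),
     (101, 115, 1), (101, 116, 0), (97, 113, 0), (97, 113, 1), (97, 114, 1), (97, 115, 1),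
     (19, 114, 0), (19, 114, 2), (37, 113, 1), (37, 113, 2), (37, 114, 2), (37, 116, 0),
     (19, 115, 1), (53, 113, 0), (53, 114, 0), (53, 115, 0), (53, 114, 2), (7, 113, 3),
     (7, 113, 2), (47, 113, 2), (7, 113, 0), (47, 114, 1), (47, 113, 3), (47, 116, 0),
     (23, 115, 0), (23, 115, 1), (89, 113, 3), (89, 113, 2), (89, 114, 1), (89, 113, 0),
     (43, 113, 2), (43, 113, 1), (43, 114, 2), (43, 113, 0), (83, 113, 1), (83, 113, 0),
     (83, 114, 1), (41, 113, 1), (83, 113, 3), (41, 113, 2), (41, 115, 1), (41, 116, 0),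
     (79, 113, 3), (79, 114, 2), (67, 114, 2)]
    (by decide +kernel)

theorem good_117 : Good 117 3 := good_of_check (by norm_num)
    [(113, 114, 2), (113, 115, 1), (113, 114, 0), (113, 114, 3), (29, 116, 1), (29, 117, 0),
     (109, 114, 1), (109, 115, 1), (109, 114, 0), (109, 117, 0), (107, 114, 2), (107, 114, 3),
     (107, 116, 1), (107, 117, 0), (103, 114, 1), (103, 114, 0), (103, 115, 1), (103, 116, 1),
     (101, 114, 1), (101, 115, 0), (101, 116, 1), (97, 114, 2), (97, 114, 1), (97, 116, 1),
     (97, 114, 0), (19, 114, 2), (19, 115, 2), (19, 115, 1), (37, 114, 3), (37, 115, 2),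
     (37, 116, 1), (19, 115, 0), (37, 115, 0), (53, 114, 0), (53, 115, 0), (53, 116, 0),
     (53, 115, 2), (7, 114, 0), (7, 114, 1), (7, 116, 0), (7, 115, 2), (47, 114, 2),
     (47, 114, 1), (47, 116, 0), (47, 116, 1), (23, 115, 0), (23, 116, 0), (23, 117, 0),
     (13, 117, 0), (89, 114, 1), (89, 114, 0), (89, 114, 2), (89, 116, 1), (43, 114, 1),
     (43, 114, 2), (43, 116, 0), (43, 115, 2), (83, 114, 3), (83, 114, 2), (83, 115, 1),
     (83, 114, 0), (41, 114, 0), (79, 114, 0), (67, 115, 1)]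
    (by decide +kernel)

theorem good_118 : Good 118 3 := good_of_check (by norm_num)
    [(59, 118, 0), (113, 115, 3), (113, 115, 2), (113, 115, 1), (113, 118, 0), (29, 116, 1),
     (29, 116, 0), (29, 116, 2), (109, 115, 2), (109, 115, 1), (109, 115, 0), (109, 117, 1),
     (107, 115, 1), (107, 116, 0), (107, 116, 1), (107, 116, 2), (103, 115, 0), (103, 116, 0),
     (103, 116, 1), (103, 115, 3), (101, 115, 2), (101, 115, 1), (101, 115, 0), (101, 116, 2),
     (97, 115, 0), (97, 115, 1), (97, 115, 2), (97, 118, 0), (23, 115, 0), (23, 115, 1),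
     (23, 115, 2), (89, 115, 3), (89, 116, 2), (89, 116, 0), (23, 116, 2), (83, 115, 3),
     (83, 115, 2), (83, 115, 1), (83, 116, 0), (79, 115, 2), (3, 115, 0), (3, 115, 1),
     (79, 116, 2), (79, 117, 1), (79, 118, 0), (19, 115, 1), (19, 116, 1), (37, 115, 3),
     (73, 115, 2), (73, 116, 2), (73, 116, 1), (71, 115, 3), (73, 116, 0), (71, 115, 0),
     (67, 115, 1), (67, 115, 2), (67, 117, 1), (67, 115, 0), (19, 116, 0), (19, 117, 1),
     (11, 115, 1), (11, 116, 1), (53, 115, 0), (53, 116, 0), (53, 117, 0), (53, 116, 2),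
     (59, 115, 1)]
    (by decide +kernel)

theorem good_119 : Good 119 3 := good_of_check (by norm_num)
    [(59, 118, 1), (59, 119, 0), (29, 116, 2), (29, 117, 1), (113, 116, 3), (113, 116, 2),
     (113, 118, 1), (113, 119, 0), (29, 117, 2), (109, 116, 0), (109, 118, 0), (109, 119, 0),
     (107, 117, 0), (107, 118, 0), (107, 119, 0), (29, 117, 0), (103, 116, 2), (103, 117, 1),
     (103, 116, 3), (103, 118, 0), (101, 116, 2), (101, 116, 3), (101, 117, 1), (101, 118, 0),
     (97, 116, 0), (97, 117, 0), (97, 117, 1), (97, 117, 2), (53, 116, 1), (53, 116, 0),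
     (53, 117, 1), (53, 117, 2), (7, 119, 0), (7, 116, 0), (7, 117, 0), (17, 119, 0),
     (7, 117, 1), (47, 116, 3), (47, 117, 2), (47, 117, 1), (47, 119, 0), (23, 116, 2),
     (23, 117, 1), (89, 116, 3), (89, 117, 1), (83, 116, 1), (83, 116, 2), (83, 118, 1),
     (83, 116, 0), (23, 117, 2), (23, 117, 0), (43, 116, 0), (43, 118, 0), (43, 118, 1),
     (41, 116, 2), (41, 117, 1), (41, 117, 0), (41, 116, 3), (79, 116, 2), (79, 117, 1),
     (79, 117, 2), (67, 117, 2)]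
    (by decide +kernel)

theorem good_120 : Good 120 3 := good_of_check (by norm_num)
    [(59, 118, 0), (59, 118, 2), (59, 118, 1), (113, 118, 2), (113, 117, 2), (113, 119, 1),
     (113, 117, 0), (109, 118, 1), (109, 117, 1), (109, 117, 0), (109, 117, 3), (107, 117, 2),
     (107, 118, 2), (107, 118, 1), (107, 118, 0), (103, 118, 2), (103, 118, 1), (103, 120, 0),
     (101, 118, 0), (101, 119, 0), (101, 118, 2), (97, 117, 3), (97, 117, 2), (97, 119, 1),
     (97, 118, 0), (29, 117, 2), (29, 118, 2), (29, 118, 1), (29, 119, 0), (53, 117, 3),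
     (53, 117, 2), (53, 118, 0), (7, 119, 1), (7, 120, 0), (7, 117, 0), (7, 117, 1),
     (47, 117, 2), (47, 117, 3), (47, 119, 1), (47, 119, 0), (23, 117, 1), (89, 117, 0),
     (89, 117, 1), (89, 117, 2), (89, 117, 3), (23, 117, 3), (23, 118, 0), (43, 117, 1),
     (43, 118, 1), (43, 119, 1), (43, 120, 0), (83, 117, 1), (17, 119, 1), (83, 118, 1),
     (83, 117, 0), (83, 119, 1), (41, 117, 2), (41, 118, 1), (41, 119, 1), (79, 117, 3),
     (41, 117, 0), (79, 118, 2), (73, 117, 0)]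
    (by decide +kernel)

theorem good_121 : Good 121 3 := good_of_check (by norm_num)
    [(59, 118, 0), (59, 118, 2), (59, 118, 1), (59, 118, 3), (11, 121, 0), (113, 118, 3),
     (113, 119, 2), (113, 120, 1), (113, 120, 0), (109, 118, 1), (109, 119, 1), (109, 120, 0),
     (109, 118, 3), (107, 118, 1), (107, 118, 2), (107, 119, 2), (107, 120, 0), (103, 118, 2),
     (103, 119, 1), (103, 119, 0), (103, 119, 2), (101, 118, 2), (101, 119, 1), (101, 118, 0),
     (101, 118, 3), (97, 118, 0), (97, 119, 0), (97, 119, 1), (97, 119, 2), (7, 119, 1),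
     (17, 119, 2), (7, 119, 0), (53, 118, 0), (53, 119, 0), (53, 118, 2), (53, 119, 2),
     (7, 119, 2), (7, 118, 2), (17, 120, 1), (47, 118, 2), (47, 118, 3), (47, 120, 1),
     (47, 119, 0), (23, 118, 1), (23, 118, 0), (23, 120, 0), (23, 118, 3), (89, 118, 1),
     (89, 118, 2), (89, 119, 0), (89, 120, 1), (29, 118, 0), (29, 118, 3), (83, 118, 2),
     (83, 119, 2), (83, 121, 0), (43, 118, 0), (43, 119, 0), (43, 119, 1), (43, 119, 2),
     (41, 118, 2), (41, 118, 3), (41, 120, 1), (79, 118, 3), (79, 120, 0)]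
    (by decide +kernel)

theorem good_122 : Good 122 3 := good_of_check (by norm_num)
    [(61, 122, 0), (11, 121, 0), (59, 119, 3), (59, 119, 2), (59, 120, 1), (11, 121, 1),
     (59, 119, 0), (113, 119, 2), (113, 120, 1), (113, 120, 2), (113, 119, 0), (109, 119, 1),
     (109, 120, 1), (109, 119, 3), (109, 122, 0), (107, 119, 2), (107, 119, 3), (107, 119, 1),
     (107, 121, 0), (103, 119, 3), (103, 120, 2), (103, 121, 1), (103, 121, 0), (101, 119, 2),
     (101, 120, 1), (101, 119, 0), (101, 120, 2), (97, 119, 2), (97, 120, 1), (97, 120, 2),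
     (97, 120, 0), (17, 119, 2), (7, 119, 0), (17, 119, 0), (7, 119, 2), (53, 120, 0),
     (53, 119, 2), (53, 120, 2), (7, 119, 3), (7, 121, 1), (47, 119, 2), (47, 120, 2),
     (47, 119, 1), (47, 120, 0), (23, 120, 1), (23, 119, 0), (89, 119, 3), (89, 119, 2),
     (89, 120, 1), (89, 122, 0), (29, 119, 2), (29, 120, 0), (29, 119, 3), (23, 122, 0),
     (43, 119, 2), (43, 119, 1), (83, 119, 0), (43, 119, 3), (83, 119, 1), (83, 119, 2),
     (83, 119, 3), (43, 121, 0), (41, 119, 2), (41, 120, 1), (79, 119, 3), (79, 119, 1)]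
    (by decide +kernel)

theorem good_123 : Good 123 3 := good_of_check (by norm_num)
    [(61, 122, 0), (61, 123, 0), (11, 121, 1), (11, 121, 2), (11, 123, 0), (59, 120, 1),
     (59, 121, 1), (59, 120, 3), (59, 123, 0), (41, 123, 0), (113, 120, 1), (113, 121, 1),
     (113, 122, 0), (113, 120, 3), (109, 120, 1), (109, 121, 0), (109, 122, 0), (107, 120, 1),
     (107, 121, 1), (107, 120, 3), (107, 120, 0), (103, 120, 3), (103, 120, 1), (103, 121, 0),
     (101, 120, 2), (101, 121, 1), (101, 121, 2), (101, 120, 0), (97, 120, 3), (97, 120, 1),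
     (97, 123, 0), (53, 120, 1), (53, 120, 0), (53, 120, 2), (53, 123, 0), (7, 120, 3),
     (7, 120, 2), (7, 121, 1), (7, 120, 0), (47, 120, 2), (47, 121, 2), (47, 121, 1),
     (47, 122, 0), (23, 121, 1), (23, 120, 1), (23, 120, 3), (89, 120, 1), (89, 120, 2),
     (89, 120, 0), (89, 120, 3), (23, 122, 0), (29, 120, 1), (29, 120, 2), (29, 122, 1),
     (29, 121, 0), (17, 121, 1), (17, 120, 1), (83, 120, 0), (83, 121, 0), (3, 120, 2),
     (83, 122, 0), (83, 121, 2), (43, 120, 3), (79, 120, 0), (43, 121, 2), (79, 120, 1),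
     (79, 122, 0), (73, 121, 2)]
    (by decide +kernel)

theorem good_124 : Good 124 3 := good_of_check (by norm_num)
    [(61, 122, 0), (11, 121, 1), (61, 122, 1), (11, 122, 0), (11, 122, 1), (61, 122, 2),
     (11, 122, 2), (41, 123, 1), (41, 123, 0), (31, 124, 0), (59, 121, 2), (59, 122, 1),
     (59, 121, 3), (59, 121, 0), (113, 121, 3), (113, 121, 2), (113, 121, 1), (113, 123, 0),
     (109, 121, 0), (109, 122, 0), (109, 121, 2), (109, 124, 0), (107, 121, 2), (107, 122, 1),
     (107, 121, 0), (107, 124, 0), (103, 121, 0), (103, 122, 0), (103, 122, 1), (103, 122, 2),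
     (101, 121, 2), (101, 121, 3), (101, 122, 1), (101, 124, 0), (97, 121, 3), (97, 122, 2),
     (97, 121, 1), (97, 124, 0), (53, 121, 3), (53, 121, 2), (53, 121, 1), (53, 121, 0),
     (7, 121, 0), (7, 121, 1), (7, 123, 0), (7, 121, 3), (47, 121, 1), (47, 121, 2),
     (47, 123, 1), (23, 121, 2), (47, 121, 0), (23, 122, 2), (23, 123, 0), (89, 121, 0),
     (89, 122, 0), (89, 122, 1), (89, 123, 1), (29, 121, 1), (29, 121, 0), (29, 121, 2),
     (29, 124, 0), (17, 121, 2), (17, 122, 1), (83, 121, 3), (83, 122, 2), (3, 121, 1),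
     (83, 121, 1), (5, 121, 2), (79, 121, 1), (79, 122, 0), (79, 121, 2), (79, 123, 1)]
    (by decide +kernel)

theorem good_125 : Good 125 3 := good_of_check (by norm_num)
    [(61, 122, 1), (61, 123, 0), (61, 122, 3), (5, 125, 0), (61, 122, 2), (11, 122, 1),
     (41, 123, 2), (31, 124, 0), (11, 123, 2), (11, 125, 0), (59, 122, 2), (59, 123, 1),
     (59, 124, 0), (59, 122, 3), (41, 123, 1), (31, 124, 1), (41, 124, 0), (113, 122, 1),
     (113, 122, 0), (113, 122, 3), (109, 122, 3), (109, 122, 2), (109, 123, 1), (109, 124, 0),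
     (107, 122, 0), (107, 122, 2), (107, 123, 2), (103, 122, 2), (103, 122, 1), (103, 124, 1),
     (103, 125, 0), (101, 122, 1), (101, 122, 0), (101, 123, 1), (101, 123, 2), (97, 122, 1),
     (97, 122, 2), (97, 123, 0), (97, 124, 1), (89, 122, 2), (89, 123, 2), (89, 124, 1),
     (89, 123, 0), (29, 122, 1), (29, 123, 0), (29, 122, 2), (29, 124, 1), (83, 122, 3),
     (83, 123, 1), (79, 122, 1), (79, 123, 0), (79, 124, 0), (79, 122, 3), (19, 122, 2),
     (19, 123, 1), (19, 124, 1), (19, 123, 0), (37, 122, 2), (73, 122, 1), (73, 123, 0),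
     (73, 122, 2), (73, 122, 3), (71, 122, 2), (71, 123, 1), (71, 123, 2), (71, 125, 0),
     (23, 122, 1), (67, 122, 3), (67, 123, 0)]
    (by decide +kernel)

theorem good_mono {m g g' : ℕ} (hg : g ≤ g') (h : Good m g) : Good m g' := by
  intro α hα
  refine h α (fun r hr => hα r ?_)
  rw [Finset.mem_Icc] at hr ⊢
  omega

theorem good_one (m : ℕ) (h2 : 2 ≤ m) (h13 : m ≤ 13) : Good m 1 := by
  interval_cases m
  · exact good_of_prime 3 (by norm_num) (by norm_num) (by norm_num)
  · exact good_of_prime 3 (by norm_num) (by norm_num) (by norm_num)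
  · exact good_of_prime 5 (by norm_num) (by norm_num) (by norm_num)
  · exact good_of_prime 5 (by norm_num) (by norm_num) (by norm_num)
  · exact good_of_prime 7 (by norm_num) (by norm_num) (by norm_num)
  · exact good_of_prime 7 (by norm_num) (by norm_num) (by norm_num)
  · exact good_8
  · exact good_9
  · exact good_of_prime 11 (by norm_num) (by norm_num) (by norm_num)
  · exact good_of_prime 11 (by norm_num) (by norm_num) (by norm_num)
  · exact good_of_prime 13 (by norm_num) (by norm_num) (by norm_num)
  · exact good_of_prime 13 (by norm_num) (by norm_num) (by norm_num)

theorem good_range {m : ℕ} (p : ℕ) (hp : p.Prime) (h1 : p - 1 ≤ m) (h2 : m ≤ p + 2) : Good m 3 :=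
  good_of_prime p hp (by omega) h1

theorem good_three (m : ℕ) (h2 : 2 ≤ m) (h128 : m ≤ 128) : Good m 3 := by
  by_cases h13 : m ≤ 13
  · exact good_mono (by norm_num) (good_one m h2 h13)
  have h14 : 14 ≤ m := by omega
  clear h2 h13
  interval_cases m
  all_goals first
    | exact good_26
    | exact good_27
    | exact good_34
    | exact good_35
    | exact good_50
    | exact good_51
    | exact good_56
    | exact good_57
    | exact good_64
    | exact good_65
    | exact good_76
    | exact good_77
    | exact good_86
    | exact good_87
    | exact good_92
    | exact good_93
    | exact good_94
    | exact good_95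
    | exact good_116
    | exact good_117
    | exact good_118
    | exact good_119
    | exact good_120
    | exact good_121
    | exact good_122
    | exact good_123
    | exact good_124
    | exact good_125
    | (refine good_range 13 ?_ ?_ ?_ <;> norm_num; done)
    | (refine good_range 17 ?_ ?_ ?_ <;> norm_num; done)
    | (refine good_range 19 ?_ ?_ ?_ <;> norm_num; done)
    | (refine good_range 23 ?_ ?_ ?_ <;> norm_num; done)
    | (refine good_range 29 ?_ ?_ ?_ <;> norm_num; done)
    | (refine good_range 31 ?_ ?_ ?_ <;> norm_num; done)
    | (refine good_range 37 ?_ ?_ ?_ <;> norm_num; done)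
    | (refine good_range 41 ?_ ?_ ?_ <;> norm_num; done)
    | (refine good_range 43 ?_ ?_ ?_ <;> norm_num; done)
    | (refine good_range 47 ?_ ?_ ?_ <;> norm_num; done)
    | (refine good_range 53 ?_ ?_ ?_ <;> norm_num; done)
    | (refine good_range 59 ?_ ?_ ?_ <;> norm_num; done)
    | (refine good_range 61 ?_ ?_ ?_ <;> norm_num; done)
    | (refine good_range 67 ?_ ?_ ?_ <;> norm_num; done)
    | (refine good_range 71 ?_ ?_ ?_ <;> norm_num; done)
    | (refine good_range 73 ?_ ?_ ?_ <;> norm_num; done)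
    | (refine good_range 79 ?_ ?_ ?_ <;> norm_num; done)
    | (refine good_range 83 ?_ ?_ ?_ <;> norm_num; done)
    | (refine good_range 89 ?_ ?_ ?_ <;> norm_num; done)
    | (refine good_range 97 ?_ ?_ ?_ <;> norm_num; done)
    | (refine good_range 101 ?_ ?_ ?_ <;> norm_num; done)
    | (refine good_range 103 ?_ ?_ ?_ <;> norm_num; done)
    | (refine good_range 107 ?_ ?_ ?_ <;> norm_num; done)
    | (refine good_range 109 ?_ ?_ ?_ <;> norm_num; done)
    | (refine good_range 113 ?_ ?_ ?_ <;> norm_num; done)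
    | (refine good_range 127 ?_ ?_ ?_ <;> norm_num; done)

theorem stmt2 :
    gDef 2 = 0 ∧
    (∀ k : ℕ, 3 ≤ k → k ≤ 13 → gDef k = 1) ∧
    (∀ k : ℕ, 14 ≤ k → k ≤ 128 → gDef k ≤ 3) := by
  refine ⟨?_, ?_, ?_⟩
  · apply Nat.le_zero.1
    apply Nat.sInf_le
    intro m h1 h2 α hα
    obtain rfl : m = 2 := by omega
    exact good_of_prime (m := 2) (g := 0) 3 (by norm_num) (by norm_num) (by norm_num) α hα
  · intro k h3 h13
    have hmem : 1 ∈ {g : ℕ |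
        ∀ m : ℕ, 2 ≤ m → m ≤ k →
          ∀ α : ℕ → Bool,
            (∀ r ∈ Finset.Icc (m - g) m,
              ∑ i ∈ Finset.range (r + 1),
                (-1 : ℤ) ^ i * (r.choose i) * (if α i then 1 else 0) = 0) →
            ∀ i ≤ m, α i = α 0} :=
      fun m h1 h2 α hα => good_one m h1 (by omega) α hα
    apply le_antisymm (Nat.sInf_le hmem)
    by_contra hlt
    have h0 : gDef k = 0 := by
      have h1 : ¬ 1 ≤ gDef k := hlt
      omega
    have hm := Nat.sInf_mem ⟨1, hmem⟩
    change gDef k ∈ _ at hm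
    rw [h0] at hm
    have := hm 3 (by norm_num) h3 (fun i => i == 1 || i == 2) (by
      intro r hr
      obtain rfl : r = 3 := by
        rw [Finset.mem_Icc] at hr
        omega
      decide) 1 (by norm_num)
    exact absurd this (by decide)
  · intro k _ h128
    apply Nat.sInf_le
    intro m h1 h2 α hα
    exact good_three m h1 (by omega) α hα
end
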